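/- Let G be a loopless multigraph, let k be a positive integer, and let S = {S_1, S_2, …, S_h} be a collection of pairwise vertex-disjoint subsets of V(G). If each S_i is 36k-edge-connected in G, then there exist k pairwise edge-disjoint S-forests in G, i.e., k pairwise edge-disjoint subgraphs of G in each of which every S_i is connected. -/

import Mathlib

/-!
Multigraphs are modelled by a vertex type `V`, an edge type `E`, and an
incidence map `ends : E → Sym2 V` giving the (unordered) pair of endpoints
of each edge.  Subgraphs are identified with their edge sets (`Set E`).
-/

namespace SteinerPacking

variable {V E : Type}

/-- The set of edges incident to a vertex `u` (denoted `E(u)` in the paper). -/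
def incEdges (ends : E → Sym2 V) (u : V) : Set E := {e | u ∈ ends e}

/-- The degree `d(u) = |E(u)|` of a vertex. -/
noncomputable def deg (ends : E → Sym2 V) (u : V) : ℕ := (incEdges ends u).ncard

/-- One step along an edge of the edge set `F`. -/
def Step (ends : E → Sym2 V) (F : Set E) (a b : V) : Prop := ∃ e ∈ F, ends e = s(a, b)

/-- `a` and `b` are joined by a walk using only edges in `F`. -/
def Reaches (ends : E → Sym2 V) (F : Set E) (a b : V) : Prop :=
  Relation.ReflTransGen (Step ends F) a b

/-- The vertex set `S` is connected in the subgraph with edge set `F`. -/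
def ConnectsSet (ends : E → Sym2 V) (F : Set E) (S : Set V) : Prop :=
  ∀ a ∈ S, ∀ b ∈ S, Reaches ends F a b

/-- A walk from `u` to `w` given by a list of edges. -/
inductive IsWalk (ends : E → Sym2 V) : V → V → List E → Prop
  | nil (v : V) : IsWalk ends v v []
  | cons {u v w : V} {e : E} {l : List E} :
      ends e = s(u, v) → IsWalk ends v w l → IsWalk ends u w (e :: l)

/-- A path from `u` to `v` using edges of `F` (a walk with no repeated edges). -/
def IsPathIn (ends : E → Sym2 V) (F : Set E) (u v : V) (l : List E) : Prop :=
  IsWalk ends u v l ∧ l.Nodup ∧ ∀ e ∈ l, e ∈ F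

/-- There are `n` pairwise edge-disjoint paths from `u` to `v` inside `F`. -/
def EdgeDisjointPathsIn (ends : E → Sym2 V) (F : Set E) (n : ℕ) (u v : V) : Prop :=
  ∃ P : Fin n → List E, (∀ i, IsPathIn ends F u v (P i)) ∧
    ∀ i j, i ≠ j → ∀ e ∈ P i, e ∉ P j

/-- `S` is `n`-edge-connected in the (sub)graph with edge set `F`:
any two distinct vertices of `S` are joined by `n` edge-disjoint paths. -/
def EdgeConnectedIn (ends : E → Sym2 V) (F : Set E) (S : Set V) (n : ℕ) : Prop :=
  ∀ a ∈ S, ∀ b ∈ S, a ≠ b → EdgeDisjointPathsIn ends F n a b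

/-- A family of subgraphs (edge sets) is pairwise edge-disjoint. -/
def PairwiseEdgeDisjoint {k : ℕ} (H : Fin k → Set E) : Prop :=
  ∀ i j, i ≠ j → Disjoint (H i) (H j)

/-- `v` is a cut vertex of the subgraph with edge set `H`: some two vertices
distinct from `v` are connected in `H` but not after removing `v`. -/
def IsCutVertexOf (ends : E → Sym2 V) (H : Set E) (v : V) : Prop :=
  ∃ a b : V, a ≠ v ∧ b ≠ v ∧ Reaches ends H a b ∧
    ¬ Reaches ends {e ∈ H | v ∉ ends e} a b

/-- A subpartition of `E(v)` into `k` (possibly empty) parts. -/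
def IsSubpartitionAt {k : ℕ} (ends : E → Sym2 V) (v : V) (P : Fin k → Set E) : Prop :=
  (∀ i, P i ⊆ incEdges ends v) ∧ ∀ i j, i ≠ j → Disjoint (P i) (P j)

/-- A balanced partition of `E(v)` into `k` parts: each part has ≥ 2 edges. -/
def IsBalancedPartitionAt {k : ℕ} (ends : E → Sym2 V) (v : V) (P : Fin k → Set E) : Prop :=
  IsSubpartitionAt ends v P ∧ (⋃ i, P i) = incEdges ends v ∧ ∀ i, 2 ≤ (P i).ncard

/-- A balanced subpartition of `E(v)`: one extendable to a balanced partition. -/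
def IsBalancedSubpartitionAt {k : ℕ} (ends : E → Sym2 V) (v : V) (P : Fin k → Set E) : Prop :=
  IsSubpartitionAt ends v P ∧
    ∃ P' : Fin k → Set E, IsBalancedPartitionAt ends v P' ∧ ∀ i, P i ⊆ P' i

/-- The subgraphs `H 1, …, H k` extend the subpartition `P` at `v`:
`P i ⊆ H i` and `v` is not a cut vertex of any `H i`. -/
def Extend {k : ℕ} (ends : E → Sym2 V) (v : V) (P H : Fin k → Set E) : Prop :=
  ∀ i, P i ⊆ H i ∧ ¬ IsCutVertexOf ends (H i) v

/-- The subgraphs `H 1, …, H k` balance the vertex `u`. -/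
def BalanceVertex {k : ℕ} (ends : E → Sym2 V) (H : Fin k → Set E) (u : V) : Prop :=
  IsBalancedSubpartitionAt ends u (fun i => incEdges ends u ∩ H i)

/-- The subgraphs `H 1, …, H k` balance every vertex of `T`. -/
def BalanceSet {k : ℕ} (ends : E → Sym2 V) (H : Fin k → Set E) (T : Set V) : Prop :=
  ∀ u ∈ T, BalanceVertex ends H u

/-- A loopless multigraph. -/
def Loopless (ends : E → Sym2 V) : Prop := ∀ e : E, ¬ (ends e).IsDiag

/-- The set of neighbors of a vertex. -/
def neighbors (ends : E → Sym2 V) (u : V) : Set V := {w | ∃ e, ends e = s(u, w)}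

/-- Rado's theorem on spanning transversals, for a supermodular corank function `a`. -/
theorem exists_small_transversal {ι Ω : Type*} [Fintype ι] [DecidableEq ι] [DecidableEq Ω]
    (a : Finset Ω → ℕ)
    (anti : ∀ S T, S ⊆ T → a T ≤ a S) (sup : ∀ S T, a S + a T ≤ a (S ∪ T) + a (S ∩ T))
    (c : ℕ) (A : ι → Finset Ω) (h : ∀ J : Finset ι, a (J.biUnion A) ≤ c + Jᶜ.card) :
    ∃ A' : ι → Finset Ω, (∀ e, A' e ⊆ A e ∧ (A' e).card ≤ 1) ∧
      a (Finset.univ.biUnion A') ≤ c := by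
  induction hn : ∑ e, (A e).card using Nat.strong_induction_on generalizing A with
  | _ n ih =>
  subst hn
  by_cases hall : ∀ e, (A e).card ≤ 1
  · exact ⟨A, fun e => ⟨subset_rfl, hall e⟩, by simpa using h Finset.univ⟩
  push Not at hall
  obtain ⟨e₀, he₀⟩ := hall
  obtain ⟨x, hx, y, hy, hxy⟩ := Finset.one_lt_card.mp he₀
  have key : ∀ z ∈ A e₀,
      (∀ J : Finset ι, a (J.biUnion (Function.update A e₀ ((A e₀).erase z))) ≤ c + Jᶜ.card) →
      ∃ A' : ι → Finset Ω, (∀ e, A' e ⊆ A e ∧ (A' e).card ≤ 1) ∧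
        a (Finset.univ.biUnion A') ≤ c := by
    intro z hz hJ
    obtain ⟨A', h1, h2⟩ := ih (∑ e, (Function.update A e₀ ((A e₀).erase z) e).card) (by
      apply Finset.sum_lt_sum
      · intro e _
        by_cases he : e = e₀
        · subst he; simpa using Finset.card_le_card (Finset.erase_subset z (A e))
        · simp [he]
      · exact ⟨e₀, Finset.mem_univ _, by simpa using Finset.card_erase_lt_of_mem hz⟩)
      _ hJ rfl
    refine ⟨A', fun e => ⟨(h1 e).1.trans ?_, (h1 e).2⟩, h2⟩
    by_cases he : e = e₀
    · subst he; simpa using Finset.erase_subset z (A e)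
    · simp [he]
  by_contra hcon
  have viol : ∀ z ∈ A e₀, ∃ J : Finset ι, e₀ ∈ J ∧
      c + Jᶜ.card < a (J.biUnion (Function.update A e₀ ((A e₀).erase z))) := by
    intro z hz
    by_contra hno
    push Not at hno
    refine hcon (key z hz fun J => ?_)
    by_cases hJ : e₀ ∈ J
    · exact hno J hJ
    · convert h J using 2
      refine Finset.biUnion_congr rfl fun e he => ?_
      rw [Function.update_of_ne]
      rintro rfl; exact hJ he
  obtain ⟨J₁, hJ₁, hv₁⟩ := viol x hx
  obtain ⟨J₂, hJ₂, hv₂⟩ := viol y hy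
  have s := sup (J₁.biUnion (Function.update A e₀ ((A e₀).erase x)))
    (J₂.biUnion (Function.update A e₀ ((A e₀).erase y)))
  have w1 : (J₁ ∪ J₂).biUnion A ⊆
      J₁.biUnion (Function.update A e₀ ((A e₀).erase x)) ∪
        J₂.biUnion (Function.update A e₀ ((A e₀).erase y)) := by
    intro w hw
    simp only [Finset.mem_biUnion, Finset.mem_union] at hw ⊢
    obtain ⟨e, he, hwe⟩ := hw
    by_cases hee : e = e₀
    · subst hee
      by_cases hwx : w = x
      · exact Or.inr ⟨e, hJ₂, by simp [hwx, hxy]; exact hx⟩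
      · exact Or.inl ⟨e, hJ₁, by simp [hwe, hwx]⟩
    · rcases he with he | he
      · exact Or.inl ⟨e, he, by simpa [hee] using hwe⟩
      · exact Or.inr ⟨e, he, by simpa [hee] using hwe⟩
  have u1 := (anti _ _ w1).trans (h (J₁ ∪ J₂))
  have w2 : ((J₁ ∩ J₂).erase e₀).biUnion A ⊆
      J₁.biUnion (Function.update A e₀ ((A e₀).erase x)) ∩
        J₂.biUnion (Function.update A e₀ ((A e₀).erase y)) := by
    intro w hw
    simp only [Finset.mem_biUnion, Finset.mem_inter, Finset.mem_erase] at hw ⊢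
    obtain ⟨e, ⟨hee, he1, he2⟩, hwe⟩ := hw
    exact ⟨⟨e, he1, by simpa [hee] using hwe⟩, ⟨e, he2, by simpa [hee] using hwe⟩⟩
  have u2 := (anti _ _ w2).trans (h ((J₁ ∩ J₂).erase e₀))
  have c1 := Finset.card_union_add_card_inter J₁ J₂
  have c2 : ((J₁ ∩ J₂).erase e₀).card + 1 = (J₁ ∩ J₂).card :=
    Finset.card_erase_add_one (by simp [hJ₁, hJ₂])
  have k1 := Finset.card_add_card_compl J₁
  have k2 := Finset.card_add_card_compl J₂
  have k3 := Finset.card_add_card_compl (J₁ ∪ J₂)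
  have k4 := Finset.card_add_card_compl ((J₁ ∩ J₂).erase e₀)
  omega

/-- Potentials constant along the pairs chosen in each color and vanishing on the chosen slots. -/
def potentials {k : ℕ} {τ σ : Type*} (U : Finset ((Fin k × τ × τ) ⊕ σ)) :
    Submodule ℚ ((Fin k × τ → ℚ) × (σ → ℚ)) where
  carrier := {p | (∀ i y z, Sum.inl (i, y, z) ∈ U → p.1 (i, y) = p.1 (i, z)) ∧
    ∀ s, Sum.inr s ∈ U → p.2 s = 0}
  add_mem' := by
    rintro p p' ⟨h1, h2⟩ ⟨h1', h2'⟩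
    exact ⟨fun i y z h => by simp [h1 i y z h, h1' i y z h], fun s h => by simp [h2 s h, h2' s h]⟩
  zero_mem' := ⟨fun _ _ _ _ => rfl, fun _ _ => rfl⟩
  smul_mem' := by
    rintro c p ⟨h1, h2⟩
    exact ⟨fun i y z h => by simp [h1 i y z h], fun s h => by simp [h2 s h]⟩

theorem mem_potentials {k : ℕ} {τ σ : Type*} {U : Finset ((Fin k × τ × τ) ⊕ σ)}
    {p : (Fin k × τ → ℚ) × (σ → ℚ)} :
    p ∈ potentials U ↔ (∀ i y z, Sum.inl (i, y, z) ∈ U → p.1 (i, y) = p.1 (i, z)) ∧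
      ∀ s, Sum.inr s ∈ U → p.2 s = 0 := Iff.rfl

theorem potentials_anti {k : ℕ} {τ σ : Type*} {U W : Finset ((Fin k × τ × τ) ⊕ σ)} (h : U ⊆ W) :
    potentials W ≤ potentials U :=
  fun _ hp => ⟨fun i y z hU => hp.1 i y z (h hU), fun s hU => hp.2 s (h hU)⟩

theorem finrank_potentials_supermodular {k : ℕ} {τ σ : Type*} [Fintype τ] [Fintype σ]
    [DecidableEq τ] [DecidableEq σ]
    (U W : Finset ((Fin k × τ × τ) ⊕ σ)) :
    Module.finrank ℚ (potentials U) + Module.finrank ℚ (potentials W) ≤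
      Module.finrank ℚ (potentials (U ∪ W)) + Module.finrank ℚ (potentials (U ∩ W)) := by
  have h := Submodule.finrank_sup_add_finrank_inf_eq (potentials U) (potentials W)
  have h1 : potentials U ⊔ potentials W ≤ potentials (U ∩ W) :=
    sup_le (potentials_anti Finset.inter_subset_left) (potentials_anti Finset.inter_subset_right)
  have h2 : potentials U ⊓ potentials W ≤ potentials (U ∪ W) := by
    rintro p ⟨hp, hp'⟩
    refine ⟨fun i y z hU => ?_, fun s hU => ?_⟩
    · rcases Finset.mem_union.mp hU with hU | hU
      exacts [hp.1 i y z hU, hp'.1 i y z hU]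
    · rcases Finset.mem_union.mp hU with hU | hU
      exacts [hp.2 s hU, hp'.2 s hU]
  have h1' := Submodule.finrank_mono h1
  have h2' := Submodule.finrank_mono h2
  omega

/-- Connectivity by the hyperedges `N e`, `e ∈ J`. -/
def hyperConn {ι τ : Type*} (N : ι → Finset τ) (J : Set ι) : Setoid τ where
  r y z := ∀ X : Set τ, (∀ e ∈ J, ∀ a ∈ N e, ∀ b ∈ N e, (a ∈ X ↔ b ∈ X)) → (y ∈ X ↔ z ∈ X)
  iseqv := ⟨fun _ _ _ => Iff.rfl, fun h X hX => (h X hX).symm,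
    fun h h' X hX => (h X hX).trans (h' X hX)⟩

theorem finrank_le_of_injective_eval {k ℓ : ℕ} {τ υ : Type*} [Fintype τ] [Fintype υ]
    (U : Finset ((Fin k × τ × τ) ⊕ (υ × Fin ℓ))) (r : Setoid τ) [Fintype (Quotient r)]
    (Y : Finset υ)
    (h1 : ∀ p ∈ potentials U, (∀ i c, p.1 (i, Quotient.out (s := r) c) = 0) → ∀ a, p.1 a = 0)
    (h2 : ∀ p ∈ potentials U, ∀ y ∉ Y, ∀ j, p.2 (y, j) = 0) :
    Module.finrank ℚ (potentials U) ≤ k * Fintype.card (Quotient r) + ℓ * Y.card := by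
  let φ : potentials U →ₗ[ℚ]
      ((Fin k × Quotient r → ℚ) × ({y // y ∈ Y} × Fin ℓ → ℚ)) :=
    { toFun := fun p => (fun a => p.1.1 (a.1, a.2.out), fun a => p.1.2 (a.1.1, a.2))
      map_add' := fun _ _ => rfl
      map_smul' := fun _ _ => rfl }
  have inj : Function.Injective φ := by
    rw [injective_iff_map_eq_zero]
    rintro ⟨p, hp⟩ h0
    have e1 : ∀ i c, p.1 (i, Quotient.out c) = 0 := fun i c =>
      congrFun (congrArg Prod.fst h0) (i, c)
    have e2 : ∀ (y : {y // y ∈ Y}) j, p.2 (y.1, j) = 0 := fun y j =>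
      congrFun (congrArg Prod.snd h0) (y, j)
    refine Subtype.ext (Prod.ext (funext fun a => h1 p hp e1 a) (funext fun a => ?_))
    by_cases hy : a.1 ∈ Y
    · exact e2 ⟨a.1, hy⟩ a.2
    · exact h2 p hp a.1 hy a.2
  have h3 := LinearMap.finrank_le_finrank_of_injective inj
  rw [Module.finrank_prod, Module.finrank_fintype_fun_eq_card,
    Module.finrank_fintype_fun_eq_card, Fintype.card_prod, Fintype.card_prod, Fintype.card_fin,
    Fintype.card_fin, Fintype.card_coe, mul_comm Y.card] at h3
  exact h3

theorem not_injective_of_finrank_le {k : ℕ} {τ σ : Type*} [Fintype τ] [Fintype σ]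
    (U : Finset ((Fin k × τ × τ) ⊕ σ)) (hU : Module.finrank ℚ (potentials U) ≤ k)
    (φ : ((Fin k → ℚ) × ℚ) →ₗ[ℚ] ((Fin k × τ → ℚ) × (σ → ℚ)))
    (hmem : ∀ p, φ p ∈ potentials U) : ¬ Function.Injective φ := by
  intro hφ
  have := LinearMap.finrank_le_finrank_of_injective
    (f := φ.codRestrict (potentials U) hmem)
    (fun a b hab => hφ (congrArg Subtype.val hab))
  rw [Module.finrank_prod, Module.finrank_fintype_fun_eq_card, Module.finrank_self,
    Fintype.card_fin] at this
  omega

open Classical in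
theorem connected_of_finrank_le {k : ℕ} {τ σ : Type*} [Fintype τ] [Fintype σ]
    (U : Finset ((Fin k × τ × τ) ⊕ σ)) (hU : Module.finrank ℚ (potentials U) ≤ k)
    (i : Fin k) (X : Set τ) (hX : ∀ y z, Sum.inl (i, y, z) ∈ U → (y ∈ X ↔ z ∈ X))
    (a b : τ) (ha : a ∈ X) : b ∈ X := by
  by_contra hb
  refine not_injective_of_finrank_le U hU
    { toFun := fun p => (fun s => p.1 s.1 + if s.1 = i ∧ s.2 ∈ X then p.2 else 0, 0)
      map_add' := fun p p' => by
        refine Prod.ext (funext fun s => ?_) (by simp)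
        by_cases h : s.1 = i ∧ s.2 ∈ X
        · simp only [if_pos h, Prod.fst_add, Prod.snd_add, Pi.add_apply]; ring
        · simp only [if_neg h, Prod.fst_add, Pi.add_apply]; ring
      map_smul' := fun t p => by
        refine Prod.ext (funext fun s => ?_) (by simp)
        by_cases h : s.1 = i ∧ s.2 ∈ X
        · simp [h, mul_add]
        · simp only [if_neg h, Prod.smul_fst, Pi.smul_apply, RingHom.id_apply, add_zero] } ?_ ?_
  · intro p
    refine mem_potentials.mpr ⟨fun i' y z h => ?_, fun _ _ => rfl⟩
    by_cases hi : i' = i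
    · subst hi
      simp [hX y z h]
    · simp [hi]
  · rw [injective_iff_map_eq_zero]
    rintro ⟨v, t⟩ h0
    have e0 : ∀ i' y, v i' + (if i' = i ∧ y ∈ X then t else 0) = 0 := fun i' y =>
      congrFun (congrArg Prod.fst h0) (i', y)
    have hv : v = 0 := by
      ext i'; simpa [hb] using e0 i' b
    have ht : t = 0 := by
      simpa [hv, ha] using e0 i a
    rw [hv, ht]; rfl

open Classical in
theorem slot_mem_of_finrank_le {k : ℕ} {τ σ : Type*} [Fintype τ] [Fintype σ] [Nonempty τ]
    (U : Finset ((Fin k × τ × τ) ⊕ σ)) (hU : Module.finrank ℚ (potentials U) ≤ k)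
    (s : σ) : Sum.inr s ∈ U := by
  by_contra hno
  refine not_injective_of_finrank_le U hU
    { toFun := fun p => (fun s => p.1 s.1, Pi.single s p.2)
      map_add' := fun p p' => Prod.ext rfl (by simp [Pi.single_add])
      map_smul' := fun t p => Prod.ext rfl (by ext a; by_cases h : a = s <;> simp [h]) } ?_ ?_
  · intro p
    refine mem_potentials.mpr ⟨fun _ _ _ _ => rfl, fun s' hs => ?_⟩
    have : s' ≠ s := by
      rintro rfl; exact hno hs
    simp [this]
  · rw [injective_iff_map_eq_zero]
    rintro ⟨v, t⟩ h0
    have e0 : ∀ i', v i' = 0 := fun i' =>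
      congrFun (congrArg Prod.fst h0) (i', Classical.arbitrary τ)
    have e1 : t = 0 := by
      have := congrFun (congrArg Prod.snd h0) s
      simpa using this
    rw [e1, show v = 0 from funext e0]; rfl

open Classical in
/-- If the partition inequality holds for all partitions `r` and all sets `Y` of slots at singleton
classes, then the hyperedges can be split into `k` connected families of pairs, while `ℓ` hyperedges
are reserved at every slot. -/
theorem exists_packing {ι τ υ : Type*} [Fintype ι] [Fintype τ] [Fintype υ] (k ℓ : ℕ)
    (q : υ → τ) (N : ι → Finset τ) (free : ι → Prop)
    (hyp : ∀ (r : Setoid τ) (Y : Finset υ), (∀ y ∈ Y, ∀ z, r (q y) z → z = q y) →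
      k * Fintype.card (Quotient r) + ℓ * Y.card ≤ k + (Finset.univ.filter fun e : ι =>
        (free e ∧ ∃ y ∈ N e, ∃ z ∈ N e, ¬ r y z) ∨ ∃ y ∈ Y, q y ∈ N e).card) :
    ∃ c : ι → Option ((Fin k × τ × τ) ⊕ (υ × Fin ℓ)),
      (∀ e i y z, c e = some (Sum.inl (i, y, z)) → free e ∧ y ∈ N e ∧ z ∈ N e ∧ y ≠ z) ∧
      (∀ e y j, c e = some (Sum.inr (y, j)) → q y ∈ N e) ∧
      (∀ i, ∀ X : Set τ, (∀ e y z, c e = some (Sum.inl (i, y, z)) → (y ∈ X ↔ z ∈ X)) →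
        ∀ a b, a ∈ X → b ∈ X) ∧
      ∀ y j, ∃ e, c e = some (Sum.inr (y, j)) := by
  obtain ⟨A, memA1, memA2⟩ : ∃ A : ι → Finset ((Fin k × τ × τ) ⊕ (υ × Fin ℓ)),
      (∀ e i y z, Sum.inl (i, y, z) ∈ A e ↔ free e ∧ y ∈ N e ∧ z ∈ N e ∧ y ≠ z) ∧
      ∀ e y j, Sum.inr (y, j) ∈ A e ↔ q y ∈ N e := by
    refine ⟨fun e => Finset.univ.filter fun ω => match ω with
      | Sum.inl (_, y, z) => free e ∧ y ∈ N e ∧ z ∈ N e ∧ y ≠ z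
      | Sum.inr (y, _) => q y ∈ N e, fun e i y z => by simp, fun e y j => by simp⟩
  have bound : ∀ J : Finset ι,
      Module.finrank ℚ (potentials (J.biUnion A)) ≤ k + Jᶜ.card := by
    intro J
    let r := hyperConn N {e | e ∈ J ∧ free e}
    let Y : Finset υ := Finset.univ.filter fun y => ∀ e ∈ J, q y ∉ N e
    have h1 := hyp r Y (by
      intro y hy z hz
      have := (hz {q y} (by
        rintro e ⟨he, -⟩ a ha b hb
        simp only [Y, Finset.mem_filter, Finset.mem_univ, true_and] at hy
        simp only [Set.mem_singleton_iff]
        constructor <;> rintro rfl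
        exacts [absurd ha (hy e he), absurd hb (hy e he)])).mp rfl
      exact this)
    have h2 : (Finset.univ.filter fun e : ι =>
        (free e ∧ ∃ y ∈ N e, ∃ z ∈ N e, ¬ r y z) ∨ ∃ y ∈ Y, q y ∈ N e).card ≤ Jᶜ.card := by
      apply Finset.card_le_card
      intro e he
      rw [Finset.mem_compl]
      intro heJ
      simp only [Finset.mem_filter, Finset.mem_univ, true_and] at he
      rcases he with ⟨hf, y, hy, z, hz, hr⟩ | ⟨y, hy, hye⟩
      · exact hr fun X hX => hX e ⟨heJ, hf⟩ y hy z hz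
      · simp only [Y, Finset.mem_filter, Finset.mem_univ, true_and] at hy
        exact hy e heJ hye
    refine (finrank_le_of_injective_eval (J.biUnion A) r Y ?_ ?_).trans
      (h1.trans (Nat.add_le_add_left h2 k))
    · rintro p hp h0 ⟨i, y⟩
      have hr : r (Quotient.out (Quotient.mk r y)) y := Quotient.mk_out y
      refine (hr {z | p.1 (i, z) = 0} ?_).mp (h0 i _)
      rintro e ⟨he, hf⟩ a ha b hb
      by_cases hab : a = b
      · subst hab; rfl
      have : p.1 (i, a) = p.1 (i, b) := (mem_potentials.mp hp).1 i a b
        (Finset.mem_biUnion.mpr ⟨e, he, (memA1 e i a b).mpr ⟨hf, ha, hb, hab⟩⟩)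
      simp [this]
    · intro p hp y hy j
      simp only [Y, Finset.mem_filter, Finset.mem_univ, true_and] at hy
      push Not at hy
      obtain ⟨e, he, hye⟩ := hy
      exact (mem_potentials.mp hp).2 (y, j)
        (Finset.mem_biUnion.mpr ⟨e, he, (memA2 e y j).mpr hye⟩)
  obtain ⟨A', hA', hsmall⟩ := exists_small_transversal
    (fun U => Module.finrank ℚ (potentials U))
    (fun _ _ h => Submodule.finrank_mono (potentials_anti h))
    finrank_potentials_supermodular k A bound
  obtain ⟨c, hc⟩ : ∃ c : ι → Option ((Fin k × τ × τ) ⊕ (υ × Fin ℓ)),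
      ∀ e ω, c e = some ω ↔ ω ∈ A' e := by
    refine ⟨fun e => if h : (A' e).Nonempty then some h.choose else none, fun e ω => ?_⟩
    by_cases h : (A' e).Nonempty
    · simp only [dif_pos h, Option.some.injEq]
      constructor
      · rintro rfl; exact h.choose_spec
      · intro hω
        exact Finset.card_le_one.mp (hA' e).2 _ h.choose_spec _ hω
    · simp only [dif_neg h]
      simp only [Finset.not_nonempty_iff_eq_empty] at h
      simp [h]
  have hU : ∀ ω, ω ∈ Finset.univ.biUnion A' ↔ ∃ e, c e = some ω := by
    intro ω; simp [hc]
  refine ⟨c, fun e i y z h => (memA1 e i y z).mp ((hA' e).1 ((hc _ _).mp h)),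
    fun e y j h => (memA2 e y j).mp ((hA' e).1 ((hc _ _).mp h)), ?_, ?_⟩
  · intro i X hX a b ha
    refine connected_of_finrank_le _ hsmall i X (fun y z h => ?_) a b ha
    obtain ⟨e, he⟩ := (hU _).mp h
    exact hX e y z he
  · intro y j
    have : Nonempty τ := ⟨q y⟩
    exact (hU _).mp (slot_mem_of_finrank_le _ hsmall (y, j))

section Cuts
variable {V E : Type}

/-- The edge `e` crosses the vertex set `X`. -/
def Crosses (g : E → V × V) (X : Set V) (e : E) : Prop := ¬ ((g e).1 ∈ X ↔ (g e).2 ∈ X)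

open Classical in
/-- The edges crossing `X`. -/
noncomputable def cut [Fintype E] (g : E → V × V) (X : Set V) : Finset E :=
  Finset.univ.filter (Crosses g X)

/-- The number of edges crossing `X`. -/
noncomputable def cutDeg [Fintype E] (g : E → V × V) (X : Set V) : ℕ := (cut g X).card

/-- Some demand pair is separated by `X`. -/
def Splits (D : V → V → Prop) (X : Set V) : Prop := ∃ u ∈ X, ∃ v ∉ X, D u v

/-- `u` is a terminal: it is in demand with some other vertex. -/
def IsTerminal (D : V → V → Prop) (u : V) : Prop := ∃ w, w ≠ u ∧ D u w

/-- Cut formulation of connectivity by the edge set `F`. -/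
def CutConn (g : E → V × V) (F : Finset E) (u v : V) : Prop :=
  ∀ X : Set V, (∀ e ∈ F, ¬ Crosses g X e) → (u ∈ X ↔ v ∈ X)

/-- The vertices of `Z` at which color class `P` or a demand leaves `Z`. -/
def Good (g : E → V × V) (D : V → V → Prop) (Z : Set V) (P : Finset E) (a : V) : Prop :=
  a ∈ Z ∧ ((∃ e ∈ P, a = (g e).1 ∨ a = (g e).2) ∨ ∃ w, w ∉ Z ∧ D a w)

open Classical in
/-- `J` is a packing inside `Z` that extends the colors `P` on the boundary. -/
structure IsPacking [Fintype E] {k : ℕ} (g : E → V × V) (D : V → V → Prop) (Z : Set V)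
    (P J : Fin k → Finset E) : Prop where
  inside : ∀ i, ∀ e ∈ J i, (g e).1 ∈ Z ∧ (g e).2 ∈ Z ∧ (g e).1 ≠ (g e).2
  disj : ∀ i j, i ≠ j → Disjoint (J i) (J j)
  dem : ∀ i, ∀ u ∈ Z, ∀ v ∈ Z, D u v → CutConn g (J i) u v
  good : ∀ i, (P i).Nonempty → ∀ a b, Good g D Z (P i) a → Good g D Z (P i) b →
    CutConn g (J i) a b
  left : ∀ y ∈ Z, IsTerminal D y → cutDeg g {y} = 36 * k →
    4 * k ≤ (cut g {y} \ Finset.univ.biUnion fun i => J i ∪ P i).card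

/-- The image of a graph under a map of its vertices. -/
def mapEnds (g : E → V × V) (f : V → V) (e : E) : V × V := (f (g e).1, f (g e).2)

/-- The image of the demands under a map of the vertices. -/
def mapDem (D : V → V → Prop) (f : V → V) (p q : V) : Prop := ∃ u v, f u = p ∧ f v = q ∧ D u v

open Classical in
/-- The map collapsing `Z` to `z`. -/
noncomputable def collapse (Z : Set V) (z w : V) : V := if w ∈ Z then z else w

theorem collapse_of_mem {Z : Set V} {z w : V} (h : w ∈ Z) : collapse Z z w = z := if_pos h

theorem collapse_of_notMem {Z : Set V} {z w : V} (h : w ∉ Z) : collapse Z z w = w := if_neg h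

theorem CutConn.refl (g : E → V × V) (F : Finset E) (u : V) : CutConn g F u u := fun _ _ => Iff.rfl

theorem CutConn.symm {g : E → V × V} {F : Finset E} {u v : V} (h : CutConn g F u v) :
    CutConn g F v u := fun X hX => (h X hX).symm

theorem CutConn.trans {g : E → V × V} {F : Finset E} {u v w : V} (h : CutConn g F u v)
    (h' : CutConn g F v w) : CutConn g F u w := fun X hX => (h X hX).trans (h' X hX)

theorem CutConn.mono {g : E → V × V} {F F' : Finset E} (hF : F ⊆ F') {u v : V}
    (h : CutConn g F u v) : CutConn g F' u v := fun X hX => h X fun e he => hX e (hF he)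

theorem crosses_mapEnds {g : E → V × V} {f : V → V} {X : Set V} {e : E} :
    Crosses (mapEnds g f) X e ↔ Crosses g (f ⁻¹' X) e := Iff.rfl

theorem splits_mapDem {D : V → V → Prop} {f : V → V} {X : Set V} :
    Splits (mapDem D f) X ↔ Splits D (f ⁻¹' X) := by
  constructor
  · rintro ⟨_, hu, _, hv, u, v, rfl, rfl, h⟩
    exact ⟨u, hu, v, hv, h⟩
  · rintro ⟨u, hu, v, hv, h⟩
    exact ⟨_, hu, _, hv, u, v, rfl, rfl, h⟩

theorem mapDem_symm {D : V → V → Prop} (hD : ∀ u v, D u v → D v u) (f : V → V) :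
    ∀ u v, mapDem D f u v → mapDem D f v u := by
  rintro _ _ ⟨u, v, rfl, rfl, h⟩
  exact ⟨v, u, rfl, rfl, hD _ _ h⟩

theorem splits_compl {D : V → V → Prop} (hD : ∀ u v, D u v → D v u) {X : Set V} :
    Splits D Xᶜ ↔ Splits D X := by
  constructor
  · rintro ⟨u, hu, v, hv, h⟩
    exact ⟨v, not_not.mp hv, u, hu, hD _ _ h⟩
  · rintro ⟨u, hu, v, hv, h⟩
    exact ⟨v, hv, u, not_not.mpr hu, hD _ _ h⟩

theorem splits_singleton {D : V → V → Prop} {u : V} : Splits D {u} ↔ IsTerminal D u := by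
  constructor
  · rintro ⟨u', rfl, v, hv, h⟩
    exact ⟨v, hv, h⟩
  · rintro ⟨w, hw, h⟩
    exact ⟨u, rfl, w, hw, h⟩

theorem crosses_singleton {g : E → V × V} {y : V} {e : E} :
    Crosses g {y} e ↔ ((g e).1 = y ∧ (g e).2 ≠ y) ∨ ((g e).1 ≠ y ∧ (g e).2 = y) := by
  unfold Crosses
  simp only [Set.mem_singleton_iff]
  tauto

variable [Fintype E]

theorem mem_cut {g : E → V × V} {X : Set V} {e : E} : e ∈ cut g X ↔ Crosses g X e := by
  classical
  simp [cut]

theorem cut_mapEnds (g : E → V × V) (f : V → V) (X : Set V) :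
    cut (mapEnds g f) X = cut g (f ⁻¹' X) := by
  ext e; rw [mem_cut, mem_cut, crosses_mapEnds]

theorem cutDeg_mapEnds (g : E → V × V) (f : V → V) (X : Set V) :
    cutDeg (mapEnds g f) X = cutDeg g (f ⁻¹' X) := by
  rw [cutDeg, cut_mapEnds, cutDeg]

theorem cut_compl (g : E → V × V) (X : Set V) : cut g Xᶜ = cut g X := by
  ext e; rw [mem_cut, mem_cut]; unfold Crosses; simp only [Set.mem_compl_iff]; tauto

theorem cutDeg_compl (g : E → V × V) (X : Set V) : cutDeg g Xᶜ = cutDeg g X := by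
  rw [cutDeg, cut_compl, cutDeg]

theorem collapse_preimage_singleton {Z : Set V} {z y : V} (hz : z ∈ Z) (hy : y ∉ Z) :
    collapse Z z ⁻¹' {y} = {y} := by
  ext w
  by_cases hw : w ∈ Z
  · simp only [Set.mem_preimage, Set.mem_singleton_iff, collapse_of_mem hw]
    constructor <;> rintro rfl <;> contradiction
  · simp [collapse_of_notMem hw]

theorem collapse_compl_preimage_singleton {Z : Set V} {x y : V} (hx : x ∉ Z) (hy : y ∈ Z) :
    collapse Zᶜ x ⁻¹' {y} = {y} :=
  collapse_preimage_singleton (Z := Zᶜ) hx (not_not.mpr hy)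

theorem isTerminal_mapDem_collapse {D : V → V → Prop} {Z : Set V} {z y : V} (hz : z ∈ Z)
    (hy : y ∉ Z) : IsTerminal (mapDem D (collapse Z z)) y ↔ IsTerminal D y := by
  rw [← splits_singleton, splits_mapDem, collapse_preimage_singleton hz hy, splits_singleton]

/-- A packing of the graph in which the complement of `Z` is collapsed is a packing inside `Z`. -/
theorem IsPacking.of_collapse_compl {k : ℕ} {g : E → V × V} {D : V → V → Prop} {Z : Set V} {x : V}
    (hx : x ∉ Z) {P J : Fin k → Finset E}
    (h : IsPacking (mapEnds g (collapse Zᶜ x)) (mapDem D (collapse Zᶜ x)) {x}ᶜ P J) :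
    IsPacking g D Z P J := by
  classical
  have key : ∀ w, collapse Zᶜ x w ≠ x → w ∈ Z := by
    intro w hw
    by_contra hwZ
    exact hw (collapse_of_mem hwZ)
  have fix : ∀ w, w ∈ Z → collapse Zᶜ x w = w := fun w hw =>
    collapse_of_notMem (not_not.mpr hw)
  have nex : ∀ w, w ∈ Z → w ∈ ({x}ᶜ : Set V) := by
    rintro w hw rfl; exact hx hw
  have conn : ∀ i u v, CutConn (mapEnds g (collapse Zᶜ x)) (J i) u v → CutConn g (J i) u v := by
    intro i u v hc X hX
    refine hc X fun e he => ?_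
    have hh := h.inside i e he
    have h1 := fix _ (key _ hh.1)
    have h2 := fix _ (key _ hh.2.1)
    have := hX e he
    unfold Crosses mapEnds at *
    simpa only [h1, h2] using this
  refine ⟨fun i e he => ?_, h.disj, fun i u hu v hv huv => ?_, fun i hP a b ha hb => ?_,
    fun y hy hT hd => ?_⟩
  · have hh := h.inside i e he
    exact ⟨key _ hh.1, key _ hh.2.1, fun hne => hh.2.2 (congrArg (collapse Zᶜ x) hne)⟩
  · exact conn _ _ _ (h.dem i u (nex u hu) v (nex v hv) ⟨u, v, fix u hu, fix v hv, huv⟩)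
  · have gd : ∀ a, Good g D Z (P i) a →
        Good (mapEnds g (collapse Zᶜ x)) (mapDem D (collapse Zᶜ x)) {x}ᶜ (P i) a := by
      rintro a ⟨haZ, h | ⟨w, hw, haw⟩⟩
      · obtain ⟨e, he, hae⟩ := h
        refine ⟨nex a haZ, Or.inl ⟨e, he, ?_⟩⟩
        have := fix a haZ
        rcases hae with hae | hae
        · left; rw [hae] at this; rw [hae]; exact this.symm
        · right; rw [hae] at this; rw [hae]; exact this.symm
      · exact ⟨nex a haZ, Or.inr ⟨x, by simp, a, w, fix a haZ, collapse_of_mem hw, haw⟩⟩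
    exact conn _ _ _ (h.good i hP a b (gd a ha) (gd b hb))
  · have := h.left y (nex y hy)
      ((isTerminal_mapDem_collapse (Z := Zᶜ) hx (not_not.mpr hy)).mpr hT)
    rw [cutDeg_mapEnds, cut_mapEnds, collapse_compl_preimage_singleton hx hy] at this
    exact this hd

open Classical in
/-- Gluing a packing of the graph with `Z` collapsed and a packing inside `Z`. -/
theorem IsPacking.glue {k : ℕ} {g : E → V × V} {D : V → V → Prop} (hD : ∀ u v, D u v → D v u)
    {Z : Set V} {x z : V} (hx : x ∉ Z) (hz : z ∈ Z) {P J J' : Fin k → Finset E}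
    (hP : ∀ i, P i ⊆ cut g {x})
    (h : IsPacking (mapEnds g (collapse Z z)) (mapDem D (collapse Z z)) {x}ᶜ P J)
    (h' : IsPacking g D Z (fun i => (J i ∪ P i) ∩ cut g Z) J') :
    IsPacking g D {x}ᶜ P (fun i => J i ∪ J' i) := by
  have fin : ∀ w, w ∈ Z → collapse Z z w = z := fun w hw => collapse_of_mem hw
  have fout : ∀ w, w ∉ Z → collapse Z z w = w := fun w hw => collapse_of_notMem hw
  have zx : z ≠ x := fun h => hx (h ▸ hz)
  have nex : ∀ w, w ∈ Z → w ≠ x := by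
    rintro w hw rfl; exact hx hw
  have fx : ∀ w, collapse Z z w = x ↔ w = x := by
    intro w
    by_cases hw : w ∈ Z
    · rw [fin w hw]; exact ⟨fun h => absurd h zx, fun h => absurd h (nex w hw)⟩
    · rw [fout w hw]
  have PZ : ∀ i, ∀ e ∈ P i, ∀ a ∈ Z, (a = (g e).1 ∨ a = (g e).2) → e ∈ cut g Z := by
    intro i e he a ha hae
    have h1 := hP i he
    rw [mem_cut, crosses_singleton] at h1
    rw [mem_cut]
    unfold Crosses
    rcases hae with rfl | rfl
    · have := nex _ ha
      have h2 : (g e).2 = x := by tauto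
      rw [h2]; tauto
    · have := nex _ ha
      have h2 : (g e).1 = x := by tauto
      rw [h2]; tauto
  have JZ : ∀ i, ∀ e ∈ J i, ¬ ((g e).1 ∈ Z ∧ (g e).2 ∈ Z) := by
    rintro i e he ⟨h1, h2⟩
    exact (h.inside i e he).2.2 (by simp only [mapEnds]; rw [fin _ h1, fin _ h2])
  -- an edge of color `i` leaves `Z` as soon as `z` has to be connected to the outside
  have leave : ∀ i v, v ≠ z → CutConn (mapEnds g (collapse Z z)) (J i) z v →
      ((J i ∪ P i) ∩ cut g Z).Nonempty := by
    intro i v hv hc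
    by_contra hno
    rw [Finset.not_nonempty_iff_eq_empty] at hno
    have := (hc {z} (by
      intro e he
      rw [crosses_mapEnds]
      intro hcr
      have : e ∈ (J i ∪ P i) ∩ cut g Z := by
        refine Finset.mem_inter.mpr ⟨Finset.mem_union_left _ he, mem_cut.mpr ?_⟩
        have hpre : collapse Z z ⁻¹' {z} = Z := by
          ext w
          by_cases hw : w ∈ Z
          · simp [fin w hw, hw]
          · simp only [Set.mem_preimage, fout w hw, Set.mem_singleton_iff, hw, iff_false]
            rintro rfl; exact hw hz
        rwa [hpre] at hcr
      rw [hno] at this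
      simp at this)).mp rfl
    exact hv this
  -- the trace on the collapsed graph of a set closed under both packings
  have trace : ∀ i (X : Set V), (∀ e ∈ J i ∪ J' i, ¬ Crosses g X e) → ∃ X' : Set V,
      (∀ e ∈ J i, ¬ Crosses (mapEnds g (collapse Z z)) X' e) ∧ (∀ w ∉ Z, w ∈ X' ↔ w ∈ X) ∧
      (((J i ∪ P i) ∩ cut g Z).Nonempty →
        ∀ a, Good g D Z ((J i ∪ P i) ∩ cut g Z) a → (z ∈ X' ↔ a ∈ X)) := by
    intro i X hX
    have cl : ∀ e ∈ J' i, ¬ Crosses g X e := fun e he => hX e (Finset.mem_union_right _ he)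
    let X' : Set V := {w | (w ∉ Z ∧ w ∈ X) ∨
      (w = z ∧ ∀ a, Good g D Z ((J i ∪ P i) ∩ cut g Z) a → a ∈ X)}
    have o1 : ∀ w ∉ Z, w ∈ X' ↔ w ∈ X := by
      intro w hw
      have : w ≠ z := by rintro rfl; exact hw hz
      simp [X', hw, this]
    have o2 : ((J i ∪ P i) ∩ cut g Z).Nonempty →
        ∀ a, Good g D Z ((J i ∪ P i) ∩ cut g Z) a → (z ∈ X' ↔ a ∈ X) := by
      intro hne a ha
      have : z ∈ X' ↔ ∀ a, Good g D Z ((J i ∪ P i) ∩ cut g Z) a → a ∈ X := by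
        simp [X', hz]
      rw [this]
      exact ⟨fun hh => hh a ha, fun hh b hb => (h'.good i hne a b ha hb X cl).mp hh⟩
    refine ⟨X', fun e he => ?_, o1, o2⟩
    have hncr := hX e (Finset.mem_union_left _ he)
    have hJZ := JZ i e he
    unfold Crosses at hncr ⊢
    simp only [mapEnds]
    rw [not_not] at hncr ⊢
    by_cases h1 : (g e).1 ∈ Z <;> by_cases h2 : (g e).2 ∈ Z
    · exact absurd ⟨h1, h2⟩ hJZ
    · have hmem : e ∈ (J i ∪ P i) ∩ cut g Z := Finset.mem_inter.mpr
        ⟨Finset.mem_union_left _ he, mem_cut.mpr (by unfold Crosses; tauto)⟩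
      rw [fin _ h1, fout _ h2, o1 _ h2, ← hncr]
      exact o2 ⟨e, hmem⟩ _ ⟨h1, Or.inl ⟨e, hmem, Or.inl rfl⟩⟩
    · have hmem : e ∈ (J i ∪ P i) ∩ cut g Z := Finset.mem_inter.mpr
        ⟨Finset.mem_union_left _ he, mem_cut.mpr (by unfold Crosses; tauto)⟩
      rw [fin _ h2, fout _ h1, o1 _ h1, hncr]
      exact (o2 ⟨e, hmem⟩ _ ⟨h2, Or.inl ⟨e, hmem, Or.inr rfl⟩⟩).symm
    · rw [fout _ h1, fout _ h2, o1 _ h1, o1 _ h2, hncr]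
  refine ⟨fun i e he => ?_, fun i j hij => ?_, fun i u hu v hv huv => ?_,
    fun i hne a b ha hb => ?_, fun y hy hT hd => ?_⟩
  · rcases Finset.mem_union.mp he with he | he
    · obtain ⟨h1, h2, h3⟩ := h.inside i e he
      simp only [mapEnds, Set.mem_compl_iff, Set.mem_singleton_iff, fx] at h1 h2 ⊢
      exact ⟨h1, h2, fun hh => h3 (congrArg (collapse Z z) hh)⟩
    · obtain ⟨h1, h2, h3⟩ := h'.inside i e he
      exact ⟨nex _ h1, nex _ h2, h3⟩
  · have jj : ∀ i j, Disjoint (J i) (J' j) := fun i j => Finset.disjoint_left.mpr fun e he he' =>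
      JZ i e he ⟨(h'.inside j e he').1, (h'.inside j e he').2.1⟩
    rw [Finset.disjoint_union_left, Finset.disjoint_union_right, Finset.disjoint_union_right]
    exact ⟨⟨h.disj i j hij, jj i j⟩, (jj j i).symm, h'.disj i j hij⟩
  · have mixed : ∀ u v, u ∈ Z → v ∉ Z → v ≠ x → D u v → CutConn g (J i ∪ J' i) u v := by
      intro u v hu hv hvx huv X hX
      have hc := h.dem i z zx v hvx ⟨u, v, fin u hu, fout v hv, huv⟩
      obtain ⟨X', h1, h2, h3⟩ := trace i X hX
      rw [← h2 v hv, ← hc X' h1]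
      exact (h3 (leave i v (by rintro rfl; exact hv hz) hc) u ⟨hu, Or.inr ⟨v, hv, huv⟩⟩).symm
    by_cases h1 : u ∈ Z <;> by_cases h2 : v ∈ Z
    · exact (h'.dem i u h1 v h2 huv).mono Finset.subset_union_right
    · exact mixed u v h1 h2 hv huv
    · exact (mixed v u h2 h1 hu (hD _ _ huv)).symm
    · intro X hX
      obtain ⟨X', h3, h4, -⟩ := trace i X hX
      rw [← h4 u h1, ← h4 v h2]
      exact h.dem i u hu v hv ⟨u, v, fout u h1, fout v h2, huv⟩ X' h3
  · have gd : ∀ a, Good g D {x}ᶜ (P i) a →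
        Good (mapEnds g (collapse Z z)) (mapDem D (collapse Z z)) {x}ᶜ (P i) (collapse Z z a) := by
      rintro a ⟨hax, ⟨e, he, hae⟩ | ⟨w, hw, haw⟩⟩
      · refine ⟨fun h => hax ((fx a).mp h), Or.inl ⟨e, he, ?_⟩⟩
        rcases hae with rfl | rfl
        exacts [Or.inl rfl, Or.inr rfl]
      · rw [Set.mem_compl_iff, not_not] at hw
        obtain rfl : w = x := hw
        exact ⟨fun h => hax ((fx a).mp h), Or.inr ⟨w, by simp, a, w, rfl, fout w hx, haw⟩⟩
    have gz : ∀ a ∈ Z, Good g D {x}ᶜ (P i) a → Good g D Z ((J i ∪ P i) ∩ cut g Z) a ∧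
        ((J i ∪ P i) ∩ cut g Z).Nonempty := by
      rintro a haZ ha
      have gda := gd a ha
      obtain ⟨hax, ⟨e, he, hae⟩ | ⟨w, hw, haw⟩⟩ := ha
      · have hmem : e ∈ (J i ∪ P i) ∩ cut g Z :=
          Finset.mem_inter.mpr ⟨Finset.mem_union_right _ he, PZ i e he a haZ hae⟩
        exact ⟨⟨haZ, Or.inl ⟨e, hmem, hae⟩⟩, e, hmem⟩
      · rw [Set.mem_compl_iff, not_not] at hw
        obtain rfl : w = x := hw
        refine ⟨⟨haZ, Or.inr ⟨w, hx, haw⟩⟩, ?_⟩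
        obtain ⟨e, he⟩ := hne
        obtain ⟨p, hp, hpe⟩ : ∃ p, p ≠ w ∧ (p = (g e).1 ∨ p = (g e).2) := by
          have h1 := hP i he
          rw [mem_cut, crosses_singleton] at h1
          rcases h1 with h1 | h1
          · exact ⟨_, h1.2, Or.inr rfl⟩
          · exact ⟨_, h1.1, Or.inl rfl⟩
        by_cases hpZ : p ∈ Z
        · exact ⟨e, Finset.mem_inter.mpr ⟨Finset.mem_union_right _ he, PZ i e he p hpZ hpe⟩⟩
        · have hc := h.good i ⟨e, he⟩ _ _ gda (gd p ⟨hp, Or.inl ⟨e, he, hpe⟩⟩)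
          rw [fin a haZ, fout p hpZ] at hc
          exact leave i p (by rintro rfl; exact hpZ hz) hc
    intro X hX
    obtain ⟨X', h1, h2, h3⟩ := trace i X hX
    have tr : ∀ a, Good g D {x}ᶜ (P i) a → (collapse Z z a ∈ X' ↔ a ∈ X) := by
      intro a ha
      by_cases haZ : a ∈ Z
      · rw [fin a haZ]
        exact h3 (gz a haZ ha).2 a (gz a haZ ha).1
      · rw [fout a haZ, h2 a haZ]
    rw [← tr a ha, ← tr b hb]
    exact h.good i hne _ _ (gd a ha) (gd b hb) X' h1
  · by_cases hyZ : y ∈ Z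
    · refine (h'.left y hyZ hT hd).trans (Finset.card_le_card ?_)
      intro e he
      simp only [Finset.mem_sdiff, Finset.mem_biUnion, Finset.mem_univ, true_and, Finset.mem_union,
        Finset.mem_inter, not_exists, not_or, not_and] at he ⊢
      have hye : y = (g e).1 ∨ y = (g e).2 := by
        have := he.1
        rw [mem_cut, crosses_singleton] at this
        rcases this with h | h
        exacts [Or.inl h.1.symm, Or.inr h.2.symm]
      refine ⟨he.1, fun i => ⟨⟨fun heJ => ?_, (he.2 i).1⟩, fun heP => ?_⟩⟩
      · refine (he.2 i).2 (Or.inl heJ) (mem_cut.mpr ?_)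
        have := JZ i e heJ
        unfold Crosses
        rcases hye with rfl | rfl <;> tauto
      · exact (he.2 i).2 (Or.inr heP) (PZ i e heP y hyZ hye)
    · have hl := h.left y hy ((isTerminal_mapDem_collapse hz hyZ).mpr hT)
      rw [cutDeg_mapEnds, cut_mapEnds, collapse_preimage_singleton hz hyZ] at hl
      refine (hl hd).trans (Finset.card_le_card ?_)
      intro e he
      simp only [Finset.mem_sdiff, Finset.mem_biUnion, Finset.mem_univ, true_and, Finset.mem_union,
        not_exists, not_or] at he ⊢
      refine ⟨he.1, fun i => ⟨⟨(he.2 i).1, fun heJ' => ?_⟩, (he.2 i).2⟩⟩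
      have h1 := h'.inside i e heJ'
      have := he.1
      rw [mem_cut, crosses_singleton] at this
      rcases this with h | h
      · exact hyZ (h.1 ▸ h1.1)
      · exact hyZ (h.2 ▸ h1.2.1)

end Cuts

section Reductions
variable {V E : Type}

/-- The edge `e` is not a loop. -/
def Proper (g : E → V × V) (e : E) : Prop := (g e).1 ≠ (g e).2

theorem crosses_proper {g : E → V × V} {X : Set V} {e : E} (h : Crosses g X e) : Proper g e :=
  fun hne => h (by rw [hne])

open Classical in
/-- The number of edges that are not loops. -/
noncomputable def properCount [Fintype E] (g : E → V × V) : ℕ :=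
  (Finset.univ.filter (Proper g)).card

variable [Fintype E]

open Classical in
/-- The hypotheses under which a packing away from the root `x` extending `P` exists. -/
structure Admissible {k : ℕ} (g : E → V × V) (D : V → V → Prop) (x : V)
    (P : Fin k → Finset E) : Prop where
  symm : ∀ u v, D u v → D v u
  conn : ∀ X, Splits D X → 36 * k ≤ cutDeg g X
  sub : ∀ i, P i ⊆ cut g {x}
  disj : ∀ i j, i ≠ j → Disjoint (P i) (P j)
  root : cutDeg g {x} = 0 ∨ (IsTerminal D x ∧ cutDeg g {x} = 36 * k ∧
    (Finset.univ.biUnion P).card + 4 * k ≤ 36 * k)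

/-- Every admissible instance with fewer proper edges than `g` has a packing. -/
def SmallerSolvable (k : ℕ) (g : E → V × V) (x : V) : Prop :=
  ∀ (g' : E → V × V) (D' : V → V → Prop) (P' : Fin k → Finset E),
    properCount g' < properCount g → Admissible g' D' x P' → ∃ J, IsPacking g' D' {x}ᶜ P' J

theorem properCount_mapEnds_lt {g : E → V × V} {f : V → V} {e : E} (he : Proper g e)
    (hf : f (g e).1 = f (g e).2) : properCount (mapEnds g f) < properCount g := by
  classical
  refine Finset.card_lt_card ⟨fun e' h => ?_, fun h => ?_⟩
  · simp only [Finset.mem_filter, Finset.mem_univ, true_and, Proper, mapEnds] at h ⊢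
    exact fun hne => h (congrArg f hne)
  · have := h (Finset.mem_filter.mpr ⟨Finset.mem_univ e, he⟩)
    simp only [Finset.mem_filter, Finset.mem_univ, true_and, Proper, mapEnds] at this
    exact this hf

theorem collapse_preimage_self {Z : Set V} {z : V} (hz : z ∈ Z) : collapse Z z ⁻¹' {z} = Z := by
  ext w
  by_cases hw : w ∈ Z
  · simp [collapse_of_mem hw, hw]
  · simp only [Set.mem_preimage, collapse_of_notMem hw, Set.mem_singleton_iff, hw, iff_false]
    rintro rfl; exact hw hz

theorem Admissible.collapse {k : ℕ} {g : E → V × V} {D : V → V → Prop} {x : V}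
    {P : Fin k → Finset E} (h : Admissible g D x P) {Z : Set V} {z : V} (hx : x ∉ Z)
    (hz : z ∈ Z) : Admissible (mapEnds g (collapse Z z)) (mapDem D (collapse Z z)) x P := by
  refine ⟨mapDem_symm h.symm _, fun X hX => ?_, fun i => ?_, h.disj, ?_⟩
  · rw [cutDeg_mapEnds]
    exact h.conn _ (splits_mapDem.mp hX)
  · rw [cut_mapEnds, collapse_preimage_singleton hz hx]
    exact h.sub i
  · rw [cutDeg_mapEnds, collapse_preimage_singleton hz hx, isTerminal_mapDem_collapse hz hx]
    exact h.root

open Classical in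
theorem IsPacking.trace_disjoint {k : ℕ} {g : E → V × V} {D : V → V → Prop} {x z : V}
    {P J : Fin k → Finset E} (h : Admissible g D x P) {Z : Set V} (hx : x ∉ Z)
    (hJ : IsPacking (mapEnds g (collapse Z z)) (mapDem D (collapse Z z)) {x}ᶜ P J) (i j : Fin k)
    (hij : i ≠ j) :
    Disjoint ((J i ∪ P i) ∩ cut g Z) ((J j ∪ P j) ∩ cut g Z) := by
  have jp : ∀ i j, Disjoint (J i) (P j) := by
    intro i j
    refine Finset.disjoint_left.mpr fun e he heP => ?_
    obtain ⟨h1, h2, -⟩ := hJ.inside i e he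
    have h3 := h.sub j heP
    rw [mem_cut, crosses_singleton] at h3
    rcases h3 with h3 | h3
    · exact h1 (by simp [mapEnds, h3.1, collapse_of_notMem hx])
    · exact h2 (by simp [mapEnds, h3.2, collapse_of_notMem hx])
  refine Disjoint.mono Finset.inter_subset_left Finset.inter_subset_left ?_
  rw [Finset.disjoint_union_left, Finset.disjoint_union_right, Finset.disjoint_union_right]
  exact ⟨⟨hJ.disj i j hij, jp i j⟩, (jp j i).symm, h.disj i j hij⟩

open Classical in
theorem exists_packing_of_collapse {k : ℕ} {g : E → V × V} {D : V → V → Prop} {x : V}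
    {P : Fin k → Finset E} (h : Admissible g D x P) (ih : SmallerSolvable k g x) {Z : Set V} {z : V}
    (hx : x ∉ Z) (hz : z ∈ Z) (hp : ∃ e, Proper g e ∧ (g e).1 ∈ Z ∧ (g e).2 ∈ Z)
    (H : ∀ J, IsPacking (mapEnds g (SteinerPacking.collapse Z z))
        (mapDem D (SteinerPacking.collapse Z z)) {x}ᶜ P J →
      ∃ J', IsPacking g D Z (fun i => (J i ∪ P i) ∩ cut g Z) J') :
    ∃ J, IsPacking g D {x}ᶜ P J := by
  obtain ⟨e, he, h1, h2⟩ := hp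
  obtain ⟨J, hJ⟩ := ih _ _ P
    (properCount_mapEnds_lt he (f := SteinerPacking.collapse Z z)
      (by rw [collapse_of_mem h1, collapse_of_mem h2])) (h.collapse hx hz)
  obtain ⟨J', hJ'⟩ := H J hJ
  exact ⟨_, hJ.glue h.symm hx hz h.sub hJ'⟩

open Classical in
theorem exists_packing_of_tight {k : ℕ} {g : E → V × V} {D : V → V → Prop} {x : V}
    {P : Fin k → Finset E} (h : Admissible g D x P) (ih : SmallerSolvable k g x) {X : Set V}
    (hs : Splits D X) (hd : cutDeg g X = 36 * k)
    (h1 : ∃ e, Proper g e ∧ (g e).1 ∈ X ∧ (g e).2 ∈ X)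
    (h2 : ∃ e, Proper g e ∧ (g e).1 ∉ X ∧ (g e).2 ∉ X) :
    ∃ J, IsPacking g D {x}ᶜ P J := by
  have main : ∀ Z : Set V, x ∉ Z → Splits D Z → cutDeg g Z = 36 * k →
      (∃ e, Proper g e ∧ (g e).1 ∈ Z ∧ (g e).2 ∈ Z) →
      (∃ e, Proper g e ∧ (g e).1 ∉ Z ∧ (g e).2 ∉ Z) → ∃ J, IsPacking g D {x}ᶜ P J := by
    intro Z hx hs hd h1 h2
    obtain ⟨z, hz, -⟩ := id hs
    refine exists_packing_of_collapse h ih hx hz h1 fun J hJ => ?_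
    obtain ⟨e, he, he1, he2⟩ := h2
    have pre : SteinerPacking.collapse Zᶜ x ⁻¹' {x} = Zᶜ := collapse_preimage_self hx
    have adm : Admissible (mapEnds g (SteinerPacking.collapse Zᶜ x))
        (mapDem D (SteinerPacking.collapse Zᶜ x)) x (fun i => (J i ∪ P i) ∩ cut g Z) := by
      refine ⟨mapDem_symm h.symm _, fun X hX => ?_, fun i => ?_,
        hJ.trace_disjoint h hx, Or.inr ⟨?_, ?_, ?_⟩⟩
      · rw [cutDeg_mapEnds]
        exact h.conn _ (splits_mapDem.mp hX)
      · rw [cut_mapEnds, pre, cut_compl]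
        exact Finset.inter_subset_right
      · rw [← splits_singleton, splits_mapDem, pre, splits_compl h.symm]
        exact hs
      · rw [cutDeg_mapEnds, pre, cutDeg_compl, hd]
      · have hl := hJ.left z (by rintro rfl; exact hx hz)
          (by rw [← splits_singleton, splits_mapDem, collapse_preimage_self hz]; exact hs)
        rw [cutDeg_mapEnds, cut_mapEnds, collapse_preimage_self hz] at hl
        have hl := hl hd
        have hsub : (Finset.univ.biUnion fun i => (J i ∪ P i) ∩ cut g Z) ⊆
            cut g Z ∩ Finset.univ.biUnion fun i => J i ∪ P i := by
          intro e he
          simp only [Finset.mem_biUnion, Finset.mem_univ, true_and, Finset.mem_inter] at he ⊢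
          obtain ⟨i, h1, h2⟩ := he
          exact ⟨h2, i, h1⟩
        have := Finset.card_le_card hsub
        have h3 := Finset.card_inter_add_card_sdiff (cut g Z)
          (Finset.univ.biUnion fun i => J i ∪ P i)
        rw [cutDeg] at hd
        omega
    obtain ⟨J', hJ'⟩ := ih _ _ _
      (properCount_mapEnds_lt he (f := SteinerPacking.collapse Zᶜ x)
        (by rw [collapse_of_mem (Z := Zᶜ) he1, collapse_of_mem (Z := Zᶜ) he2])) adm
    exact ⟨J', hJ'.of_collapse_compl hx⟩
  by_cases hx : x ∈ X
  · refine main Xᶜ (not_not.mpr hx) ((splits_compl h.symm).mpr hs) (by rw [cutDeg_compl, hd]) h2 ?_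
    obtain ⟨e, he, h3, h4⟩ := h1
    exact ⟨e, he, not_not.mpr h3, not_not.mpr h4⟩
  · exact main X hx hs hd h1 h2

open Classical in
theorem exists_packing_of_uncut {k : ℕ} {g : E → V × V} {D : V → V → Prop} {x : V}
    {P : Fin k → Finset E} (h : Admissible g D x P) (ih : SmallerSolvable k g x) {e : E}
    (he : Proper g e)
    (hun : ∀ X, Splits D X → cutDeg g X = 36 * k → ¬ Crosses g X e) :
    ∃ J, IsPacking g D {x}ᶜ P J := by
  let g2 := Function.update g e ((g e).1, (g e).1)
  have ge : ∀ e' ≠ e, g2 e' = g e' := fun e' h => Function.update_of_ne h _ _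
  have gs : g2 e = ((g e).1, (g e).1) := Function.update_self _ _ _
  have crs : ∀ X, ∀ e' ≠ e, (Crosses g2 X e' ↔ Crosses g X e') := by
    intro X e' h; unfold Crosses; rw [ge e' h]
  have cutE : ∀ X, cut g2 X = (cut g X).erase e := by
    intro X
    ext e'
    rw [Finset.mem_erase, mem_cut, mem_cut]
    by_cases h' : e' = e
    · subst h'; unfold Crosses; rw [gs]; simp
    · rw [crs X e' h']; simp [h']
  have cutE' : ∀ X, ¬ Crosses g X e → cut g2 X = cut g X := by
    intro X hX
    rw [cutE, Finset.erase_eq_of_notMem]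
    rwa [mem_cut]
  have xcut : ¬ Crosses g {x} e := by
    rcases h.root with h0 | ⟨hT, hd, -⟩
    · intro hc
      rw [cutDeg, Finset.card_eq_zero] at h0
      have := mem_cut.mpr hc
      rw [h0] at this
      simp at this
    · exact hun _ (splits_singleton.mpr hT) hd
  have eP : ∀ i, e ∉ P i := fun i hi => xcut (mem_cut.mp (h.sub i hi))
  have adm : Admissible g2 D x P := by
    refine ⟨h.symm, fun X hX => ?_, fun i => ?_, h.disj, ?_⟩
    · by_cases hc : Crosses g X e
      · have h1 := h.conn X hX
        have h2 : cutDeg g X ≠ 36 * k := fun h2 => hun X hX h2 hc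
        rw [cutDeg, cutE, Finset.card_erase_of_mem (mem_cut.mpr hc)]
        rw [cutDeg] at h1 h2
        omega
      · rw [cutDeg, cutE' X hc]; exact h.conn X hX
    · rw [cutE' _ xcut]; exact h.sub i
    · have : cutDeg g2 {x} = cutDeg g {x} := by rw [cutDeg, cutE' _ xcut, cutDeg]
      rw [this]; exact h.root
  have lt : properCount g2 < properCount g := by
    refine Finset.card_lt_card ⟨fun e' h => ?_, fun h => ?_⟩
    · simp only [Finset.mem_filter, Finset.mem_univ, true_and, Proper] at h ⊢
      by_cases h' : e' = e
      · subst h'; exact he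
      · rwa [ge e' h'] at h
    · have := h (Finset.mem_filter.mpr ⟨Finset.mem_univ e, he⟩)
      simp only [Finset.mem_filter, Finset.mem_univ, true_and, Proper, gs] at this
      exact this rfl
  obtain ⟨J, hJ⟩ := ih g2 D P lt adm
  have eJ : ∀ i, e ∉ J i := fun i hi => (hJ.inside i e hi).2.2 (by rw [gs])
  have conn : ∀ i u v, CutConn g2 (J i) u v → CutConn g (J i) u v := fun i u v hc X hX =>
    hc X fun e' he' => by
      rw [crs X e' (by rintro rfl; exact eJ i he')]; exact hX e' he'
  have gd : ∀ i a, Good g D {x}ᶜ (P i) a → Good g2 D {x}ᶜ (P i) a := by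
    rintro i a ⟨ha, ⟨e', he', hae⟩ | hw⟩
    · refine ⟨ha, Or.inl ⟨e', he', ?_⟩⟩
      rwa [ge e' (by rintro rfl; exact eP i he')]
    · exact ⟨ha, Or.inr hw⟩
  refine ⟨J, fun i e' he' => ?_, hJ.disj,
    fun i u hu v hv huv => conn _ _ _ (hJ.dem i u hu v hv huv),
    fun i hP a b ha hb => conn _ _ _ (hJ.good i hP a b (gd i a ha) (gd i b hb)),
    fun y hy hT hd => ?_⟩
  · have := hJ.inside i e' he'
    rwa [ge e' (by rintro rfl; exact eJ i he')] at this
  · have hc := hun {y} (splits_singleton.mpr hT) hd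
    have := hJ.left y hy hT
    rw [cutDeg, cutE' _ hc] at this
    exact this hd

/-- In an instance without proper tight cuts all of whose edges are in tight cuts, every edge
has an end that is a terminal of minimum degree. -/
theorem exists_tight_end {k : ℕ} {g : E → V × V} {D : V → V → Prop}
    (hD : ∀ u v, D u v → D v u) (hconn : ∀ X, Splits D X → 36 * k ≤ cutDeg g X)
    (hT : ∀ X, Splits D X → cutDeg g X = 36 * k →
      ¬ ((∃ e, Proper g e ∧ (g e).1 ∈ X ∧ (g e).2 ∈ X) ∧
        ∃ e, Proper g e ∧ (g e).1 ∉ X ∧ (g e).2 ∉ X))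
    {e : E} (he : ∃ X, Splits D X ∧ cutDeg g X = 36 * k ∧ Crosses g X e) :
    ∃ y, (y = (g e).1 ∨ y = (g e).2) ∧ IsTerminal D y ∧ cutDeg g {y} = 36 * k := by
  have main : ∀ X, Splits D X → cutDeg g X = 36 * k → Crosses g X e →
      (¬ ∃ e, Proper g e ∧ (g e).1 ∈ X ∧ (g e).2 ∈ X) →
      ∃ y, (y = (g e).1 ∨ y = (g e).2) ∧ IsTerminal D y ∧ cutDeg g {y} = 36 * k := by
    intro X hs hd hc hin
    obtain ⟨u, hu, v, hv, huv⟩ := hs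
    have hTu : IsTerminal D u := ⟨v, by rintro rfl; exact hv hu, huv⟩
    have hsub : cut g {u} ⊆ cut g X := by
      intro e' he'
      rw [mem_cut] at he' ⊢
      have hpr := crosses_proper he'
      rw [crosses_singleton] at he'
      by_contra hcr
      unfold Crosses at hcr
      rw [not_not] at hcr
      refine hin ⟨e', hpr, ?_⟩
      rcases he' with h | h
      · rw [← hcr, h.1]; exact ⟨hu, hu⟩
      · rw [hcr, h.2]; exact ⟨hu, hu⟩
    have hle := hconn {u} (splits_singleton.mpr hTu)
    have heq : cut g {u} = cut g X := Finset.eq_of_subset_of_card_le hsub (by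
      rw [cutDeg] at hle hd; omega)
    refine ⟨u, ?_, hTu, by rw [cutDeg, heq, ← hd, cutDeg]⟩
    have : e ∈ cut g {u} := by rw [heq, mem_cut]; exact hc
    rw [mem_cut, crosses_singleton] at this
    rcases this with h | h
    exacts [Or.inl h.1.symm, Or.inr h.2.symm]
  obtain ⟨X, hs, hd, hc⟩ := he
  by_cases hin : ∃ e, Proper g e ∧ (g e).1 ∈ X ∧ (g e).2 ∈ X
  · refine main Xᶜ ((splits_compl hD).mpr hs) (by rw [cutDeg_compl, hd]) ?_ ?_
    · rw [← mem_cut, cut_compl, mem_cut]; exact hc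
    · exact fun hout => hT X hs hd ⟨hin, hout⟩
  · exact main X hs hd hc hin

end Reductions

section Splitting
variable {V E : Type}

/-- The edge `e` has ends `s` and `t`. -/
def Joins (g : E → V × V) (e : E) (s t : V) : Prop := g e = (s, t) ∨ g e = (t, s)

theorem Joins.crosses {g : E → V × V} {e : E} {s t : V} (h : Joins g e s t) (X : Set V) :
    Crosses g X e ↔ ¬ (s ∈ X ↔ t ∈ X) := by
  unfold Crosses
  rcases h with h | h <;> rw [h]
  exact not_congr Iff.comm

theorem Joins.symm {g : E → V × V} {e : E} {s t : V} (h : Joins g e s t) : Joins g e t s :=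
  Or.symm h

theorem Joins.end_iff {g : E → V × V} {e : E} {s t : V} (h : Joins g e s t) (a : V) :
    (a = (g e).1 ∨ a = (g e).2) ↔ a = s ∨ a = t := by
  rcases h with h | h <;> rw [h]
  exact or_comm

variable [Fintype E]

open Classical in
/-- Splitting off a pair of edges at a nonterminal `s`. -/
theorem exists_packing_of_splitOff {k : ℕ} {g : E → V × V} {D : V → V → Prop} {x : V}
    {P : Fin k → Finset E} (h : Admissible g D x P) (ih : SmallerSolvable k g x) {s t u : V}
    {e₁ e₂ : E} (h1 : Joins g e₁ s t) (h2 : Joins g e₂ s u) (hne : e₁ ≠ e₂) (hs : ¬ IsTerminal D s)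
    (hsx : s ≠ x) (hux : u ≠ x) (htu : t ≠ u) (hst : s ≠ t) (hsu : s ≠ u)
    (hX : ∀ X, Splits D X → s ∉ X → t ∈ X → u ∈ X → 36 * k + 2 ≤ cutDeg g X) :
    ∃ J, IsPacking g D {x}ᶜ P J := by
  let g2 := Function.update (Function.update g e₁ (t, u)) e₂ (u, u)
  have ge : ∀ e, e ≠ e₁ → e ≠ e₂ → g2 e = g e := fun e h h' => by
    simp only [g2]; rw [Function.update_of_ne h', Function.update_of_ne h]
  have g1 : g2 e₁ = (t, u) := by
    simp only [g2]; rw [Function.update_of_ne hne, Function.update_self]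
  have gs : g2 e₂ = (u, u) := Function.update_self _ _ _
  have j1 : Joins g2 e₁ t u := Or.inl g1
  have crs : ∀ X e, e ≠ e₁ → e ≠ e₂ → (Crosses g2 X e ↔ Crosses g X e) := by
    intro X e h h'; unfold Crosses; rw [ge e h h']
  have crs2 : ∀ X, ¬ Crosses g2 X e₂ := by
    intro X; unfold Crosses; rw [gs]; simp
  have cutother : ∀ X, (u ∈ X ↔ s ∈ X) → cut g2 X = cut g X := by
    intro X hXu
    ext e
    rw [mem_cut, mem_cut]
    by_cases h' : e = e₂
    · subst h'; rw [h2.crosses]; have := crs2 X; tauto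
    by_cases h'' : e = e₁
    · subst h''; rw [h1.crosses, j1.crosses]; tauto
    exact crs X e h'' h'
  have cutx : cut g2 {x} = cut g {x} := cutother _ (by simp [hux, hsx])
  have cutY : ∀ y, y ≠ s → y ≠ u → cut g2 {y} = cut g {y} := fun y hy hy' =>
    cutother _ (by simp [hy.symm, hy'.symm])
  have cutA : ∀ X, (u ∈ X ↔ s ∈ X) ∨ cut g2 X = (cut g X \ {e₁, e₂}) ∨
      cut g2 X = insert e₁ ((cut g X).erase e₂) ∧ e₂ ∈ cut g X ∧ e₁ ∉ cut g X := by
    intro X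
    by_cases hu : (u ∈ X ↔ s ∈ X)
    · exact Or.inl hu
    right
    by_cases ht : (t ∈ X ↔ u ∈ X)
    · left
      ext e
      simp only [Finset.mem_sdiff, Finset.mem_insert, Finset.mem_singleton, mem_cut]
      by_cases h' : e = e₂
      · have := crs2 X; simp [h', this]
      by_cases h'' : e = e₁
      · subst h''; rw [j1.crosses]; simp [ht]
      rw [crs X e h'' h']; simp [h', h'']
    · right
      refine ⟨?_, mem_cut.mpr ((h2.crosses X).mpr (by tauto)), fun hm => ?_⟩
      · ext e
        simp only [Finset.mem_insert, Finset.mem_erase, mem_cut]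
        by_cases h' : e = e₂
        · have := crs2 X; simp [h', this, hne.symm]
        by_cases h'' : e = e₁
        · subst h''; rw [j1.crosses]; simp [ht]
        rw [crs X e h'' h']; simp [h', h'']
      · have := (h1.crosses X).mp (mem_cut.mp hm)
        tauto
  have card3 : ∀ X, e₂ ∈ cut g X → e₁ ∉ cut g X →
      (insert e₁ ((cut g X).erase e₂)).card = (cut g X).card := by
    intro X ha hb
    rw [Finset.card_insert_of_notMem (by simp [hb]), Finset.card_erase_add_one ha]
  have e2P : ∀ i, e₂ ∉ P i := fun i hi => by
    have := mem_cut.mp (h.sub i hi)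
    rw [h2.crosses] at this
    simp [hsx, hux] at this
  have adm : Admissible g2 D x P := by
    refine ⟨h.symm, fun X hXs => ?_, fun i => ?_, h.disj, ?_⟩
    · have h0 := h.conn X hXs
      rcases cutA X with hc | hc | ⟨hc, ha, hb⟩
      · rw [cutDeg, cutother X hc]; exact h0
      · have hle : cutDeg g X ≤ cutDeg g2 X + 2 := by
          rw [cutDeg, cutDeg, hc]
          have := Finset.le_card_sdiff {e₁, e₂} (cut g X)
          rw [Finset.card_pair hne] at this
          omega
        by_cases hu : (u ∈ X ↔ s ∈ X)
        · rw [cutDeg, cutother X hu]; exact h0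
        by_cases ht : (t ∈ X ↔ u ∈ X)
        · by_cases hsX : s ∈ X
          · have := hX Xᶜ ((splits_compl h.symm).mpr hXs) (not_not.mpr hsX) (by
              simp only [Set.mem_compl_iff]; tauto) (by simp only [Set.mem_compl_iff]; tauto)
            rw [cutDeg_compl] at this
            omega
          · have := hX X hXs hsX (by tauto) (by tauto)
            omega
        · exfalso
          have hm : e₁ ∈ cut g2 X := mem_cut.mpr ((j1.crosses X).mpr ht)
          rw [hc] at hm
          simp at hm
      · rw [cutDeg, hc, card3 X ha hb]; exact h0
    · rw [cutx]; exact h.sub i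
    · have : cutDeg g2 {x} = cutDeg g {x} := by rw [cutDeg, cutx, cutDeg]
      rw [this]; exact h.root
  have lt : properCount g2 < properCount g := by
    refine Finset.card_lt_card ⟨fun e h => ?_, fun h => ?_⟩
    · simp only [Finset.mem_filter, Finset.mem_univ, true_and, Proper] at h ⊢
      by_cases h' : e = e₂
      · subst h'; rw [gs] at h; exact absurd rfl h
      by_cases h'' : e = e₁
      · subst h''
        rcases h1 with h1 | h1 <;> rw [h1]
        exacts [hst, hst.symm]
      · rwa [ge e h'' h'] at h
    · have hp : Proper g e₂ := by
        unfold Proper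
        rcases h2 with h2 | h2 <;> rw [h2]
        exacts [hsu, hsu.symm]
      have := h (Finset.mem_filter.mpr ⟨Finset.mem_univ e₂, hp⟩)
      simp only [Finset.mem_filter, Finset.mem_univ, true_and, Proper, gs] at this
      exact this rfl
  obtain ⟨J, hJ⟩ := ih g2 D P lt adm
  have e2J : ∀ i, e₂ ∉ J i := fun i hi => (hJ.inside i e₂ hi).2.2 (by rw [gs])
  let J' : Fin k → Finset E := fun i => if e₁ ∈ J i ∪ P i then insert e₂ (J i) else J i
  have memJ' : ∀ i e, e ∈ J' i ↔ e ∈ J i ∨ (e = e₂ ∧ e₁ ∈ J i ∪ P i) := by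
    intro i e
    simp only [J']
    split_ifs with hh
    · simp only [Finset.mem_insert, hh]; tauto
    · simp [hh]
  have JP : ∀ i j e, e ∈ J i → e ∉ P j := by
    intro i j e he heP
    have h3 := hJ.inside i e he
    have h4 := adm.sub j heP
    rw [mem_cut, crosses_singleton] at h4
    rcases h4 with h4 | h4
    · exact h3.1 h4.1
    · exact h3.2.1 h4.2
  have conn : ∀ i a b, CutConn g2 (J i) a b → CutConn g (J' i) a b := by
    intro i a b hc X hX
    refine hc X fun e he => ?_
    by_cases h' : e = e₂
    · subst h'; exact crs2 X
    by_cases h'' : e = e₁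
    · subst h''
      have ha := hX e ((memJ' i e).mpr (Or.inl he))
      have hb := hX e₂ ((memJ' i e₂).mpr (Or.inr ⟨rfl, Finset.mem_union_left _ he⟩))
      rw [h1.crosses] at ha
      rw [h2.crosses] at hb
      rw [j1.crosses]
      tauto
    · rw [crs X e h'' h']; exact hX e ((memJ' i e).mpr (Or.inl he))
  have gd : ∀ i a, Good g D {x}ᶜ (P i) a →
      ∃ a', Good g2 D {x}ᶜ (P i) a' ∧ CutConn g (J' i) a a' := by
    rintro i a ⟨ha, ⟨e, he, hae⟩ | hw⟩
    · have h' : e ≠ e₂ := by rintro rfl; exact e2P i he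
      by_cases h'' : e = e₁
      · subst h''
        refine ⟨u, ⟨hux, Or.inl ⟨e, he, Or.inr (by rw [g1])⟩⟩, fun X hcl => ?_⟩
        have hc := mem_cut.mp (h.sub i he)
        rw [h1.crosses] at hc
        have htx : t = x := by
          by_contra hne; simp [hne, hsx] at hc
        rw [h1.end_iff] at hae
        have : a = s := by
          rcases hae with hae | hae
          · exact hae
          · exact absurd (hae.trans htx) ha
        subst this
        have hb := hcl e₂ ((memJ' i e₂).mpr (Or.inr ⟨rfl, Finset.mem_union_right _ he⟩))
        rw [h2.crosses] at hb
        tauto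
      · refine ⟨a, ⟨ha, Or.inl ⟨e, he, ?_⟩⟩, CutConn.refl _ _ _⟩
        rwa [ge e h'' h']
    · exact ⟨a, ⟨ha, Or.inr hw⟩, CutConn.refl _ _ _⟩
  refine ⟨J', fun i e he' => ?_, fun i j hij => ?_, fun i a ha b hb hab => conn _ _ _
    (hJ.dem i a ha b hb hab), fun i hP a b ha hb => ?_, fun y hy hT hd => ?_⟩
  · rcases (memJ' i e).mp he' with hm | ⟨rfl, hm⟩
    · have h' : e ≠ e₂ := by rintro rfl; exact e2J i hm
      have := hJ.inside i e hm
      by_cases h'' : e = e₁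
      · subst h''
        rw [g1] at this
        obtain ⟨ha, -, -⟩ := this
        rcases h1 with h1 | h1 <;> rw [h1]
        exacts [⟨hsx, ha, hst⟩, ⟨ha, hsx, hst.symm⟩]
      · rwa [ge e h'' h'] at this
    · rcases h2 with h2 | h2 <;> rw [h2]
      exacts [⟨hsx, hux, hsu⟩, ⟨hux, hsx, hsu.symm⟩]
  · refine Finset.disjoint_left.mpr fun e hi hj => ?_
    rw [memJ'] at hi hj
    rcases hi with hi | ⟨rfl, hi⟩ <;> rcases hj with hj | ⟨hj0, hj⟩
    · exact Finset.disjoint_left.mp (hJ.disj i j hij) hi hj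
    · subst hj0; exact e2J i hi
    · exact e2J j hj
    · rw [Finset.mem_union] at hi hj
      rcases hi with hi | hi <;> rcases hj with hj | hj
      · exact Finset.disjoint_left.mp (hJ.disj i j hij) hi hj
      · exact JP _ _ _ hi hj
      · exact JP _ _ _ hj hi
      · exact Finset.disjoint_left.mp (h.disj i j hij) hi hj
  · obtain ⟨a', ha', hca⟩ := gd i a ha
    obtain ⟨b', hb', hcb⟩ := gd i b hb
    exact (hca.trans (conn _ _ _ (hJ.good i hP a' b' ha' hb'))).trans hcb.symm
  · have hys : y ≠ s := by rintro rfl; exact hs hT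
    have hl := hJ.left y hy hT
    by_cases hyu : y = u
    · subst hyu
      have ha : e₂ ∈ cut g {y} := mem_cut.mpr ((h2.crosses _).mpr (by simp [hsu]))
      have hb : e₁ ∉ cut g {y} := fun hm =>
        absurd (mem_cut.mp hm) (by rw [h1.crosses]; simp [hsu, htu])
      have hc : cut g2 {y} = insert e₁ ((cut g {y}).erase e₂) := by
        rcases cutA {y} with hc | hc | hc
        · simp [hsu] at hc
        · exfalso
          have hm : e₁ ∈ cut g2 {y} := mem_cut.mpr ((j1.crosses _).mpr (by simp [htu]))
          rw [hc] at hm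
          simp at hm
        · exact hc.1
      rw [cutDeg, hc, card3 _ ha hb] at hl
      refine (hl hd).trans ?_
      have hinj : Set.InjOn (fun e => if e = e₁ then e₂ else e)
          ((insert e₁ ((cut g {y}).erase e₂) \ Finset.univ.biUnion fun i => J i ∪ P i :
            Finset E) : Set E) := by
        intro e hem e' hem' hee
        simp only [Finset.coe_sdiff, Set.mem_sdiff, Finset.mem_coe, Finset.mem_insert,
          Finset.mem_erase] at hem hem'
        dsimp only at hee
        split_ifs at hee with ha hb hb
        · rw [ha, hb]
        · exact absurd hee.symm (by tauto)
        · exact absurd hee (by tauto)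
        · exact hee
      rw [← Finset.card_image_of_injOn hinj]
      refine Finset.card_le_card ?_
      intro e hem
      obtain ⟨e', hem', rfl⟩ := Finset.mem_image.mp hem
      simp only [Finset.mem_sdiff, Finset.mem_insert, Finset.mem_erase, Finset.mem_biUnion,
        Finset.mem_univ, true_and, not_exists] at hem' ⊢
      split_ifs with hee
      · subst hee
        refine ⟨ha, fun i hm => ?_⟩
        rw [Finset.mem_union, memJ'] at hm
        rcases hm with (hm | ⟨-, hm⟩) | hm
        · exact e2J i hm
        · exact hem'.2 i hm
        · exact e2P i hm
      · obtain ⟨hm1, hm2⟩ := hem'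
        refine ⟨by tauto, fun i hm => ?_⟩
        have := hm2 i
        rw [Finset.mem_union] at this hm
        rw [memJ'] at hm
        tauto
    · rw [cutDeg, cutY y hys hyu] at hl
      refine (hl hd).trans (Finset.card_le_card ?_)
      intro e hem
      simp only [Finset.mem_sdiff, Finset.mem_biUnion, Finset.mem_univ, true_and,
        not_exists] at hem ⊢
      refine ⟨hem.1, fun i hm => ?_⟩
      rw [Finset.mem_union, memJ'] at hm
      rcases hm with (hm | ⟨rfl, -⟩) | hm
      · exact hem.2 i (Finset.mem_union_left _ hm)
      · have := mem_cut.mp hem.1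
        rw [h2.crosses] at this
        simp [Ne.symm hys, Ne.symm hyu] at this
      · exact hem.2 i (Finset.mem_union_right _ hm)

end Splitting

section CutCounts
variable {V E : Type} [Fintype E]

open Classical in
/-- The number of edges between two vertex sets. -/
noncomputable def between (g : E → V × V) (A B : Set V) : ℕ :=
  (Finset.univ.filter fun e =>
    ((g e).1 ∈ A ∧ (g e).2 ∈ B) ∨ ((g e).1 ∈ B ∧ (g e).2 ∈ A)).card

theorem cutDeg_inter_union (g : E → V × V) (X Y : Set V) :
    cutDeg g (X ∩ Y) + cutDeg g (X ∪ Y) ≤ cutDeg g X + cutDeg g Y := by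
  classical
  simp only [cutDeg, cut, Finset.card_filter, ← Finset.sum_add_distrib]
  refine Finset.sum_le_sum fun e _ => ?_
  unfold Crosses
  by_cases h1 : (g e).1 ∈ X <;> by_cases h2 : (g e).2 ∈ X <;> by_cases h3 : (g e).1 ∈ Y <;>
    by_cases h4 : (g e).2 ∈ Y <;> simp [h1, h2, h3, h4]

theorem cutDeg_sdiff_sdiff (g : E → V × V) (X Y : Set V) :
    cutDeg g (X \ Y) + cutDeg g (Y \ X) + 2 * between g (X ∩ Y) (X ∪ Y)ᶜ ≤
      cutDeg g X + cutDeg g Y := by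
  classical
  simp only [cutDeg, cut, between, Finset.card_filter, ← Finset.sum_add_distrib, Finset.mul_sum]
  refine Finset.sum_le_sum fun e _ => ?_
  unfold Crosses
  by_cases h1 : (g e).1 ∈ X <;> by_cases h2 : (g e).2 ∈ X <;> by_cases h3 : (g e).1 ∈ Y <;>
    by_cases h4 : (g e).2 ∈ Y <;> simp [h1, h2, h3, h4]

theorem cutDeg_union_of_disjoint (g : E → V × V) {A B : Set V} (h : Disjoint A B) :
    cutDeg g (A ∪ B) + 2 * between g A B = cutDeg g A + cutDeg g B := by
  classical
  simp only [cutDeg, cut, between, Finset.card_filter, ← Finset.sum_add_distrib, Finset.mul_sum]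
  refine Finset.sum_congr rfl fun e _ => ?_
  have d1 : (g e).1 ∈ A → (g e).1 ∉ B := fun h1 h2 => Set.disjoint_left.mp h h1 h2
  have d2 : (g e).2 ∈ A → (g e).2 ∉ B := fun h1 h2 => Set.disjoint_left.mp h h1 h2
  unfold Crosses
  by_cases h1 : (g e).1 ∈ A <;> by_cases h2 : (g e).2 ∈ A <;> by_cases h3 : (g e).1 ∈ B <;>
    by_cases h4 : (g e).2 ∈ B <;> simp_all

theorem between_mono (g : E → V × V) {A B A' B' : Set V} (hA : A ⊆ A') (hB : B ⊆ B') :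
    between g A B ≤ between g A' B' := by
  classical
  refine Finset.card_le_card fun e he => ?_
  simp only [Finset.mem_filter, Finset.mem_univ, true_and] at he ⊢
  exact he.imp (fun h => ⟨hA h.1, hB h.2⟩) (fun h => ⟨hB h.1, hA h.2⟩)

theorem between_union_le (g : E → V × V) (A B C : Set V) :
    between g A (B ∪ C) ≤ between g A B + between g A C := by
  classical
  unfold between
  refine (Finset.card_le_card fun e he => ?_).trans (Finset.card_union_le _ _)
  simp only [Finset.mem_filter, Finset.mem_univ, true_and, Finset.mem_union, Set.mem_union] at he ⊢
  tauto

theorem between_union (g : E → V × V) {A B C : Set V} (hBC : Disjoint B C) (hAB : Disjoint A B)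
    (hAC : Disjoint A C) : between g A B + between g A C ≤ between g A (B ∪ C) := by
  classical
  unfold between
  rw [← Finset.card_union_of_disjoint]
  · refine Finset.card_le_card fun e he => ?_
    simp only [Finset.mem_filter, Finset.mem_univ, true_and, Finset.mem_union,
      Set.mem_union] at he ⊢
    tauto
  · refine Finset.disjoint_left.mpr fun e he he' => ?_
    simp only [Finset.mem_filter, Finset.mem_univ, true_and] at he he'
    rw [Set.disjoint_left] at hBC hAB hAC
    rcases he with ⟨h1, h2⟩ | ⟨h1, h2⟩ <;> rcases he' with ⟨h3, h4⟩ | ⟨h3, h4⟩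
    · exact hBC h2 h4
    · exact hAC h1 h3
    · exact hAB h3 h1
    · exact hBC h1 h3

theorem between_comm (g : E → V × V) (A B : Set V) : between g A B = between g B A := by
  classical
  unfold between
  congr 1
  ext e
  simp only [Finset.mem_filter, Finset.mem_univ, true_and]
  tauto

theorem one_le_between {g : E → V × V} {e : E} {s t : V} (h : Joins g e s t) {A B : Set V}
    (hs : s ∈ A) (ht : t ∈ B) : 1 ≤ between g A B := by
  classical
  refine Finset.card_pos.mpr ⟨e, ?_⟩
  simp only [Finset.mem_filter, Finset.mem_univ, true_and]
  rcases h with h | h <;> rw [h]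
  exacts [Or.inl ⟨hs, ht⟩, Or.inr ⟨ht, hs⟩]

theorem splits_uncross {D : V → V → Prop} (hD : ∀ u v, D u v → D v u) {X Y : Set V}
    (hX : Splits D X) (hY : Splits D Y) :
    (Splits D (X ∩ Y) ∧ Splits D (X ∪ Y)) ∨ (Splits D (X \ Y) ∧ Splits D (Y \ X)) := by
  obtain ⟨a, ha, b, hb, hab⟩ := hX
  obtain ⟨p, hp, q, hq, hpq⟩ := hY
  have sp : ∀ W : Set V, ¬ Splits D W → (a ∈ W ↔ b ∈ W) ∧ (p ∈ W ↔ q ∈ W) := by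
    intro W hW
    refine ⟨⟨fun h => ?_, fun h => ?_⟩, ⟨fun h => ?_, fun h => ?_⟩⟩ <;> by_contra h'
    exacts [hW ⟨_, h, _, h', hab⟩, hW ⟨_, h, _, h', hD _ _ hab⟩, hW ⟨_, h, _, h', hpq⟩,
      hW ⟨_, h, _, h', hD _ _ hpq⟩]
  by_contra hcon
  obtain ⟨hc1, hc2⟩ := not_or.mp hcon
  have e1 : (a ∈ X ∩ Y ↔ b ∈ X ∩ Y) ∧ (p ∈ X ∩ Y ↔ q ∈ X ∩ Y) ∨
      (a ∈ X ∪ Y ↔ b ∈ X ∪ Y) ∧ (p ∈ X ∪ Y ↔ q ∈ X ∪ Y) :=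
    (not_and_or.mp hc1).imp (sp _) (sp _)
  have e2 : (a ∈ X \ Y ↔ b ∈ X \ Y) ∧ (p ∈ X \ Y ↔ q ∈ X \ Y) ∨
      (a ∈ Y \ X ↔ b ∈ Y \ X) ∧ (p ∈ Y \ X ↔ q ∈ Y \ X) :=
    (not_and_or.mp hc2).imp (sp _) (sp _)
  clear sp hcon hc1 hc2
  simp only [Set.mem_inter_iff, Set.mem_union, Set.mem_sdiff] at e1 e2
  by_cases h1 : a ∈ Y <;> by_cases h2 : b ∈ Y <;> by_cases h3 : p ∈ X <;> by_cases h4 : q ∈ X <;>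
    simp [h1, h2, h3, h4, ha, hb, hp, hq] at e1 e2

end CutCounts

section Mader
variable {V E : Type} [Fintype E]

/-- `t` is a neighbor of `s`. -/
def Nbr (g : E → V × V) (s t : V) : Prop := t ≠ s ∧ ∃ e, Joins g e s t

/-- No pair of edges at the nonterminal `s` can be split off. -/
structure Stuck (k : ℕ) (g : E → V × V) (D : V → V → Prop) (s : V) : Prop where
  pos : 0 < k
  symm : ∀ u v, D u v → D v u
  conn : ∀ X, Splits D X → 36 * k ≤ cutDeg g X
  tight : ∀ X, Splits D X → cutDeg g X = 36 * k →
      ¬ ((∃ e, Proper g e ∧ (g e).1 ∈ X ∧ (g e).2 ∈ X) ∧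
        ∃ e, Proper g e ∧ (g e).1 ∉ X ∧ (g e).2 ∉ X)
  nonterminal : ¬ IsTerminal D s
  nbr : ∀ t, Nbr g s t → IsTerminal D t ∧ cutDeg g {t} = 36 * k
  bad : ∀ t u, Nbr g s t → Nbr g s u → t ≠ u →
    ∃ X, Splits D X ∧ s ∉ X ∧ t ∈ X ∧ u ∈ X ∧ cutDeg g X ≤ 36 * k + 1

/-- A cut that prevents a pair of edges at `s` from being split off. -/
structure Dangerous (k : ℕ) (g : E → V × V) (D : V → V → Prop) (s : V) (X : Set V) : Prop where
  splits : Splits D X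
  notMem : s ∉ X
  small : cutDeg g X ≤ 36 * k + 1
  nonisolated : ∀ w ∈ X, ∃ e, Crosses g {w} e

theorem exists_crosses_of_cutDeg_pos {g : E → V × V} {X : Set V} (h : 0 < cutDeg g X) :
    ∃ e, Crosses g X e := by
  obtain ⟨e, he⟩ := Finset.card_pos.mp h
  exact ⟨e, mem_cut.mp he⟩

theorem cutDeg_pos_of_crosses {g : E → V × V} {X : Set V} {e : E} (h : Crosses g X e) :
    0 < cutDeg g X := Finset.card_pos.mpr ⟨e, mem_cut.mpr h⟩

theorem between_eq_zero {g : E → V × V} {A B : Set V}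
    (h : ∀ e, (g e).1 ∈ A → (g e).2 ∉ B) (h' : ∀ e, (g e).1 ∈ B → (g e).2 ∉ A) :
    between g A B = 0 := by
  classical
  refine Finset.card_eq_zero.mpr (Finset.filter_eq_empty_iff.mpr fun e _ => ?_)
  rintro (⟨h1, h2⟩ | ⟨h1, h2⟩)
  exacts [h e h1 h2, h' e h1 h2]

theorem between_le_cutDeg (g : E → V × V) {A B : Set V} (h : Disjoint A B) :
    between g A B ≤ cutDeg g A := by
  classical
  refine Finset.card_le_card fun e he => mem_cut.mpr ?_
  simp only [Finset.mem_filter, Finset.mem_univ, true_and] at he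
  rw [Set.disjoint_left] at h
  rcases he with ⟨h1, h2⟩ | ⟨h1, h2⟩
  · exact fun hc => h (hc.mp h1) h2
  · exact fun hc => h (hc.mpr h2) h1

/-- A vertex has at most as many edges as it has towards a set containing all its neighbors. -/
theorem cutDeg_le_between {g : E → V × V} {s : V} {B : Set V} (h : ∀ t, Nbr g s t → t ∈ B) :
    cutDeg g {s} ≤ between g {s} B := by
  classical
  refine Finset.card_le_card fun e he => ?_
  rw [mem_cut, crosses_singleton] at he
  simp only [Finset.mem_filter, Finset.mem_univ, true_and, Set.mem_singleton_iff]
  rcases he with ⟨h1, h2⟩ | ⟨h1, h2⟩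
  · exact Or.inl ⟨h1, h _ ⟨h2, e, Or.inl (Prod.ext h1 rfl)⟩⟩
  · exact Or.inr ⟨h _ ⟨h1, e, Or.inr (Prod.ext rfl h2)⟩, h2⟩

theorem Nbr.one_le_between {g : E → V × V} {s t : V} (h : Nbr g s t) {B : Set V} (ht : t ∈ B) :
    1 ≤ between g {s} B := by
  obtain ⟨-, e, he⟩ := h
  exact SteinerPacking.one_le_between he rfl ht

/-- A cut splits into a vertex and the rest. -/
theorem cutDeg_erase (g : E → V × V) {X : Set V} {t : V} (ht : t ∈ X) :
    cutDeg g X + 2 * between g (X \ {t}) {t} = cutDeg g (X \ {t}) + cutDeg g {t} := by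
  have := cutDeg_union_of_disjoint g (A := X \ {t}) (B := {t}) Set.disjoint_sdiff_left
  rwa [Set.sdiff_union_of_subset (Set.singleton_subset_iff.mpr ht)] at this

/-- A tight cut with an edge on its far side is a single vertex. -/
theorem eq_singleton_of_tight {k : ℕ} {g : E → V × V} {D : V → V → Prop}
    (conn : ∀ X, Splits D X → 36 * k ≤ cutDeg g X)
    (tight : ∀ X, Splits D X → cutDeg g X = 36 * k →
      ¬ ((∃ e, Proper g e ∧ (g e).1 ∈ X ∧ (g e).2 ∈ X) ∧
        ∃ e, Proper g e ∧ (g e).1 ∉ X ∧ (g e).2 ∉ X)) {X : Set V} (hX : Splits D X)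
    (hd : cutDeg g X ≤ 36 * k) (hni : ∀ w ∈ X, ∃ e, Crosses g {w} e)
    (hout : ∃ e, Proper g e ∧ (g e).1 ∉ X ∧ (g e).2 ∉ X) : ∃ u, X = {u} := by
  have hd' := le_antisymm hd (conn X hX)
  have hin : ∀ e, Proper g e → (g e).1 ∈ X → (g e).2 ∉ X := fun e he h1 h2 =>
    tight X hX hd' ⟨⟨e, he, h1, h2⟩, hout⟩
  obtain ⟨u, hu, v, hv, huv⟩ := id hX
  refine ⟨u, Set.eq_singleton_iff_unique_mem.mpr ⟨hu, fun w hw => ?_⟩⟩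
  by_contra hwu
  have h1 := cutDeg_erase g hu
  have h2 : between g (X \ {u}) {u} = 0 := by
    refine between_eq_zero (fun e h h' => ?_) (fun e h h' => ?_)
    · exact hin e (fun hne => h.2 (hne.trans h')) h.1 (h' ▸ hu)
    · exact hin e (fun hne => h'.2 (hne.symm.trans h)) (h ▸ hu) h'.1
  have h3 := conn {u} (splits_singleton.mpr ⟨v, fun h => hv (h ▸ hu), huv⟩)
  obtain ⟨e, he⟩ := hni w hw
  have h4 : 0 < cutDeg g (X \ {u}) := by
    refine cutDeg_pos_of_crosses (e := e) ?_
    have hp := crosses_proper he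
    rcases crosses_singleton.mp he with ⟨h5, h6⟩ | ⟨h5, h6⟩
    · exact fun hc => hin e hp (h5 ▸ hw) (hc.mp (by rw [h5]; exact ⟨hw, hwu⟩)).1
    · exact fun hc => hin e hp (hc.mpr (by rw [h6]; exact ⟨hw, hwu⟩)).1 (h6 ▸ hw)
  omega

namespace Stuck

variable {k : ℕ} {g : E → V × V} {D : V → V → Prop} {s : V}

theorem two_between_le (h : Stuck k g D s) {X : Set V} (hX : Splits D X) (hs : s ∉ X) :
    36 * k + 2 * between g {s} X ≤ cutDeg g X + cutDeg g {s} := by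
  have h1 := cutDeg_union_of_disjoint g (A := {s}) (B := X) (Set.disjoint_singleton_left.mpr hs)
  have h2 : Splits D ({s} ∪ X) := by
    obtain ⟨u, hu, v, hv, huv⟩ := hX
    refine ⟨u, Or.inr hu, v, ?_, huv⟩
    rintro (rfl | hv')
    · exact h.nonterminal ⟨u, fun h => hv (h ▸ hu), h.symm _ _ huv⟩
    · exact hv hv'
  have := h.conn _ h2
  omega

theorem splits_nbr (h : Stuck k g D s) {t : V} (ht : Nbr g s t) : Splits D {t} :=
  splits_singleton.mpr (h.nbr t ht).1

theorem not_subset (h : Stuck k g D s) {X : Set V} (hX : Splits D X) (hs : s ∉ X)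
    (hd : cutDeg g X + 1 ≤ 36 * k + cutDeg g {s}) : ∃ v, Nbr g s v ∧ v ∉ X := by
  by_contra! hcon
  have := cutDeg_le_between hcon
  have := h.two_between_le hX hs
  omega

/-- A neighbor of `s` is not in a set with at most one leaving edge. -/
theorem not_bridge (h : Stuck k g D s) {X : Set V} (hs : s ∉ X) (hd : cutDeg g X ≤ 1) {w : V}
    (hw : Nbr g s w) (hwX : w ∈ X) : False := by
  have hk := h.pos
  obtain ⟨⟨w', hne, hww⟩, hdw⟩ := h.nbr w hw
  by_cases hw' : w' ∈ X
  · have h1 := h.conn (X \ {w}) ⟨w', ⟨hw', hne⟩, w, fun h => h.2 rfl, h.symm _ _ hww⟩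
    have h2 := cutDeg_erase g hwX
    have h3 := between_union g (A := {w}) (B := {s}) (C := X \ {w})
      (Set.disjoint_singleton_left.mpr fun h => hs h.1)
      (Set.disjoint_singleton.mpr hw.1) Set.disjoint_sdiff_right
    have h4 := between_le_cutDeg g (A := {w}) (B := {s} ∪ X \ {w})
      (Set.disjoint_singleton_left.mpr (by rintro (h | h); exacts [hw.1 h, h.2 rfl]))
    have h5 := hw.one_le_between (B := {w}) rfl
    rw [between_comm] at h5
    rw [between_comm] at h2
    omega
  · have := h.conn X ⟨w, hwX, w', hw', hww⟩
    omega

theorem exists_maximal [Finite V] (h : Stuck k g D s) {t u : V} (ht : Nbr g s t) (hu : Nbr g s u)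
    (hne : t ≠ u) : ∃ X, Maximal (Dangerous k g D s) X ∧ t ∈ X ∧ u ∈ X := by
  have hk := h.pos
  obtain ⟨X, hX, hs, htX, huX, hd⟩ := h.bad t u ht hu hne
  have ni : ∀ w, Splits D {w} → ∃ e, Crosses g {w} e := fun w hw =>
    exists_crosses_of_cutDeg_pos (by have := h.conn _ hw; omega)
  have hcut : cutDeg g (X ∩ {w | ∃ e, Crosses g {w} e}) = cutDeg g X := by
    unfold cutDeg
    congr 1
    ext e
    rw [mem_cut, mem_cut]
    by_cases hp : Proper g e
    · have h1 : ∃ e', Crosses g {(g e).1} e' :=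
        ⟨e, crosses_singleton.mpr (Or.inl ⟨rfl, fun h => hp h.symm⟩)⟩
      have h2 : ∃ e', Crosses g {(g e).2} e' :=
        ⟨e, crosses_singleton.mpr (Or.inr ⟨hp, rfl⟩)⟩
      simp only [Crosses, Set.mem_inter_iff, Set.mem_ofPred_eq] at h1 h2 ⊢
      simp only [h1, h2, and_true]
    · exact iff_of_false (fun h => hp (crosses_proper h)) (fun h => hp (crosses_proper h))
  have hdang : Dangerous k g D s (X ∩ {w | ∃ e, Crosses g {w} e}) := by
    obtain ⟨a, ha, b, hb, hab⟩ := hX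
    exact ⟨⟨a, ⟨ha, ni a (splits_singleton.mpr ⟨b, fun h => hb (h ▸ ha), hab⟩)⟩, b,
      fun h => hb h.1, hab⟩, fun h => hs h.1, hcut ▸ hd, fun w hw => hw.2⟩
  obtain ⟨Y, hY, hm⟩ := (Set.toFinite {X | Dangerous k g D s X}).exists_le_maximal hdang
  exact ⟨Y, hm, hY ⟨htX, ni t (h.splits_nbr ht)⟩, hY ⟨huX, ni u (h.splits_nbr hu)⟩⟩

/-- Uncrossing two maximal dangerous sets through their intersection. -/
theorem of_splits_inter (h : Stuck k g D s) (hn : 3 ≤ cutDeg g {s}) {X Y : Set V}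
    (hX : Maximal (Dangerous k g D s) X) (hY : Dangerous k g D s Y) (hYX : ¬ Y ⊆ X) {t : V}
    (htX : t ∈ X) (htY : t ∈ Y) (hI : Splits D (X ∩ Y)) (hU : Splits D (X ∪ Y)) :
    X ∩ Y = {t} ∧ ∃ v, Nbr g s v ∧ v ∉ X ∪ Y := by
  have h1 := cutDeg_inter_union g X Y
  have h2 := hX.prop.small
  have h3 := hY.small
  have h4 := h.conn _ hI
  have hs : s ∉ X ∪ Y := fun hs => hs.elim hX.prop.notMem hY.notMem
  have h5 : 36 * k + 2 ≤ cutDeg g (X ∪ Y) := by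
    by_contra hlt
    have : Dangerous k g D s (X ∪ Y) := ⟨hU, hs, by omega, fun w hw =>
      hw.elim (hX.prop.nonisolated w) (hY.nonisolated w)⟩
    exact hYX (Set.subset_union_right.trans (hX.le_of_ge this Set.subset_union_left))
  obtain ⟨v, hv, hvU⟩ := h.not_subset hU hs (by omega)
  obtain ⟨u, hu⟩ := eq_singleton_of_tight h.conn h.tight hI (by omega)
    (fun w hw => hX.prop.nonisolated w hw.1) (by
      obtain ⟨hvs, e, he⟩ := hv
      refine ⟨e, ?_⟩
      have hv' : v ∉ X ∩ Y := fun h => hvU (Or.inl h.1)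
      have hs' : s ∉ X ∩ Y := fun h => hs (Or.inl h.1)
      rcases he with he | he <;> rw [Proper, he]
      exacts [⟨hvs.symm, hs', hv'⟩, ⟨hvs, hv', hs'⟩])
  have : t ∈ X ∩ Y := ⟨htX, htY⟩
  rw [hu] at this
  obtain rfl : t = u := this
  exact ⟨hu, v, hv, hvU⟩

/-- Uncrossing two dangerous sets through their differences. -/
theorem of_splits_sdiff (h : Stuck k g D s) {X Y : Set V}
    (hX : Dangerous k g D s X) (hY : Dangerous k g D s Y) {t : V} (ht : Nbr g s t)
    (htX : t ∈ X) (htY : t ∈ Y) (hA : Splits D (X \ Y)) (hB : Splits D (Y \ X)) :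
    between g (X ∩ Y) (X ∪ Y)ᶜ = 1 ∧ ∃ u, X \ Y = {u} ∧
      cutDeg g (X ∩ Y) = 1 + 2 * between g (X ∩ Y) {u} := by
  have h1 := cutDeg_sdiff_sdiff g X Y
  have h2 := hX.small
  have h3 := hY.small
  have h4 := h.conn _ hA
  have h5 := h.conn _ hB
  have h6 : 1 ≤ between g (X ∩ Y) (X ∪ Y)ᶜ := by
    obtain ⟨-, e, he⟩ := ht
    exact one_le_between he.symm ⟨htX, htY⟩ (fun h => h.elim hX.notMem hY.notMem)
  obtain ⟨u, hu⟩ := eq_singleton_of_tight h.conn h.tight hA (by omega)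
    (fun w hw => hX.nonisolated w hw.1) (by
      obtain ⟨hts, e, he⟩ := ht
      refine ⟨e, ?_⟩
      have ht' : t ∉ X \ Y := fun h => h.2 htY
      have hs' : s ∉ X \ Y := fun h => hX.notMem h.1
      rcases he with he | he <;> rw [Proper, he]
      exacts [⟨hts.symm, hs', ht'⟩, ⟨hts, ht', hs'⟩])
  refine ⟨by omega, u, hu, ?_⟩
  have h7 := cutDeg_erase g (X := X) (t := u) (hu.ge rfl).1
  have h8 : X \ {u} = X ∩ Y := by rw [← hu, Set.sdiff_sdiff_right_self]
  rw [h8] at h7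
  rw [hu] at h4 h1
  omega

theorem nbr_unique {X Y : Set V} (hsX : s ∉ X) (hsY : s ∉ Y)
    (hb : between g (X ∩ Y) (X ∪ Y)ᶜ = 1) {t w : V} (ht : Nbr g s t)
    (htX : t ∈ X) (htY : t ∈ Y) (hw : Nbr g s w) (hwX : w ∈ X) (hwY : w ∈ Y) : w = t := by
  by_contra hne
  have h1 := between_union g (A := {s}) (B := {t}) (C := {w})
    (Set.disjoint_singleton.mpr (Ne.symm hne)) (Set.disjoint_singleton.mpr ht.1.symm)
    (Set.disjoint_singleton.mpr hw.1.symm)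
  have h2 := between_mono g (A := {t} ∪ {w}) (B := {s}) (A' := X ∩ Y) (B' := (X ∪ Y)ᶜ)
    (by rintro a (rfl | rfl); exacts [⟨htX, htY⟩, ⟨hwX, hwY⟩])
    (by rintro a rfl; exact fun h => h.elim hsX hsY)
  rw [between_comm] at h2
  have h3 := ht.one_le_between (B := {t}) rfl
  have h4 := hw.one_le_between (B := {w}) rfl
  omega

theorem not_splits_sdiff_aux (h : Stuck k g D s) {X Y Z : Set V} (hX : Dangerous k g D s X)
    (hY : Dangerous k g D s Y) (hZ : Dangerous k g D s Z) {t u v w : V} (ht : Nbr g s t)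
    (htX : t ∈ X) (htY : t ∈ Y) (htZ : t ∈ Z) (hu : Nbr g s u) (hXY : X \ Y = {u})
    (hvY : v ∈ Y) (hvX : v ∉ X) (hM : cutDeg g (X ∩ Y) = 1 + 2 * between g (X ∩ Y) {v})
    (hw : w ∉ X ∪ Y) (hwZ : w ∈ Z) (hA : Splits D (X \ Z)) (hB : Splits D (Z \ X)) : False := by
  obtain ⟨hb, u', hu', -⟩ := h.of_splits_sdiff hX hZ ht htX htZ hA hB
  obtain ⟨-, w', hw', -⟩ := h.of_splits_sdiff hZ hX ht htZ htX hB hA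
  have huX : u ∈ X \ Y := hXY.ge rfl
  have huZ : u ∉ Z := by
    intro huZ
    have := nbr_unique hX.notMem hZ.notMem hb ht htX htZ hu huX.1 huZ
    exact huX.2 (this ▸ htY)
  have hwX : w ∈ Z \ X := ⟨hwZ, fun h => hw (Or.inl h)⟩
  have hvZ : v ∉ Z := by
    intro hvZ
    have h1 : v ∈ Z \ X := ⟨hvZ, hvX⟩
    rw [hw'] at h1 hwX
    exact hw (Or.inr ((hwX.trans h1.symm : w = v) ▸ hvY))
  have hXZ : X ∩ Z = X ∩ Y := by
    have h1 : u ∈ X \ Z := ⟨huX.1, huZ⟩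
    rw [hu'] at h1
    obtain rfl : u = u' := h1
    rw [← Set.sdiff_sdiff_right_self, ← Set.sdiff_sdiff_right_self, hu', hXY]
  rw [hXZ] at hb
  have hsv : s ≠ v := fun h => hY.notMem (h ▸ hvY)
  have h1 := between_union g (A := X ∩ Y) (B := {s}) (C := {v}) (Set.disjoint_singleton.mpr hsv)
    (Set.disjoint_singleton_right.mpr fun h => hX.notMem h.1)
    (Set.disjoint_singleton_right.mpr fun h => hvX h.1)
  have h2 := between_mono g (A := X ∩ Y) (B := {s} ∪ {v}) (A' := X ∩ Y) (B' := (X ∪ Z)ᶜ) le_rfl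
    (by
      rintro a (rfl | rfl)
      exacts [fun h => h.elim hX.notMem hZ.notMem, fun h => h.elim hvX hvZ])
  have h3 := ht.one_le_between (B := X ∩ Y) ⟨htX, htY⟩
  rw [between_comm] at h3
  exact h.not_bridge (X := X ∩ Y) (fun h => hX.notMem h.1) (by omega) ht ⟨htX, htY⟩

/-- Two maximal dangerous sets with a common neighbor of `s` do not uncross through their
differences. -/
theorem not_splits_sdiff [Finite V] (h : Stuck k g D s) (hn : 4 ≤ cutDeg g {s}) {X Y : Set V}
    (hX : Maximal (Dangerous k g D s) X) (hY : Maximal (Dangerous k g D s) Y) {t u v : V}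
    (ht : Nbr g s t) (htX : t ∈ X) (htY : t ∈ Y) (hu : Nbr g s u) (huX : u ∈ X) (hut : u ≠ t)
    (hv : Nbr g s v) (hvY : v ∈ Y) (hvt : v ≠ t) (hA : Splits D (X \ Y)) (hB : Splits D (Y \ X)) :
    False := by
  have hk := h.pos
  obtain ⟨hb, u', hu', hMu⟩ := h.of_splits_sdiff hX.prop hY.prop ht htX htY hA hB
  obtain ⟨-, v', hv', hMv⟩ := h.of_splits_sdiff hY.prop hX.prop ht htY htX hB hA
  have hsX := hX.prop.notMem
  have hsY := hY.prop.notMem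
  have huY : u ∉ Y := fun huY => hut (nbr_unique hsX hsY hb ht htX htY hu huX huY)
  have hvX : v ∉ X := fun hvX => hvt (nbr_unique hsX hsY hb ht htX htY hv hvX hvY)
  obtain rfl : u = u' := by have : u ∈ X \ Y := ⟨huX, huY⟩; rwa [hu'] at this
  obtain rfl : v = v' := by have : v ∈ Y \ X := ⟨hvY, hvX⟩; rwa [hv'] at this
  rw [Set.inter_comm] at hMv
  have huv : u ≠ v := fun h => huY (h ▸ hvY)
  by_cases hN : ∃ w, Nbr g s w ∧ w ∉ X ∪ Y
  · obtain ⟨w, hw, hwXY⟩ := hN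
    have htw : t ≠ w := fun h => hwXY (Or.inl (h ▸ htX))
    obtain ⟨Z, hZ, htZ, hwZ⟩ := h.exists_maximal ht hw htw
    rcases splits_uncross h.symm hX.prop.splits hZ.prop.splits with ⟨h1, h2⟩ | ⟨h1, h2⟩
    swap
    · exact h.not_splits_sdiff_aux hX.prop hY.prop hZ.prop ht htX htY htZ hu hu' hvY hvX hMv hwXY
        hwZ h1 h2
    rcases splits_uncross h.symm hY.prop.splits hZ.prop.splits with ⟨h3, h4⟩ | ⟨h3, h4⟩
    swap
    · exact h.not_splits_sdiff_aux hY.prop hX.prop hZ.prop ht htY htX htZ hv hv' huX huY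
        (by rwa [Set.inter_comm]) (by rwa [Set.union_comm]) hwZ h3 h4
    obtain ⟨hXZ, -⟩ := h.of_splits_inter (by omega) hX hZ.prop (fun hc => hwXY (Or.inl (hc hwZ)))
      htX htZ h1 h2
    obtain ⟨hYZ, -⟩ := h.of_splits_inter (by omega) hY hZ.prop (fun hc => hwXY (Or.inr (hc hwZ)))
      htY htZ h3 h4
    have hsZ := hZ.prop.notMem
    have hO : ({s} ∪ Z \ {t} : Set V) ⊆ (X ∪ Y)ᶜ := by
      rintro a (rfl | ⟨ha, hat⟩)
      · exact fun h => h.elim hsX hsY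
      · rintro (haX | haY)
        · exact hat (hXZ.le ⟨haX, ha⟩)
        · exact hat (hYZ.le ⟨haY, ha⟩)
    have h5 := between_mono g (A := {t}) (A' := X ∩ Y) (by rintro a rfl; exact ⟨htX, htY⟩) hO
    have h6 := between_union g (A := {t}) (B := {s}) (C := Z \ {t})
      (Set.disjoint_singleton_left.mpr fun h => hsZ h.1) (Set.disjoint_singleton.mpr ht.1)
      Set.disjoint_sdiff_right
    have h7 := ht.one_le_between (B := {t}) rfl
    have h8 := cutDeg_erase g htZ
    rw [between_comm] at h7 h8
    have h9 := (h.nbr t ht).2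
    have h10 := hZ.prop.small
    exact h.not_bridge (X := Z \ {t}) (fun h => hsZ h.1) (by omega) hw ⟨hwZ, htw.symm⟩
  · push Not at hN
    have hcov : ∀ w, Nbr g s w → w ∈ ({t} ∪ ({u} ∪ {v}) : Set V) := by
      intro w hw
      by_cases hwX : w ∈ X
      · by_cases hwY : w ∈ Y
        · exact Or.inl (nbr_unique hsX hsY hb ht htX htY hw hwX hwY)
        · exact Or.inr (Or.inl (hu'.le ⟨hwX, hwY⟩))
      · exact Or.inr (Or.inr (hv'.le ⟨(hN w hw).resolve_left hwX, hwX⟩))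
    have h1 := cutDeg_le_between hcov
    have h2 := between_union_le g {s} {t} ({u} ∪ {v})
    have h3 := between_union_le g {s} {u} {v}
    have h4 := h.two_between_le hX.prop.splits hsX
    have h5 := h.two_between_le hY.prop.splits hsY
    have h6 := between_mono g (A := {s}) (A' := {s}) (B := {t} ∪ {u}) (B' := X) le_rfl
      (by rintro a (rfl | rfl) <;> assumption)
    have h7 := between_mono g (A := {s}) (A' := {s}) (B := {t} ∪ {v}) (B' := Y) le_rfl
      (by rintro a (rfl | rfl) <;> assumption)
    have h8 := between_union g (A := {s}) (B := {t}) (C := {u})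
      (Set.disjoint_singleton.mpr hut.symm) (Set.disjoint_singleton.mpr ht.1.symm)
      (Set.disjoint_singleton.mpr hu.1.symm)
    have h9 := between_union g (A := {s}) (B := {t}) (C := {v})
      (Set.disjoint_singleton.mpr hvt.symm) (Set.disjoint_singleton.mpr ht.1.symm)
      (Set.disjoint_singleton.mpr hv.1.symm)
    have h10 := hX.prop.small
    have h11 := hY.prop.small
    have h12 : between g {s} {t} ≤ 1 := by
      rw [between_comm, ← hb]
      exact between_mono g (by rintro a rfl; exact ⟨htX, htY⟩)
        (by rintro a rfl; exact fun h => h.elim hsX hsY)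
    have h13 : 2 ≤ between g {s} {u} := by
      have := ht.one_le_between (B := {t}) rfl
      omega
    obtain ⟨X₁, hX₁, huX₁, hvX₁⟩ := h.exists_maximal hu hv huv
    obtain ⟨X₂, hX₂, huX₂, htX₂⟩ := h.exists_maximal hu ht hut
    have htX₁ : t ∉ X₁ := by
      intro htX₁
      have := hX₁.prop.small
      obtain ⟨w, hw, hwX₁⟩ := h.not_subset hX₁.prop.splits hX₁.prop.notMem (by omega)
      rcases hcov w hw with rfl | rfl | rfl <;> exact hwX₁ (by assumption)
    rcases splits_uncross h.symm hX₁.prop.splits hX₂.prop.splits with ⟨h14, h15⟩ | ⟨h14, h15⟩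
    · obtain ⟨-, w, hw, hwX⟩ := h.of_splits_inter (by omega) hX₁ hX₂.prop
        (fun hc => htX₁ (hc htX₂)) huX₁ huX₂ h14 h15
      rcases hcov w hw with rfl | rfl | rfl
      exacts [hwX (Or.inr htX₂), hwX (Or.inl huX₁), hwX (Or.inl hvX₁)]
    · obtain ⟨hb', -⟩ := h.of_splits_sdiff hX₁.prop hX₂.prop hu huX₁ huX₂ h14 h15
      have h16 := between_mono g (A := {u}) (B := {s}) (A' := X₁ ∩ X₂) (B' := (X₁ ∪ X₂)ᶜ)
        (by rintro a rfl; exact ⟨huX₁, huX₂⟩)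
        (by rintro a rfl; exact fun h => h.elim hX₁.prop.notMem hX₂.prop.notMem)
      rw [between_comm] at h16
      omega

theorem not_two_nonsplit [Finite V] (h : Stuck k g D s) (hn : 4 ≤ cutDeg g {s}) {X Y : Set V}
    (hX : Maximal (Dangerous k g D s) X) (hY : Maximal (Dangerous k g D s) Y) {t u v : V}
    (ht : Nbr g s t) (hXY : X ∩ Y = {t}) (hu : Nbr g s u) (huX : u ∈ X) (hut : u ≠ t)
    (hv : Nbr g s v) (hvY : v ∈ Y) (hvt : v ≠ t) (hA : ¬ Splits D (X \ {t}))
    (hB : ¬ Splits D (Y \ {t})) : False := by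
  obtain ⟨htX, htY⟩ : t ∈ X ∩ Y := hXY.ge rfl
  have partner : ∀ Z : Set V, ¬ Splits D (Z \ {t}) → ∀ a, Nbr g s a → a ∈ Z → a ≠ t →
      ∃ b, b ≠ a ∧ D a b ∧ b ∈ Z ∧ b ≠ t := by
    intro Z hZ a ha haZ hat
    obtain ⟨b, hb, hab⟩ := (h.nbr a ha).1
    by_contra! hc
    exact hZ ⟨a, ⟨haZ, hat⟩, b, fun h' => h'.2 (hc b hb hab h'.1), hab⟩
  obtain ⟨u', hu'u, huu', hu'X, hu't⟩ := partner X hA u hu huX hut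
  obtain ⟨v', hv'v, hvv', hv'Y, hv't⟩ := partner Y hB v hv hvY hvt
  have huY : u ∉ Y := fun hc => hut (hXY.le ⟨huX, hc⟩)
  have hvX : v ∉ X := fun hc => hvt (hXY.le ⟨hc, hvY⟩)
  have huv : u ≠ v := fun hc => huY (hc ▸ hvY)
  obtain ⟨W, hW, huW, hvW⟩ := h.exists_maximal hu hv huv
  have cl1 := h.not_splits_sdiff hn hX hW hu huX huW ht htX hut.symm hv hvW huv.symm
  have cl2 := h.not_splits_sdiff hn hY hW hv hvY hvW ht htY hvt.symm hu huW huv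
  have hXW : X ∩ W = {u} := by
    rcases splits_uncross h.symm hX.prop.splits hW.prop.splits with ⟨h1, h2⟩ | ⟨h1, h2⟩
    · exact (h.of_splits_inter (by omega) hX hW.prop (fun hc => hvX (hc hvW)) huX huW h1 h2).1
    · exact (cl1 h1 h2).elim
  have hYW : Y ∩ W = {v} := by
    rcases splits_uncross h.symm hY.prop.splits hW.prop.splits with ⟨h1, h2⟩ | ⟨h1, h2⟩
    · exact (h.of_splits_inter (by omega) hY hW.prop (fun hc => huY (hc huW)) hvY hvW h1 h2).1
    · exact (cl2 h1 h2).elim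
  refine cl1 ⟨u', ⟨hu'X, fun hc => hu'u (hXW.le ⟨hu'X, hc⟩)⟩, u, fun hc => hc.2 huW,
    h.symm _ _ huu'⟩ ⟨v, ⟨hvW, hvX⟩, v', fun hc => hv'v (hYW.le ⟨hv'Y, hc.1⟩), hvv'⟩

/-- If no pair of edges at `s` can be split off then `s` is isolated or has degree three and three
neighbors. -/
theorem cutDeg_eq [Finite V] (h : Stuck k g D s) : cutDeg g {s} = 0 ∨
    (cutDeg g {s} = 3 ∧ ∃ t u v, Nbr g s t ∧ Nbr g s u ∧ Nbr g s v ∧ t ≠ u ∧ t ≠ v ∧ u ≠ v) := by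
  rcases Nat.eq_zero_or_pos (cutDeg g {s}) with h0 | hpos
  · exact Or.inl h0
  refine Or.inr ?_
  have hN : ∃ t, Nbr g s t := by
    by_contra! hc
    have h1 := cutDeg_le_between (g := g) (s := s) (B := ∅) fun t ht => (hc t ht).elim
    rw [between_eq_zero (fun _ _ h => Set.notMem_empty _ h)
      (fun _ h => (Set.notMem_empty _ h).elim)]
      at h1
    omega
  obtain ⟨t, ht⟩ := hN
  have hst : s ∉ ({t} : Set V) := ht.1.symm
  have hn2 : 2 ≤ cutDeg g {s} := by
    have h1 := h.two_between_le (h.splits_nbr ht) hst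
    have h2 := ht.one_le_between (B := {t}) rfl
    rw [(h.nbr t ht).2] at h1
    omega
  obtain ⟨u, hu, hut⟩ := h.not_subset (h.splits_nbr ht) hst (by rw [(h.nbr t ht).2]; omega)
  obtain ⟨X, hX, htX, huX⟩ := h.exists_maximal ht hu (Ne.symm hut)
  have hXs := hX.prop.small
  obtain ⟨v, hv, hvX⟩ := h.not_subset hX.prop.splits hX.prop.notMem (by omega)
  have htv : t ≠ v := fun hc => hvX (hc ▸ htX)
  have hn3 : 3 ≤ cutDeg g {s} := by
    have h1 := h.two_between_le hX.prop.splits hX.prop.notMem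
    have h2 := between_union g (A := {s}) (B := {t}) (C := {u})
      (Set.disjoint_singleton.mpr (Ne.symm hut)) (Set.disjoint_singleton.mpr ht.1.symm)
      (Set.disjoint_singleton.mpr hu.1.symm)
    have h3 := between_mono g (A := {s}) (A' := {s}) (B := {t} ∪ {u}) (B' := X) le_rfl
      (by rintro a (rfl | rfl) <;> assumption)
    have h4 := ht.one_le_between (B := {t}) rfl
    have h5 := hu.one_le_between (B := {u}) rfl
    omega
  rcases hn3.eq_or_lt with h3 | hn
  · exact ⟨h3.symm, t, u, v, ht, hu, hv, Ne.symm hut, htv, fun hc => hvX (hc ▸ huX)⟩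
  exfalso
  have pair : ∀ {X Y : Set V} {u v}, Maximal (Dangerous k g D s) X → Maximal (Dangerous k g D s) Y →
      t ∈ X → t ∈ Y → Nbr g s u → u ∈ X → u ≠ t → Nbr g s v → v ∈ Y → v ≠ t → v ∉ X →
      (X ∩ Y = {t} ∧ ∃ w, Nbr g s w ∧ w ∉ X ∪ Y) ∧
        ¬ (Splits D (X \ {t}) ∧ Splits D (Y \ {t})) := by
    intro X Y u v hX hY htX htY hu huX hut hv hvY hvt hvX
    have cl := h.not_splits_sdiff hn hX hY ht htX htY hu huX hut hv hvY hvt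
    rcases splits_uncross h.symm hX.prop.splits hY.prop.splits with ⟨h1, h2⟩ | ⟨h1, h2⟩
    · have h3 := h.of_splits_inter hn3 hX hY.prop (fun hc => hvX (hc hvY)) htX htY h1 h2
      refine ⟨h3, fun hc => cl ?_ ?_⟩
      · rw [← Set.sdiff_inter_self_eq_sdiff, Set.inter_comm, h3.1]; exact hc.1
      · rw [← Set.sdiff_inter_self_eq_sdiff, h3.1]; exact hc.2
    · exact (cl h1 h2).elim
  obtain ⟨Y, hY, htY, hvY⟩ := h.exists_maximal ht hv htv
  obtain ⟨⟨hXY, w, hw, hwXY⟩, p1⟩ := pair hX hY htX htY hu huX hut hv hvY htv.symm hvX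
  have htw : t ≠ w := fun hc => hwXY (Or.inl (hc ▸ htX))
  obtain ⟨Z, hZ, htZ, hwZ⟩ := h.exists_maximal ht hw htw
  obtain ⟨⟨hXZ, -⟩, p2⟩ := pair hX hZ htX htZ hu huX hut hw hwZ htw.symm fun hc => hwXY (Or.inl hc)
  obtain ⟨⟨hYZ, -⟩, p3⟩ :=
    pair hY hZ htY htZ hv hvY htv.symm hw hwZ htw.symm fun hc => hwXY (Or.inr hc)
  by_cases hSX : Splits D (X \ {t})
  · exact h.not_two_nonsplit hn hY hZ ht hYZ hv hvY htv.symm hw hwZ htw.symm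
      (fun hc => p1 ⟨hSX, hc⟩) (fun hc => p2 ⟨hSX, hc⟩)
  · by_cases hSY : Splits D (Y \ {t})
    · exact h.not_two_nonsplit hn hX hZ ht hXZ hu huX hut hw hwZ htw.symm hSX
        (fun hc => p3 ⟨hSY, hc⟩)
    · exact h.not_two_nonsplit hn hX hY ht hXY hu huX hut hv hvY htv.symm hSX hSY

end Stuck
end Mader

section Elements
variable {V E : Type}

/-- Every edge has a terminal end, and every nonisolated nonterminal has three edges, to distinct
terminals. -/
structure Reduced (g : E → V × V) (D : V → V → Prop) : Prop where
  terminal : ∀ e, Proper g e → IsTerminal D (g e).1 ∨ IsTerminal D (g e).2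
  cubic : ∀ u e, ¬ IsTerminal D u → Crosses g {u} e →
    ∃ e₁ e₂ e₃ t₁ t₂ t₃, Joins g e₁ u t₁ ∧ Joins g e₂ u t₂ ∧ Joins g e₃ u t₃ ∧
      t₁ ≠ t₂ ∧ t₁ ≠ t₃ ∧ t₂ ≠ t₃ ∧ IsTerminal D t₁ ∧ IsTerminal D t₂ ∧ IsTerminal D t₃ ∧
      ∀ e, Crosses g {u} e → e = e₁ ∨ e = e₂ ∨ e = e₃

/-- The terminals of `A` that an element of a piece can connect: an element is either a nonterminal
of `A` or an edge outside `B` without a nonterminal end in `A`. -/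
def touched (g : E → V × V) (D : V → V → Prop) (A : Set V) (B : Finset E) : V ⊕ E → Set V
  | .inl u => {y | y ∈ A ∧ u ∈ A ∧ ¬ IsTerminal D u ∧ Nbr g u y}
  | .inr e => {y | y ∈ A ∧ IsTerminal D y ∧ Crosses g {y} e ∧ e ∉ B ∧
      ∀ u ∈ A, Crosses g {u} e → IsTerminal D u}

/-- An element is free if it has no edge in `B`. -/
def IsFree (g : E → V × V) (B : Finset E) : V ⊕ E → Prop
  | .inl u => ∀ e ∈ B, ¬ Crosses g {u} e
  | .inr _ => True

/-- The element `a` is free and connects terminals with different values of `f`. -/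
def Links {κ : Type} (g : E → V × V) (D : V → V → Prop) (A : Set V) (B : Finset E) (f : V → κ)
    (a : V ⊕ E) : Prop :=
  IsFree g B a ∧ ∃ y ∈ touched g D A B a, ∃ z ∈ touched g D A B a, f y ≠ f z

/-- The terminals of `A` of value `c` and the nonterminals having most of their neighbors there. -/
def block {κ : Type} (g : E → V × V) (D : V → V → Prop) (A : Set V) (f : V → κ) (c : κ) : Set V :=
  {v | v ∈ A ∧ ((IsTerminal D v ∧ f v = c) ∨ (¬ IsTerminal D v ∧
    ∃ y ∈ A, ∃ z ∈ A, y ≠ z ∧ Nbr g v y ∧ Nbr g v z ∧ f y = c ∧ f z = c))}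

/-- Every nonisolated nonterminal of `A` has two neighbors in `A`. -/
def Rich (g : E → V × V) (D : V → V → Prop) (A : Set V) : Prop :=
  ∀ u ∈ A, ∀ e, ¬ IsTerminal D u → Crosses g {u} e →
    ∃ y ∈ A, ∃ z ∈ A, y ≠ z ∧ Nbr g u y ∧ Nbr g u z

open Classical in
/-- The element to which an edge belongs. -/
noncomputable def owner (g : E → V × V) (D : V → V → Prop) (A : Set V) (e : E) : V ⊕ E :=
  if (g e).1 ∈ A ∧ ¬ IsTerminal D (g e).1 ∧ Proper g e then .inl (g e).1
  else if (g e).2 ∈ A ∧ ¬ IsTerminal D (g e).2 ∧ Proper g e then .inl (g e).2 else .inr e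

theorem crosses_singleton_iff {g : E → V × V} {u : V} {e : E} :
    Crosses g {u} e ↔ Proper g e ∧ (u = (g e).1 ∨ u = (g e).2) := by
  rw [crosses_singleton]
  unfold Proper
  constructor
  · rintro (⟨rfl, h⟩ | ⟨h, rfl⟩)
    exacts [⟨h.symm, Or.inl rfl⟩, ⟨h, Or.inr rfl⟩]
  · rintro ⟨h, rfl | rfl⟩
    exacts [Or.inl ⟨rfl, h.symm⟩, Or.inr ⟨h, rfl⟩]

theorem joins_of_crosses {g : E → V × V} {u v : V} {e : E} (hu : Crosses g {u} e)
    (hv : Crosses g {v} e) (h : u ≠ v) : Joins g e u v := by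
  rw [crosses_singleton_iff] at hu hv
  rcases hu with ⟨-, rfl | rfl⟩ <;> rcases hv with ⟨-, rfl | rfl⟩
  exacts [(h rfl).elim, Or.inl rfl, Or.inr rfl, (h rfl).elim]

theorem Joins.crosses_left {g : E → V × V} {u v : V} {e : E} (h : Joins g e u v) (hne : u ≠ v) :
    Crosses g {u} e := by
  rw [h.crosses]
  simp [hne.symm]

theorem Joins.right_unique {g : E → V × V} {u t t' : V} {e : E} (h : Joins g e u t)
    (h' : Joins g e u t') : t = t' := by
  rcases h with h | h <;> rcases h' with h' | h' <;> rw [h] at h' <;>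
    simp only [Prod.mk.injEq] at h'
  exacts [h'.2, h'.2.trans h'.1, h'.1.trans h'.2, h'.1]

theorem exists_other_end {g : E → V × V} {u : V} {e : E} (h : Crosses g {u} e) :
    ∃ v, v ≠ u ∧ Joins g e u v := by
  rcases crosses_singleton_iff.mp h with ⟨hp, rfl | rfl⟩
  exacts [⟨_, hp.symm, Or.inl rfl⟩, ⟨_, hp, Or.inr rfl⟩]

namespace Reduced

variable {g : E → V × V} {D : V → V → Prop} {A : Set V} {B : Finset E}

theorem nbr_terminal (h : Reduced g D) {u y : V} (hu : ¬ IsTerminal D u) (hy : Nbr g u y) :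
    IsTerminal D y := by
  obtain ⟨hne, e, he⟩ := hy
  have hp : Proper g e := crosses_proper (he.crosses_left hne.symm)
  have := h.terminal e hp
  rcases he with he | he <;> rw [he] at this
  exacts [this.resolve_left hu, this.resolve_right hu]

theorem owner_eq_inl (h : Reduced g D) {e : E} {u : V} :
    owner g D A e = .inl u ↔ u ∈ A ∧ ¬ IsTerminal D u ∧ Crosses g {u} e := by
  rw [crosses_singleton_iff]
  have ht := h.terminal e
  unfold owner
  split_ifs with h1 h2
  · rw [Sum.inl.injEq]
    constructor
    · rintro rfl
      exact ⟨h1.1, h1.2.1, h1.2.2, Or.inl rfl⟩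
    · rintro ⟨-, h2, -, rfl | rfl⟩
      · rfl
      · exact ((ht h1.2.2).elim h1.2.1 h2).elim
  · rw [Sum.inl.injEq]
    constructor
    · rintro rfl
      exact ⟨h2.1, h2.2.1, h2.2.2, Or.inr rfl⟩
    · rintro ⟨-, h3, -, rfl | rfl⟩
      · exact ((ht h2.2.2).elim h3 h2.2.1).elim
      · rfl
  · refine iff_of_false (by simp) ?_
    rintro ⟨hA, hT, hp, rfl | rfl⟩
    exacts [h1 ⟨hA, hT, hp⟩, h2 ⟨hA, hT, hp⟩]

theorem owner_eq_inr (h : Reduced g D) {e e' : E} :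
    owner g D A e = .inr e' ↔ e = e' ∧ ∀ u ∈ A, Crosses g {u} e → IsTerminal D u := by
  constructor
  · intro he
    constructor
    · unfold owner at he
      split_ifs at he
      exact Sum.inr.inj he
    · intro u hu hc
      by_contra hT
      rw [h.owner_eq_inl.mpr ⟨hu, hT, hc⟩] at he
      simp at he
  · rintro ⟨rfl, hu⟩
    rcases ho : owner g D A e with u | e'
    · obtain ⟨hA, hT, hc⟩ := h.owner_eq_inl.mp ho
      exact (hT (hu u hA hc)).elim
    · unfold owner at ho
      split_ifs at ho
      rw [Sum.inr.inj ho]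

theorem mem_touched_owner (h : Reduced g D) {y : V} (hy : y ∈ A) (hT : IsTerminal D y) {e : E}
    (he : Crosses g {y} e) (heB : e ∉ B) : y ∈ touched g D A B (owner g D A e) := by
  rcases ho : owner g D A e with u | e'
  · obtain ⟨hA, hTu, hc⟩ := h.owner_eq_inl.mp ho
    have hne : u ≠ y := fun hc => hTu (hc ▸ hT)
    exact ⟨hy, hA, hTu, hne.symm, e, joins_of_crosses hc he hne⟩
  · obtain ⟨rfl, hu⟩ := h.owner_eq_inr.mp ho
    exact ⟨hy, hT, he, heB, hu⟩

theorem edge_unique (h : Reduced g D) {u y : V} (hu : ¬ IsTerminal D u) (hne : u ≠ y) {e e' : E}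
    (he : Joins g e u y) (he' : Joins g e' u y) : e = e' := by
  have hc := he.crosses_left hne
  have hc' := he'.crosses_left hne
  obtain ⟨e₁, e₂, e₃, t₁, t₂, t₃, h1, h2, h3, h12, h13, h23, -, -, -, hall⟩ := h.cubic u e hu hc
  rcases hall e hc with rfl | rfl | rfl <;> rcases hall e' hc' with rfl | rfl | rfl <;>
    first | rfl | exfalso
  · exact h12 ((h1.right_unique he).trans (h2.right_unique he').symm)
  · exact h13 ((h1.right_unique he).trans (h3.right_unique he').symm)
  · exact h12 ((h1.right_unique he').trans (h2.right_unique he).symm)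
  · exact h23 ((h2.right_unique he).trans (h3.right_unique he').symm)
  · exact h13 ((h1.right_unique he').trans (h3.right_unique he).symm)
  · exact h23 ((h2.right_unique he').trans (h3.right_unique he).symm)

open Classical in
/-- Every edge outside `B` at a terminal belongs to its own element. -/
theorem card_le_touch [Fintype V] [Fintype E] (h : Reduced g D) {y : V} (hy : y ∈ A)
    (hT : IsTerminal D y) : (cut g {y} \ B).card ≤
      (Finset.univ.filter fun a => y ∈ touched g D A B a).card := by
  refine Finset.card_le_card_of_injOn (owner g D A) (fun e he => ?_) (fun e he e' he' hee => ?_)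
  · obtain ⟨h1, h2⟩ := Finset.mem_sdiff.mp he
    exact Finset.mem_filter.mpr ⟨Finset.mem_univ _,
      h.mem_touched_owner hy hT (mem_cut.mp h1) h2⟩
  · have h1 := mem_cut.mp (Finset.mem_sdiff.mp he).1
    have h2 := mem_cut.mp (Finset.mem_sdiff.mp he').1
    rcases ho : owner g D A e with u | e''
    · obtain ⟨-, hTu, hc⟩ := h.owner_eq_inl.mp ho
      obtain ⟨-, -, hc'⟩ := h.owner_eq_inl.mp (hee.symm.trans ho)
      have hne : u ≠ y := fun hc => hTu (hc ▸ hT)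
      exact h.edge_unique hTu hne (joins_of_crosses hc h1 hne) (joins_of_crosses hc' h2 hne)
    · exact (h.owner_eq_inr.mp ho).1.trans (h.owner_eq_inr.mp (hee.symm.trans ho)).1.symm

end Reduced
end Elements

section Counting

open Classical in
theorem sum_labels_le {κ : Type} [Fintype κ] (a b : κ) (o : Option κ) (S : ℕ)
    (hS : S = ∑ c, ((if ((a = c ∧ b = c) ∨ (a = c ∧ o = some c) ∨ (b = c ∧ o = some c) ↔ a = c)
        then 0 else 1) +
      (if ((a = c ∧ b = c) ∨ (a = c ∧ o = some c) ∨ (b = c ∧ o = some c) ↔ b = c) then 0 else 1) +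
      (if ((a = c ∧ b = c) ∨ (a = c ∧ o = some c) ∨ (b = c ∧ o = some c) ↔ o = some c)
        then 0 else 1))) :
    S ≤ 3 ∧ (o = none → S ≤ 2) ∧ (a = b → o = none → S ≤ 1) ∧ (a = b → o = some a → S = 0) ∧
      (a = b ∨ o = some a ∨ o = some b → S ≤ 2) := by
  have one : ∀ a : κ, (∑ c, if a = c then 1 else 0) = 1 := fun a => by simp
  rcases o with _ | d
  · have h1 : S ≤ ∑ c, ((if a = c then 1 else 0) + if b = c then 1 else 0) := by
      rw [hS]
      refine Finset.sum_le_sum fun c _ => ?_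
      by_cases h1 : a = c <;> by_cases h2 : b = c <;> simp [h1, h2]
    rw [Finset.sum_add_distrib, one, one] at h1
    refine ⟨by omega, fun _ => h1, ?_, fun _ h => by simp at h, fun _ => h1⟩
    rintro rfl -
    rw [hS, ← one a]
    refine Finset.sum_le_sum fun c _ => ?_
    by_cases h1 : a = c <;> simp [h1]
  · have h1 : S ≤ ∑ c, (((if a = c then 1 else 0) + if b = c then 1 else 0) +
        if d = c then 1 else 0) := by
      rw [hS]
      refine Finset.sum_le_sum fun c _ => ?_
      by_cases h1 : a = c <;> by_cases h2 : b = c <;> by_cases h3 : d = c <;> simp [h1, h2, h3]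
    rw [Finset.sum_add_distrib, Finset.sum_add_distrib, one, one, one] at h1
    refine ⟨h1, fun h => by simp at h, fun _ h => by simp at h, ?_, ?_⟩
    · rintro rfl h
      obtain rfl := Option.some.inj h
      rw [hS]
      refine Finset.sum_eq_zero fun c _ => ?_
      by_cases h1 : d = c <;> simp [h1]
    · intro h
      have h' : ∃ p q : κ, (a = b ∧ p = a ∧ q = d) ∨ (d = a ∧ p = a ∧ q = b) ∨
          (d = b ∧ p = a ∧ q = b) := by
        rcases h with h | h | h
        · exact ⟨a, d, Or.inl ⟨h, rfl, rfl⟩⟩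
        · exact ⟨a, b, Or.inr (Or.inl ⟨Option.some.inj h, rfl, rfl⟩)⟩
        · exact ⟨a, b, Or.inr (Or.inr ⟨Option.some.inj h, rfl, rfl⟩)⟩
      obtain ⟨p, q, h'⟩ := h'
      have h2 : S ≤ ∑ c, ((if p = c then 1 else 0) + if q = c then 1 else 0) := by
        rw [hS]
        refine Finset.sum_le_sum fun c _ => ?_
        rcases h' with ⟨rfl, rfl, rfl⟩ | ⟨rfl, rfl, rfl⟩ | ⟨rfl, rfl, rfl⟩ <;>
          by_cases h1 : p = c <;> by_cases h2 : q = c <;> simp [h1, h2]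
      rwa [Finset.sum_add_distrib, one, one] at h2

variable {V E κ : Type} {g : E → V × V} {D : V → V → Prop} {A : Set V} {B : Finset E}

theorem mem_block_of_terminal {f : V → κ} {c : κ} {v : V} (hv : IsTerminal D v) :
    v ∈ block g D A f c ↔ v ∈ A ∧ f v = c := by
  simp [block, hv]

open Classical in
/-- The number of blocks crossed by an edge. -/
noncomputable def crossings [Fintype κ] (g : E → V × V) (D : V → V → Prop) (A : Set V) (f : V → κ)
    (e : E) : ℕ := ∑ c, if Crosses g (block g D A f c) e then 1 else 0

theorem crossings_eq_zero [Fintype κ] {f : V → κ} {e : E}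
    (h : ∀ c, ¬ Crosses g (block g D A f c) e) : crossings g D A f e = 0 := by
  classical
  exact Finset.sum_eq_zero fun c _ => if_neg (h c)

open Classical in
theorem crossings_nonterminal_le [Fintype E] [Fintype κ] (hB : B ⊆ cut g A) (f : V → κ) (w : ℕ)
    (hw : 3 ≤ w ∨ 2 ≤ w ∧ Fintype.card κ ≤ 2) {u t₁ t₂ t₃ : V} {e₁ e₂ e₃ : E} (huA : u ∈ A)
    (hu : ¬ IsTerminal D u) (h₁ : Joins g e₁ u t₁) (h₂ : Joins g e₂ u t₂) (h₃ : Joins g e₃ u t₃)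
    (h12 : t₁ ≠ t₂) (h13 : t₁ ≠ t₃) (h23 : t₂ ≠ t₃) (hT₁ : IsTerminal D t₁) (hT₂ : IsTerminal D t₂)
    (hT₃ : IsTerminal D t₃) (hall : ∀ e, Crosses g {u} e → e = e₁ ∨ e = e₂ ∨ e = e₃)
    (hA₁ : t₁ ∈ A) (hA₂ : t₂ ∈ A) :
    crossings g D A f e₁ + crossings g D A f e₂ + crossings g D A f e₃ ≤
      w * (if Links g D A B f (.inl u) then 1 else 0) + (if e₃ ∈ cut g A then 1 else 0) +
        (if e₃ ∈ B then 1 else 0) := by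
  have ne : ∀ {t}, IsTerminal D t → t ≠ u := fun ht hc => hu (hc ▸ ht)
  have nb : ∀ t, Nbr g u t ↔ t = t₁ ∨ t = t₂ ∨ t = t₃ := by
    intro t
    constructor
    · rintro ⟨htu, e, he⟩
      rcases hall e (he.crosses_left htu.symm) with rfl | rfl | rfl
      exacts [Or.inl (he.right_unique h₁), Or.inr (Or.inl (he.right_unique h₂)),
        Or.inr (Or.inr (he.right_unique h₃))]
    · rintro (rfl | rfl | rfl)
      exacts [⟨ne hT₁, _, h₁⟩, ⟨ne hT₂, _, h₂⟩, ⟨ne hT₃, _, h₃⟩]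
  set o : Option κ := if t₃ ∈ A then some (f t₃) else none with ho
  have ho3 : ∀ c, o = some c ↔ t₃ ∈ A ∧ f t₃ = c := by
    intro c
    rw [ho]
    split_ifs with h3 <;> simp [h3]
  have hU : ∀ c, u ∈ block g D A f c ↔ (f t₁ = c ∧ f t₂ = c) ∨ (f t₁ = c ∧ o = some c) ∨
      (f t₂ = c ∧ o = some c) := by
    intro c
    simp only [block, Set.mem_ofPred_eq, huA, hu, false_and, false_or, true_and, not_false_eq_true,
      nb, ho3]
    constructor
    · rintro ⟨y, hy, z, hz, hyz, rfl | rfl | rfl, rfl | rfl | rfl, hfy, hfz⟩ <;> tauto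
    · rintro (⟨a, b⟩ | ⟨a, b, c⟩ | ⟨a, b, c⟩)
      · exact ⟨t₁, hA₁, t₂, hA₂, h12, by tauto⟩
      · exact ⟨t₁, hA₁, t₃, b, h13, by tauto⟩
      · exact ⟨t₂, hA₂, t₃, b, h23, by tauto⟩
  obtain ⟨b1, b2, b3, b4, b5⟩ := sum_labels_le (f t₁) (f t₂) o
    (crossings g D A f e₁ + crossings g D A f e₂ + crossings g D A f e₃) (by
      simp only [crossings, ← Finset.sum_add_distrib]
      refine Finset.sum_congr rfl fun c _ => ?_
      rw [h₁.crosses, h₂.crosses, h₃.crosses, mem_block_of_terminal hT₁, mem_block_of_terminal hT₂,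
        mem_block_of_terminal hT₃, hU, ← ho3]
      simp only [hA₁, hA₂, true_and, ite_not]
      congr 1
      split_ifs <;> rfl)
  have c1 : e₁ ∉ B := fun hc => (h₁.crosses A).mp (mem_cut.mp (hB hc)) (by simp [huA, hA₁])
  have c2 : e₂ ∉ B := fun hc => (h₂.crosses A).mp (mem_cut.mp (hB hc)) (by simp [huA, hA₂])
  have hfree : e₃ ∉ B → IsFree g B (.inl u) := by
    intro h3 e he hc
    rcases hall e hc with rfl | rfl | rfl <;> contradiction
  have link : ∀ {t t'}, IsFree g B (.inl u) → Nbr g u t → Nbr g u t' → t ∈ A → t' ∈ A →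
      f t ≠ f t' → Links g D A B f (.inl u) := fun hf ht ht' hA hA' hne =>
    ⟨hf, _, ⟨hA, huA, hu, ht⟩, _, ⟨hA', huA, hu, ht'⟩, hne⟩
  have n1 := (nb t₁).mpr (by simp)
  have n2 := (nb t₂).mpr (by simp)
  have n3 := (nb t₃).mpr (by simp)
  by_cases hA₃ : t₃ ∈ A
  · have ho' : o = some (f t₃) := (ho3 _).mpr ⟨hA₃, rfl⟩
    have c3 : e₃ ∉ B := fun hc => (h₃.crosses A).mp (mem_cut.mp (hB hc)) (by simp [huA, hA₃])
    have hf := hfree c3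
    by_cases hl : Links g D A B f (.inl u)
    · simp only [hl, if_true, mul_one]
      rcases hw with hw | ⟨hw, hcard⟩
      · omega
      · have : ¬ Function.Injective ![f t₁, f t₂, f t₃] := fun hi => by
          have := Fintype.card_le_of_injective _ hi
          simp at this
          omega
        have h5 : f t₁ = f t₂ ∨ f t₃ = f t₁ ∨ f t₃ = f t₂ := by
          by_contra! hc
          refine this ?_
          intro i j hij
          fin_cases i <;> fin_cases j <;> simp_all
        have := b5 (h5.imp id (Or.imp (fun h => ho'.trans (congrArg some h))
          (fun h => ho'.trans (congrArg some h))))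
        omega
    · have h1 : f t₁ = f t₂ := by
        by_contra hne; exact hl (link hf n1 n2 hA₁ hA₂ hne)
      have h2 : f t₃ = f t₁ := by
        by_contra hne; exact hl (link hf n3 n1 hA₃ hA₁ hne)
      have := b4 h1 (ho'.trans (congrArg some h2))
      omega
  · have ho' : o = none := if_neg hA₃
    have c3 : e₃ ∈ cut g A := mem_cut.mpr ((h₃.crosses A).mpr (by simp [huA, hA₃]))
    simp only [c3, if_true]
    by_cases h1 : f t₁ = f t₂
    · have := b3 h1 ho'
      omega
    · have := b2 ho'
      by_cases c4 : e₃ ∈ B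
      · simp only [c4, if_true]
        omega
      · simp only [link (hfree c4) n1 n2 hA₁ hA₂ h1, if_true]
        omega

open Classical in
/-- The blocks of a labelling of the terminals of a piece have few edges unless many free elements
connect terminals with different labels. -/
theorem Reduced.sum_cutDeg_block_le [Fintype V] [Fintype E] [Fintype κ] (h : Reduced g D)
    (hR : Rich g D A) (hB : B ⊆ cut g A) (f : V → κ) (w : ℕ)
    (hw : 3 ≤ w ∨ 2 ≤ w ∧ Fintype.card κ ≤ 2) :
    ∑ c, cutDeg g (block g D A f c) ≤
      w * (Finset.univ.filter (Links g D A B f)).card + cutDeg g A + B.card := by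
  have e1 : ∑ c, cutDeg g (block g D A f c) = ∑ e, crossings g D A f e := by
    simp only [crossings, cutDeg, cut, Finset.card_filter]
    exact Finset.sum_comm
  have e2 : ∑ a : V ⊕ E, w * (if Links g D A B f a then 1 else 0) =
      w * (Finset.univ.filter (Links g D A B f)).card := by
    rw [Finset.card_filter, Finset.mul_sum]
  have e3 : ∑ e, (if e ∈ cut g A then 1 else 0) = cutDeg g A := by simp [cutDeg]
  have e4 : ∑ e, (if e ∈ B then 1 else 0) = B.card := by simp
  rw [e1, ← e2, ← e3, ← e4]
  rw [← Finset.sum_fiberwise Finset.univ (owner g D A) (crossings g D A f),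
    ← Finset.sum_fiberwise Finset.univ (owner g D A) (fun e => if e ∈ cut g A then 1 else 0),
    ← Finset.sum_fiberwise Finset.univ (owner g D A) (fun e => if e ∈ B then 1 else 0),
    ← Finset.sum_add_distrib, ← Finset.sum_add_distrib]
  refine Finset.sum_le_sum fun a _ => ?_
  rcases a with u | e
  · by_cases hu : ∃ e, owner g D A e = .inl u
    swap
    · rw [Finset.filter_false_of_mem fun e _ he => hu ⟨e, he⟩]
      simp
    obtain ⟨e₀, he₀⟩ := hu
    obtain ⟨huA, huT, hc⟩ := h.owner_eq_inl.mp he₀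
    obtain ⟨e₁, e₂, e₃, t₁, t₂, t₃, h₁, h₂, h₃, h12, h13, h23, hT₁, hT₂, hT₃, hall⟩ :=
      h.cubic u e₀ huT hc
    have ne : ∀ {t}, IsTerminal D t → u ≠ t := fun ht hc => huT (hc ▸ ht)
    have hfib : (Finset.univ.filter fun e => owner g D A e = .inl u) = {e₁, e₂, e₃} := by
      ext e
      simp only [Finset.mem_filter, Finset.mem_univ, true_and, Finset.mem_insert,
        Finset.mem_singleton, h.owner_eq_inl, huA, huT, not_false_eq_true]
      refine ⟨hall e, ?_⟩
      rintro (rfl | rfl | rfl)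
      exacts [h₁.crosses_left (ne hT₁), h₂.crosses_left (ne hT₂), h₃.crosses_left (ne hT₃)]
    have d12 : e₁ ≠ e₂ := by rintro rfl; exact h12 (h₁.right_unique h₂)
    have d13 : e₁ ≠ e₃ := by rintro rfl; exact h13 (h₁.right_unique h₃)
    have d23 : e₂ ≠ e₃ := by rintro rfl; exact h23 (h₂.right_unique h₃)
    have three : ∀ F : E → ℕ, ∑ e ∈ {e₁, e₂, e₃}, F e = F e₁ + F e₂ + F e₃ := by
      intro F
      rw [Finset.sum_insert (by simp [d12, d13]), Finset.sum_insert (by simp [d23]),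
        Finset.sum_singleton, add_assoc]
    rw [hfib, three, three, three]
    obtain ⟨y, hy, z, hz, hyz, ny, nz⟩ := hR u huA e₀ huT hc
    have nb : ∀ {t}, Nbr g u t → t = t₁ ∨ t = t₂ ∨ t = t₃ := by
      rintro t ⟨htu, e, he⟩
      rcases hall e (he.crosses_left htu.symm) with rfl | rfl | rfl
      exacts [Or.inl (he.right_unique h₁), Or.inr (Or.inl (he.right_unique h₂)),
        Or.inr (Or.inr (he.right_unique h₃))]
    have two : (t₁ ∈ A ∧ t₂ ∈ A) ∨ (t₁ ∈ A ∧ t₃ ∈ A) ∨ (t₂ ∈ A ∧ t₃ ∈ A) := by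
      rcases nb ny with rfl | rfl | rfl <;> rcases nb nz with rfl | rfl | rfl <;> tauto
    rcases two with ⟨m, n⟩ | ⟨m, n⟩ | ⟨m, n⟩
    · have := crossings_nonterminal_le hB f w hw huA huT h₁ h₂ h₃ h12 h13 h23 hT₁ hT₂ hT₃ hall m n
      omega
    · have := crossings_nonterminal_le hB f w hw huA huT h₁ h₃ h₂ h13 h12 h23.symm hT₁ hT₃ hT₂
        (fun e he => by have := hall e he; tauto) m n
      omega
    · have := crossings_nonterminal_le hB f w hw huA huT h₂ h₃ h₁ h23 h12.symm h13.symm hT₂ hT₃ hT₁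
        (fun e he => by have := hall e he; tauto) m n
      omega
  · by_cases he : owner g D A e = .inr e
    swap
    · rw [Finset.filter_false_of_mem]
      · simp
      · intro e' _ he'
        obtain ⟨rfl, h'⟩ := h.owner_eq_inr.mp he'
        exact he (h.owner_eq_inr.mpr ⟨rfl, h'⟩)
    have hfib : (Finset.univ.filter fun e' => owner g D A e' = .inr e) = {e} := by
      ext e'
      simp only [Finset.mem_filter, Finset.mem_univ, true_and, Finset.mem_singleton]
      exact ⟨fun h' => (h.owner_eq_inr.mp h').1, fun h' => h' ▸ he⟩
    rw [hfib, Finset.sum_singleton, Finset.sum_singleton, Finset.sum_singleton]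
    have hnt := (h.owner_eq_inr.mp he).2
    by_cases hp : Proper g e
    swap
    · rw [crossings_eq_zero fun c hc => hp (crosses_proper hc)]
      exact Nat.zero_le _
    have hm : ∀ v, Crosses g {v} e → ∀ c, v ∈ block g D A f c ↔ v ∈ A ∧ f v = c := by
      intro v hv c
      by_cases hvA : v ∈ A
      · exact mem_block_of_terminal (hnt v hvA hv)
      · simp [block, hvA]
    have hc1 : Crosses g {(g e).1} e := crosses_singleton_iff.mpr ⟨hp, Or.inl rfl⟩
    have hc2 : Crosses g {(g e).2} e := crosses_singleton_iff.mpr ⟨hp, Or.inr rfl⟩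
    have hcr : crossings g D A f e = ∑ c, if ((g e).1 ∈ A ∧ f (g e).1 = c ↔
        (g e).2 ∈ A ∧ f (g e).2 = c) then 0 else 1 := by
      refine Finset.sum_congr rfl fun c _ => ?_
      unfold Crosses
      rw [hm _ hc1, hm _ hc2]
      split_ifs <;> rfl
    have one : ∀ a : κ, (∑ c, if a = c then 1 else 0) = 1 := fun a => by simp
    rw [hcr]
    by_cases h1 : (g e).1 ∈ A <;> by_cases h2 : (g e).2 ∈ A
    · by_cases hf : f (g e).1 = f (g e).2
      · simp [h1, h2, hf]
      · have heB : e ∉ B := fun hc => mem_cut.mp (hB hc) (iff_of_true h1 h2)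
        have hl : Links g D A B f (.inr e) := ⟨trivial, _, ⟨h1, hnt _ h1 hc1, hc1, heB, hnt⟩, _,
          ⟨h2, hnt _ h2 hc2, hc2, heB, hnt⟩, hf⟩
        have : (∑ c, if ((g e).1 ∈ A ∧ f (g e).1 = c ↔ (g e).2 ∈ A ∧ f (g e).2 = c) then 0 else 1) ≤
            ∑ c, ((if f (g e).1 = c then 1 else 0) + if f (g e).2 = c then 1 else 0) := by
          refine Finset.sum_le_sum fun c _ => ?_
          by_cases k1 : f (g e).1 = c <;> by_cases k2 : f (g e).2 = c <;> simp [h1, h2, k1, k2]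
        rw [Finset.sum_add_distrib, one, one] at this
        simp only [hl, if_true]
        omega
    · have : e ∈ cut g A := mem_cut.mpr fun hc => h2 (hc.mp h1)
      simp [h1, h2, this]
      omega
    · have : e ∈ cut g A := mem_cut.mpr fun hc => h1 (hc.mpr h2)
      simp [h1, h2, this]
      omega
    · simp [h1, h2]

end Counting

section Piece
variable {V E : Type} {g : E → V × V} {D : V → V → Prop} {A : Set V} {B : Finset E} {k : ℕ}

open Classical in
/-- Conditions on the set `A` and the edges `B` leaving it that allow a packing inside `A`. -/
structure Piece [Fintype V] [Fintype E] (k : ℕ) (g : E → V × V) (D : V → V → Prop) (A : Set V)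
    (B : Finset E) : Prop where
  rich : Rich g D A
  sub : B ⊆ cut g A
  small : cutDeg g A ≤ 36 * k
  large : ∀ W ⊆ A, (∃ y ∈ W, IsTerminal D y) → (∃ z ∈ A, z ∉ W ∧ IsTerminal D z) →
    34 * k ≤ cutDeg g W
  links : ∀ C : Set V, (∃ y ∈ A, y ∈ C ∧ IsTerminal D y) → (∃ z ∈ A, z ∉ C ∧ IsTerminal D z) →
    k ≤ (Finset.univ.filter (Links g D A B (· ∈ C))).card
  degree : ∀ y, IsTerminal D y → 36 * k ≤ cutDeg g {y}
  sole : ∀ y ∈ A, IsTerminal D y → (∀ z ∈ A, IsTerminal D z → z = y) → B.card + 4 * k ≤ 36 * k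

theorem Reduced.of_touched (h : Reduced g D) {a : V ⊕ E} {y : V} (hy : y ∈ touched g D A B a) :
    y ∈ A ∧ IsTerminal D y := by
  rcases a with u | e
  · exact ⟨hy.1, h.nbr_terminal hy.2.2.1 hy.2.2.2⟩
  · exact ⟨hy.1, hy.2.1⟩

namespace Piece
variable [Fintype V] [Fintype E]

open Classical in
theorem le_touch (p : Piece k g D A B) (h : Reduced g D) {y z : V} (hy : y ∈ A)
    (hT : IsTerminal D y) (hz : z ∈ A) (hTz : IsTerminal D z) (hne : z ≠ y) :
    17 * k ≤ (Finset.univ.filter fun a => y ∈ touched g D A B a).card := by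
  refine le_trans ?_ (h.card_le_touch hy hT)
  have h1 := cutDeg_erase g hy
  have h2 := p.large (A \ {y}) Set.sdiff_subset ⟨z, ⟨hz, hne⟩, hTz⟩ ⟨y, hy, by simp, hT⟩
  have h3 := p.degree y hT
  have h4 := p.small
  have h5 : between g (A \ {y}) {y} ≤ (cut g {y} \ B).card := by
    unfold between
    refine Finset.card_le_card fun e he => ?_
    simp only [Finset.mem_filter, Finset.mem_univ, true_and] at he
    have hc : Crosses g {y} e := by
      unfold Crosses
      simp only [Set.mem_sdiff, Set.mem_singleton_iff] at he ⊢
      tauto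
    refine Finset.mem_sdiff.mpr ⟨mem_cut.mpr hc, fun hB => mem_cut.mp (p.sub hB) ?_⟩
    rcases he with ⟨he, he'⟩ | ⟨he, he'⟩
    · exact iff_of_true he.1 (he' ▸ hy)
    · exact iff_of_true (he ▸ hy) he'.1
  omega

open Classical in
theorem exists_assignment (p : Piece k g D A B) (h : Reduced g D) :
    ∃ c : V ⊕ E → Option ((Fin k × V × V) ⊕ (V × Fin (4 * k))),
      (∀ a i y z, c a = some (.inl (i, y, z)) →
        IsFree g B a ∧ y ∈ touched g D A B a ∧ z ∈ touched g D A B a ∧ y ≠ z) ∧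
      (∀ a y j, c a = some (.inr (y, j)) → y ∈ touched g D A B a) ∧
      (∀ i (X : Set V), (∀ a y z, c a = some (.inl (i, y, z)) → (y ∈ X ↔ z ∈ X)) →
        ∀ y ∈ A, ∀ z ∈ A, IsTerminal D y → IsTerminal D z → y ∈ X → z ∈ X) ∧
      ∀ y ∈ A, IsTerminal D y → cutDeg g {y} = 36 * k → ∀ j, ∃ a, c a = some (.inr (y, j)) := by
  let τ := {y // y ∈ A ∧ IsTerminal D y}
  let υ := {y : τ // cutDeg g {y.1} = 36 * k}
  have key := exists_packing (ι := V ⊕ E) (τ := τ) (υ := υ) k (4 * k) Subtype.val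
    (fun a => Finset.univ.filter fun y => y.1 ∈ touched g D A B a) (IsFree g B) (by
    intro r Y hY
    set N := Finset.univ.filter fun e : V ⊕ E =>
        (IsFree g B e ∧ ∃ y ∈ Finset.univ.filter fun y : τ => y.1 ∈ touched g D A B e,
          ∃ z ∈ Finset.univ.filter fun y : τ => y.1 ∈ touched g D A B e, ¬ r y z) ∨
        ∃ y ∈ Y, y.1 ∈ Finset.univ.filter fun y : τ => y.1 ∈ touched g D A B e with hN
    suffices hcount : k * Fintype.card (Quotient r) + 4 * k * Y.card ≤ k + N.card by
      convert hcount
    have linked : ∀ {κ : Type} (f : V → κ), (∀ y z : τ, r y z → f y.1 = f z.1) →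
        (Finset.univ.filter (Links g D A B f)).card ≤ N.card := by
      intro κ f hf
      refine Finset.card_le_card fun a ha => ?_
      obtain ⟨h1, y, hy, z, hz, hyz⟩ := (Finset.mem_filter.mp ha).2
      exact Finset.mem_filter.mpr ⟨Finset.mem_univ _, Or.inl ⟨h1, ⟨y, h.of_touched hy⟩, by simpa,
        ⟨z, h.of_touched hz⟩, by simpa, fun hr => hyz (hf _ _ hr)⟩⟩
    have touch : ∀ y ∈ Y, (Finset.univ.filter fun a => y.1.1 ∈ touched g D A B a).card ≤
        N.card := by
      intro y hy
      refine Finset.card_le_card fun a ha => ?_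
      exact Finset.mem_filter.mpr ⟨Finset.mem_univ _, Or.inr ⟨y, hy, by simpa using ha⟩⟩
    have hcard : Y.card ≤ Fintype.card (Quotient r) := by
      rw [← Finset.card_univ]
      refine Finset.card_le_card_of_injOn (fun y => (⟦y.1⟧ : Quotient r))
        (fun _ _ => Finset.mem_univ _) fun y hy y' _ hyy => ?_
      exact (Subtype.ext (hY y hy _ (Quotient.exact hyy))).symm
    have hB : B.card ≤ 36 * k := (Finset.card_le_card p.sub).trans p.small
    have other : ∀ y : τ, 2 ≤ Fintype.card (Quotient r) → ∃ z : τ, ¬ r y z := by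
      intro y ht
      obtain ⟨q, hq⟩ := Fintype.exists_ne_of_one_lt_card ht (⟦y⟧ : Quotient r)
      induction q using Quotient.inductionOn with | _ z =>
      exact ⟨z, fun hr => hq (Quotient.sound hr).symm⟩
    have htouch : 2 ≤ Fintype.card (Quotient r) → Y.Nonempty → 17 * k ≤ N.card := by
      rintro ht ⟨y, hy⟩
      obtain ⟨z, hz⟩ := other y.1 ht
      exact (p.le_touch h y.1.2.1 y.1.2.2 z.2.1 z.2.2
        fun hc => hz (Subtype.ext hc ▸ r.refl _)).trans (touch y hy)
    have hmany : 2 ≤ Fintype.card (Quotient r) →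
        34 * (k * Fintype.card (Quotient r)) ≤ 3 * N.card + 72 * k := by
      intro ht
      let f : V → Option (Quotient r) := fun v =>
        if hv : v ∈ A ∧ IsTerminal D v then some ⟦⟨v, hv⟩⟧ else none
      have hf : ∀ y : τ, f y.1 = some ⟦y⟧ := fun y => dif_pos y.2
      have h1 := h.sum_cutDeg_block_le p.rich p.sub f 3 (Or.inl le_rfl)
      have h2 := linked f fun y z hr => by rw [hf, hf, Quotient.sound hr]
      rw [Fintype.sum_option] at h1
      have h3 : ∑ q : Quotient r, 34 * k ≤ ∑ q, cutDeg g (block g D A f (some q)) := by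
        refine Finset.sum_le_sum fun q _ => ?_
        induction q using Quotient.inductionOn with | _ y =>
        obtain ⟨z, hz⟩ := other y ht
        refine p.large _ (fun _ hv => hv.1) ⟨y, ⟨y.2.1, Or.inl ⟨y.2.2, hf y⟩⟩, y.2.2⟩
          ⟨z, z.2.1, fun hc => ?_, z.2.2⟩
        have := ((mem_block_of_terminal z.2.2).mp hc).2
        rw [hf, Option.some.injEq] at this
        exact hz (r.symm (Quotient.exact this))
      have h4 := p.small
      rw [Finset.sum_const, Finset.card_univ, smul_eq_mul] at h3
      have h5 : Fintype.card (Quotient r) * (34 * k) = 34 * (k * Fintype.card (Quotient r)) := by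
        ring
      omega
    have hY0 : Y.card = 0 ∨ Y.Nonempty := by
      rcases Y.eq_empty_or_nonempty with rfl | h
      exacts [Or.inl rfl, Or.inr h]
    rw [mul_assoc]
    rcases lt_or_ge (Fintype.card (Quotient r)) 4 with ht | ht
    · interval_cases ht' : Fintype.card (Quotient r)
      · simp only [Nat.le_zero.mp hcard]
        omega
      · rcases hY0 with hY0 | ⟨y, hy⟩
        · rw [hY0]
          omega
        · have h1 := touch y hy
          have h2 := h.card_le_touch (B := B) y.1.2.1 y.1.2.2
          have h3 := Finset.le_card_sdiff B (cut g {y.1.1})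
          have h4 := p.degree _ y.1.2.2
          have h5 := p.sole _ y.1.2.1 y.1.2.2 fun z hz hTz => by
            have := hY y hy ⟨z, hz, hTz⟩ (Quotient.exact ((Fintype.card_le_one_iff.mp ht'.le) _ _))
            exact congrArg Subtype.val this
          have h6 : k * Y.card ≤ k * 1 := Nat.mul_le_mul_left _ hcard
          unfold cutDeg at h4
          omega
      · have h6 : k * Y.card ≤ k * 2 := Nat.mul_le_mul_left _ hcard
        rcases hY0 with hY0 | hY0
        · rw [hY0]
          obtain ⟨q⟩ : Nonempty (Quotient r) := Fintype.card_pos_iff.mp (by omega)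
          induction q using Quotient.inductionOn with | _ y =>
          obtain ⟨z, hz⟩ := other y le_rfl
          have h1 := p.links {v | ∃ hv : v ∈ A ∧ IsTerminal D v, r y ⟨v, hv⟩}
            ⟨y, y.2.1, ⟨y.2, r.refl _⟩, y.2.2⟩ ⟨z, z.2.1, fun ⟨_, hc⟩ => hz hc, z.2.2⟩
          have h2 := linked (· ∈ {v | ∃ hv : v ∈ A ∧ IsTerminal D v, r y ⟨v, hv⟩})
            fun u v huv => propext ⟨fun ⟨_, hc⟩ => ⟨v.2, r.trans hc huv⟩,
              fun ⟨_, hc⟩ => ⟨u.2, r.trans hc (r.symm huv)⟩⟩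
          omega
        · have := htouch le_rfl hY0
          omega
      · have h6 : k * Y.card ≤ k * 3 := Nat.mul_le_mul_left _ hcard
        rcases hY0 with hY0 | hY0
        · have := hmany (by omega)
          rw [hY0]
          omega
        · have := htouch (by omega) hY0
          omega
    · have h6 : k * Y.card ≤ k * Fintype.card (Quotient r) := Nat.mul_le_mul_left _ hcard
      have h7 : k * 4 ≤ k * Fintype.card (Quotient r) := Nat.mul_le_mul_left _ ht
      have := hmany (by omega)
      omega)
  obtain ⟨c, h1, h2, h3, h4⟩ := key
  refine ⟨fun a => (c a).map (Sum.map (fun x => (x.1, x.2.1.1, x.2.2.1))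
    fun x => (x.1.1.1, x.2)), ?_, ?_, ?_, ?_⟩
  · intro a i y z ha
    rw [Option.map_eq_some_iff] at ha
    obtain ⟨⟨i', y', z'⟩ | ⟨y', j⟩, ha, hv⟩ := ha
    · simp only [Sum.map_inl, Sum.inl.injEq, Prod.mk.injEq] at hv
      obtain ⟨rfl, rfl, rfl⟩ := hv
      obtain ⟨r1, r2, r3, r4⟩ := h1 _ _ _ _ ha
      exact ⟨r1, (Finset.mem_filter.mp r2).2, (Finset.mem_filter.mp r3).2,
        fun hc => r4 (Subtype.ext hc)⟩
    · simp at hv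
  · intro a y j ha
    rw [Option.map_eq_some_iff] at ha
    obtain ⟨⟨i', y', z'⟩ | ⟨y', j⟩, ha, hv⟩ := ha
    · simp at hv
    · simp only [Sum.map_inr, Sum.inr.injEq, Prod.mk.injEq] at hv
      obtain ⟨rfl, rfl⟩ := hv
      exact (Finset.mem_filter.mp (h2 _ _ _ ha)).2
  · intro i X hX y hy z hz hTy hTz hyX
    have := h3 i {v | v.1 ∈ X} (fun a y' z' ha => by
      simpa using hX a y'.1 z'.1 (by simp [ha])) ⟨y, hy, hTy⟩ ⟨z, hz, hTz⟩ (by simpa using hyX)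
    simpa using this
  · intro y hy hT hd j
    obtain ⟨a, ha⟩ := h4 ⟨⟨y, hy, hT⟩, hd⟩ j
    exact ⟨a, by simp [ha]⟩

end Piece
end Piece

section PiecePacking
variable {V E : Type} [Fintype E] {g : E → V × V} {D : V → V → Prop} {A : Set V}
  {B : Finset E} {k : ℕ}

theorem Reduced.exists_edge_of_touched (h : Reduced g D) (hB : B ⊆ cut g A) {a : V ⊕ E} {y : V}
    (hy : y ∈ touched g D A B a) : ∃ e, owner g D A e = a ∧ Crosses g {y} e ∧ e ∉ B ∧
      ∀ u, a = .inl u → Joins g e u y := by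
  rcases a with u | e
  · obtain ⟨hyA, huA, hu, hne, e, he⟩ := hy
    refine ⟨e, h.owner_eq_inl.mpr ⟨huA, hu, he.crosses_left hne.symm⟩, ?_, fun hc => ?_, ?_⟩
    · rw [he.crosses]
      simp [hne.symm]
    · exact (he.crosses A).mp (mem_cut.mp (hB hc)) (iff_of_true huA hyA)
    · rintro _ ⟨⟩
      exact he
  · obtain ⟨-, -, hc, heB, hT⟩ := hy
    exact ⟨e, h.owner_eq_inr.mpr ⟨rfl, hT⟩, hc, heB, fun _ h => by simp at h⟩

theorem Reduced.boundary_unique (h : Reduced g D) (hR : Rich g D A) {u : V} (huA : u ∈ A)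
    (hu : ¬ IsTerminal D u) {e e' : E} (he : e ∈ cut g A) (he' : e' ∈ cut g A)
    (hc : Crosses g {u} e) (hc' : Crosses g {u} e') : e = e' := by
  obtain ⟨y, hy, z, hz, hyz, ⟨hyu, a, ha⟩, ⟨hzu, b, hb⟩⟩ := hR u huA e hu hc
  have hab : a ≠ b := by
    rintro rfl
    exact hyz (ha.right_unique hb)
  have na : a ∉ cut g A := fun hm => (ha.crosses A).mp (mem_cut.mp hm) (iff_of_true huA hy)
  have nb : b ∉ cut g A := fun hm => (hb.crosses A).mp (mem_cut.mp hm) (iff_of_true huA hz)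
  have h1 : e ≠ a := fun hh => na (hh ▸ he)
  have h2 : e ≠ b := fun hh => nb (hh ▸ he)
  have h3 : e' ≠ a := fun hh => na (hh ▸ he')
  have h4 : e' ≠ b := fun hh => nb (hh ▸ he')
  obtain ⟨e₁, e₂, e₃, -, -, -, -, -, -, -, -, -, -, -, -, hall⟩ := h.cubic u e hu hc
  have k1 := hall e hc
  have k2 := hall e' hc'
  have k3 := hall a (ha.crosses_left hyu.symm)
  have k4 := hall b (hb.crosses_left hzu.symm)
  grind

open Classical in
/-- The edges of color `i` determined by an assignment `c` of the elements and a choice `hub` of a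
terminal for every nonterminal. -/
noncomputable def colored (g : E → V × V) (D : V → V → Prop) (A : Set V) (P : Fin k → Finset E)
    (c : V ⊕ E → Option ((Fin k × V × V) ⊕ (V × Fin (4 * k)))) (hub : V → V) (i : Fin k) :
    Finset E :=
  Finset.univ.filter fun e => (g e).1 ∈ A ∧ (g e).2 ∈ A ∧
    ((∃ y z, c (owner g D A e) = some (.inl (i, y, z)) ∧ (Crosses g {y} e ∨ Crosses g {z} e)) ∨
      ∃ u, owner g D A e = .inl u ∧ Crosses g {hub u} e ∧ ∃ e₀ ∈ P i, Crosses g {u} e₀)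

open Classical in
theorem Piece.exists_isPacking [Fintype V] {P : Fin k → Finset E}
    (p : Piece k g D A (Finset.univ.biUnion P)) (h : Reduced g D) (hD : ∀ u v, D u v → D v u)
    (hP : ∀ i j, i ≠ j → Disjoint (P i) (P j)) : ∃ J, IsPacking g D A P J := by
  obtain ⟨c, c1, c2, c3, c4⟩ := p.exists_assignment h
  have hPB : ∀ i, P i ⊆ Finset.univ.biUnion P := fun i =>
    Finset.subset_biUnion_of_mem P (Finset.mem_univ i)
  have hub : ∀ u, ∃ y, u ∈ A → ¬ IsTerminal D u → (∃ e, Crosses g {u} e) →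
      y ∈ A ∧ Nbr g u y ∧ ∀ z j, c (.inl u) = some (.inr (z, j)) → y ≠ z := by
    intro u
    by_cases hu : u ∈ A ∧ ¬ IsTerminal D u ∧ ∃ e, Crosses g {u} e
    · obtain ⟨huA, hT, e, he⟩ := hu
      obtain ⟨y, hy, z, hz, hyz, ny, nz⟩ := p.rich u huA e hT he
      by_cases hc : ∃ j, c (.inl u) = some (.inr (y, j))
      · obtain ⟨j, hj⟩ := hc
        refine ⟨z, fun _ _ _ => ⟨hz, nz, fun w j' hw => ?_⟩⟩
        rw [hj] at hw
        simp only [Option.some.injEq, Sum.inr.injEq, Prod.mk.injEq] at hw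
        exact hw.1 ▸ hyz.symm
      · refine ⟨y, fun _ _ _ => ⟨hy, ny, ?_⟩⟩
        rintro w j hw rfl
        exact hc ⟨j, hw⟩
    · exact ⟨u, fun h1 h2 h3 => (hu ⟨h1, h2, h3⟩).elim⟩
  choose hub hhub using hub
  have mem : ∀ {i e}, e ∈ colored g D A P c hub i ↔ (g e).1 ∈ A ∧ (g e).2 ∈ A ∧
      ((∃ y z, c (owner g D A e) = some (.inl (i, y, z)) ∧ (Crosses g {y} e ∨ Crosses g {z} e)) ∨
      ∃ u, owner g D A e = .inl u ∧ Crosses g {hub u} e ∧ ∃ e₀ ∈ P i, Crosses g {u} e₀) := by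
    intro i e
    simp [colored]
  have ends : ∀ {e u y}, Joins g e u y → u ∈ A → y ∈ A → (g e).1 ∈ A ∧ (g e).2 ∈ A := by
    rintro e u y (he | he) hu hy <;> rw [he]
    exacts [⟨hu, hy⟩, ⟨hy, hu⟩]
  have terminals : ∀ i, ∀ u ∈ A, ∀ v ∈ A, IsTerminal D u → IsTerminal D v →
      CutConn g (colored g D A P c hub i) u v := by
    intro i u hu v hv hTu hTv X hX
    have key : ∀ a y z, c a = some (.inl (i, y, z)) → (y ∈ X ↔ z ∈ X) := by
      intro a y z ha
      obtain ⟨-, hy, hz, hyz⟩ := c1 _ _ _ _ ha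
      obtain ⟨e, heo, hey, -, hej⟩ := h.exists_edge_of_touched p.sub hy
      obtain ⟨e', heo', hez, -, hej'⟩ := h.exists_edge_of_touched p.sub hz
      rcases a with w | a
      · have n1 := hX e (mem.mpr ⟨(ends (hej w rfl) hy.2.1 hy.1).1,
          (ends (hej w rfl) hy.2.1 hy.1).2, Or.inl ⟨y, z, heo ▸ ha, Or.inl hey⟩⟩)
        have n2 := hX e' (mem.mpr ⟨(ends (hej' w rfl) hz.2.1 hz.1).1,
          (ends (hej' w rfl) hz.2.1 hz.1).2, Or.inl ⟨y, z, heo' ▸ ha, Or.inr hez⟩⟩)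
        rw [(hej w rfl).crosses, not_not] at n1
        rw [(hej' w rfl).crosses, not_not] at n2
        exact n1.symm.trans n2
      · obtain ⟨rfl, -⟩ := h.owner_eq_inr.mp heo
        obtain ⟨rfl, -⟩ := h.owner_eq_inr.mp heo'
        have hj := joins_of_crosses hey hez hyz
        have n1 := hX e' (mem.mpr ⟨(ends hj hy.1 hz.1).1, (ends hj hy.1 hz.1).2,
          Or.inl ⟨y, z, heo ▸ ha, Or.inl hey⟩⟩)
        rwa [hj.crosses, not_not] at n1
    exact ⟨c3 i X key u hu v hv hTu hTv, c3 i X key v hv u hu hTv hTu⟩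
  refine ⟨colored g D A P c hub, ?_, ?_, ?_, ?_, ?_⟩
  · intro i e he
    obtain ⟨h1, h2, h3⟩ := mem.mp he
    refine ⟨h1, h2, ?_⟩
    rcases h3 with ⟨_, _, -, h3 | h3⟩ | ⟨_, -, h3, -⟩ <;> exact crosses_proper h3
  · intro i j hij
    refine Finset.disjoint_left.mpr fun e he he' => hij ?_
    obtain ⟨-, -, h1⟩ := mem.mp he
    obtain ⟨-, -, h2⟩ := mem.mp he'
    have clash : ∀ {i j u y z}, c (.inl u) = some (.inl (j, y, z)) →
        ¬ ∃ e₀ ∈ P i, Crosses g {u} e₀ := fun hc ⟨e₀, he₀, hu⟩ =>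
      (c1 _ _ _ _ hc).1 e₀ (hPB _ he₀) hu
    rcases h1 with ⟨y, z, hc, -⟩ | ⟨u, hu, -, hc⟩ <;>
      rcases h2 with ⟨y', z', hc', -⟩ | ⟨u', hu', -, hc'⟩
    · rw [hc] at hc'
      simp only [Option.some.injEq, Sum.inl.injEq, Prod.mk.injEq] at hc'
      exact hc'.1
    · exact (clash (hu' ▸ hc) hc').elim
    · exact (clash (hu ▸ hc') hc).elim
    · obtain rfl := Sum.inl.inj (hu.symm.trans hu')
      obtain ⟨e₀, h0, h1⟩ := hc
      obtain ⟨e₀', h0', h1'⟩ := hc'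
      obtain ⟨huA, hT, -⟩ := h.owner_eq_inl.mp hu
      obtain rfl := h.boundary_unique p.rich huA hT (p.sub (hPB _ h0)) (p.sub (hPB _ h0')) h1 h1'
      by_contra hne
      exact Finset.disjoint_left.mp (hP i j hne) h0 h0'
  · intro i u hu v hv huv
    by_cases hne : u = v
    · exact hne ▸ CutConn.refl _ _ _
    · exact terminals i u hu v hv ⟨v, Ne.symm hne, huv⟩ ⟨u, hne, hD _ _ huv⟩
  · intro i _ a b ha hb
    have key : ∀ a, Good g D A (P i) a → ∃ y ∈ A, IsTerminal D y ∧
        CutConn g (colored g D A P c hub i) a y := by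
      rintro a ⟨haA, ha⟩
      by_cases hT : IsTerminal D a
      · exact ⟨a, haA, hT, CutConn.refl _ _ _⟩
      rcases ha with ⟨e₀, he₀, ha⟩ | ⟨w, hw, haw⟩
      · have hc : Crosses g {a} e₀ := crosses_singleton_iff.mpr
          ⟨crosses_proper (mem_cut.mp (p.sub (hPB _ he₀))), ha⟩
        obtain ⟨hy, hn, -⟩ := hhub a haA hT ⟨e₀, hc⟩
        refine ⟨hub a, hy, h.nbr_terminal hT hn, fun X hX => ?_⟩
        obtain ⟨hne, e, he⟩ := hn
        have := hX e (mem.mpr ⟨(ends he haA hy).1, (ends he haA hy).2, Or.inr ⟨a,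
          h.owner_eq_inl.mpr ⟨haA, hT, he.crosses_left hne.symm⟩,
          by rw [he.crosses]; simp [hne.symm],
          e₀, he₀, hc⟩⟩)
        rwa [he.crosses, not_not] at this
      · exact (hT ⟨w, fun hc => hw (hc ▸ haA), haw⟩).elim
    obtain ⟨y, hy, hTy, hay⟩ := key a ha
    obtain ⟨z, hz, hTz, hbz⟩ := key b hb
    exact (hay.trans (terminals i y hy z hz hTy hTz)).trans hbz.symm
  · intro y hy hT hd
    choose a ha using c4 y hy hT hd
    choose e he using fun j => h.exists_edge_of_touched p.sub (c2 _ _ _ (ha j))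
    have hinj : Function.Injective e := by
      intro j j' hjj
      have h1 : a j = a j' := by rw [← (he j).1, ← (he j').1, hjj]
      have h2 := ha j
      rw [h1, ha j'] at h2
      simpa using h2.symm
    rw [← Fintype.card_fin (4 * k), ← Finset.card_univ]
    refine Finset.card_le_card_of_injOn e (fun j _ => ?_) hinj.injOn
    obtain ⟨ho, hc, heB, hj⟩ := he j
    refine Finset.mem_sdiff.mpr ⟨mem_cut.mpr hc, fun hm => ?_⟩
    obtain ⟨i, -, hm⟩ := Finset.mem_biUnion.mp hm
    rcases Finset.mem_union.mp hm with hm | hm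
    · obtain ⟨-, -, ⟨y', z', hc', -⟩ | ⟨u, hu, hu', -⟩⟩ := mem.mp hm
      · rw [ho, ha] at hc'
        simp at hc'
      · obtain ⟨huA, huT, hue⟩ := h.owner_eq_inl.mp hu
        obtain ⟨-, ⟨hne, -⟩, hz⟩ := hhub u huA huT ⟨_, hue⟩
        have hau : a j = .inl u := ho.symm.trans hu
        have h1 := joins_of_crosses hue hu' hne.symm
        exact hz y j (hau ▸ ha j) (h1.right_unique (hj u hau))
    · exact heB (hPB i hm)

end PiecePacking

section Reduction
variable {V E : Type} [Fintype E] {k : ℕ} {g : E → V × V} {D : V → V → Prop} {x : V}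
  {P : Fin k → Finset E}

/-- An instance that cannot be made smaller by collapsing a tight set, deleting an edge or splitting
off a pair of edges is reduced. -/
theorem exists_packing_or_reduced [Finite V] (hk : 0 < k) (h : Admissible g D x P)
    (ih : SmallerSolvable k g x) : (∃ J, IsPacking g D {x}ᶜ P J) ∨ Reduced g D := by
  classical
  by_contra! hno
  obtain ⟨hJ, hR⟩ := hno
  have hJ : ¬ ∃ J, IsPacking g D {x}ᶜ P J := fun ⟨J, hj⟩ => hJ J hj
  have tight : ∀ X, Splits D X → cutDeg g X = 36 * k →
      ¬ ((∃ e, Proper g e ∧ (g e).1 ∈ X ∧ (g e).2 ∈ X) ∧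
        ∃ e, Proper g e ∧ (g e).1 ∉ X ∧ (g e).2 ∉ X) :=
    fun X hs hd hc => hJ (exists_packing_of_tight h ih hs hd hc.1 hc.2)
  have tight_end : ∀ e, Proper g e →
      ∃ y, (y = (g e).1 ∨ y = (g e).2) ∧ IsTerminal D y ∧ cutDeg g {y} = 36 * k := by
    intro e he
    refine exists_tight_end h.symm h.conn tight ?_
    by_contra! hc
    exact hJ (exists_packing_of_uncut h ih he hc)
  refine hR ⟨fun e he => ?_, fun u e hu hc => ?_⟩
  · obtain ⟨y, rfl | rfl, hT, -⟩ := tight_end e he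
    exacts [Or.inl hT, Or.inr hT]
  · have hux : u ≠ x := by
      rintro rfl
      rcases h.root with h0 | ⟨hT, -⟩
      · exact (cutDeg_pos_of_crosses hc).ne' h0
      · exact hu hT
    have stuck : Stuck k g D u := by
      refine ⟨hk, h.symm, h.conn, tight, hu, ?_, ?_⟩
      · rintro t ⟨htu, e', he'⟩
        obtain ⟨y, hy, hT, hd⟩ := tight_end e' (crosses_proper (he'.crosses_left htu.symm))
        rcases (he'.end_iff y).mp hy with rfl | rfl
        exacts [(hu hT).elim, ⟨hT, hd⟩]
      · rintro t v ⟨htu, e₁, h₁⟩ ⟨hvu, e₂, h₂⟩ htv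
        have hne : e₁ ≠ e₂ := by
          rintro rfl
          exact htv (h₁.right_unique h₂)
        by_contra! hX
        refine hJ ?_
        by_cases hvx : v = x
        · exact exists_packing_of_splitOff h ih h₂ h₁ hne.symm hu hux (hvx ▸ htv) htv.symm hvu.symm
            htu.symm fun X hs hsX hvX htX => hX X hs hsX htX hvX
        · exact exists_packing_of_splitOff h ih h₁ h₂ hne hu hux hvx htv htu.symm
            hvu.symm fun X hs hsX htX hvX => hX X hs hsX htX hvX
    rcases stuck.cutDeg_eq with h0 | ⟨h3, t₁, t₂, t₃, n₁, n₂, n₃, h12, h13, h23⟩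
    · exact ((cutDeg_pos_of_crosses hc).ne' h0).elim
    obtain ⟨hu₁, e₁, j₁⟩ := id n₁
    obtain ⟨hu₂, e₂, j₂⟩ := id n₂
    obtain ⟨hu₃, e₃, j₃⟩ := id n₃
    refine ⟨e₁, e₂, e₃, t₁, t₂, t₃, j₁, j₂, j₃, h12, h13, h23, (stuck.nbr _ n₁).1,
      (stuck.nbr _ n₂).1, (stuck.nbr _ n₃).1, ?_⟩
    have d12 : e₁ ≠ e₂ := by rintro rfl; exact h12 (j₁.right_unique j₂)
    have d13 : e₁ ≠ e₃ := by rintro rfl; exact h13 (j₁.right_unique j₃)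
    have d23 : e₂ ≠ e₃ := by rintro rfl; exact h23 (j₂.right_unique j₃)
    have hsub : {e₁, e₂, e₃} ⊆ cut g {u} := by
      intro e' he'
      simp only [Finset.mem_insert, Finset.mem_singleton] at he'
      rcases he' with rfl | rfl | rfl
      exacts [mem_cut.mpr (j₁.crosses_left hu₁.symm), mem_cut.mpr (j₂.crosses_left hu₂.symm),
        mem_cut.mpr (j₃.crosses_left hu₃.symm)]
    have heq := Finset.eq_of_subset_of_card_le hsub (by
      rw [Finset.card_insert_of_notMem (by simp [d12, d13]),
        Finset.card_insert_of_notMem (by simp [d23]), Finset.card_singleton]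
      exact h3.le)
    intro e' he'
    have := heq ▸ mem_cut.mpr he'
    simpa using this

end Reduction

section Core
variable {V E : Type} [Fintype V] [Fintype E] {k : ℕ} {g : E → V × V} {D : V → V → Prop} {x : V}
  {P : Fin k → Finset E}

open Classical in
/-- Collapsing a piece. -/
theorem exists_packing_of_piece (h : Admissible g D x P) (ih : SmallerSolvable k g x)
    (hr : Reduced g D) {A : Set V} (hx : x ∉ A) (hR : Rich g D A) (hd : cutDeg g A < 36 * k)
    (hT : ∃ y ∈ A, IsTerminal D y)
    (large : ∀ W ⊆ A, (∃ y ∈ W, IsTerminal D y) → (∃ z ∈ A, z ∉ W ∧ IsTerminal D z) →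
      34 * k ≤ cutDeg g W)
    (links : ∀ B ⊆ cut g A, ∀ C : Set V, (∃ y ∈ A, y ∈ C ∧ IsTerminal D y) →
      (∃ z ∈ A, z ∉ C ∧ IsTerminal D z) →
      k ≤ (Finset.univ.filter (Links g D A B (· ∈ C))).card) :
    ∃ J, IsPacking g D {x}ᶜ P J := by
  have deg : ∀ y, IsTerminal D y → 36 * k ≤ cutDeg g {y} := fun y hy =>
    h.conn _ (splits_singleton.mpr hy)
  have other : ∀ y ∈ A, IsTerminal D y → ∃ z ∈ A, IsTerminal D z ∧ z ≠ y := by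
    rintro y hy ⟨w, hw, hD⟩
    refine ⟨w, ?_, ⟨y, hw.symm, h.symm _ _ hD⟩, hw⟩
    by_contra hwA
    exact hd.not_ge (h.conn A ⟨y, hy, w, hwA, hD⟩)
  obtain ⟨y, hy, hTy⟩ := hT
  have hp : ∃ e, Proper g e ∧ (g e).1 ∈ A ∧ (g e).2 ∈ A := by
    obtain ⟨e, he, heA⟩ := Finset.exists_mem_notMem_of_card_lt_card (hd.trans_le (deg y hTy))
    rw [mem_cut] at he heA
    refine ⟨e, crosses_proper he, ?_⟩
    unfold Crosses at heA
    rw [not_not] at heA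
    rcases (crosses_singleton_iff.mp he).2 with rfl | rfl
    exacts [⟨hy, heA.mp hy⟩, ⟨heA.mpr hy, hy⟩]
  refine exists_packing_of_collapse h ih hx hy hp fun J hJ => ?_
  have hsub : (Finset.univ.biUnion fun i => (J i ∪ P i) ∩ cut g A) ⊆ cut g A :=
    Finset.biUnion_subset.mpr fun _ _ => Finset.inter_subset_right
  refine Piece.exists_isPacking ⟨hR, hsub, hd.le, large, links _ hsub, deg, ?_⟩ hr h.symm
    (hJ.trace_disjoint h hx)
  intro y hy hTy hsole
  obtain ⟨z, hz, hTz, hne⟩ := other y hy hTy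
  exact (hne (hsole z hz hTz)).elim

open Classical in
theorem exists_packing_of_large (h : Admissible g D x P) (hr : Reduced g D)
    (large : ∀ W, x ∉ W → (∃ y ∈ W, IsTerminal D y) → 34 * k ≤ cutDeg g W) :
    ∃ J, IsPacking g D {x}ᶜ P J := by
  have hsub : Finset.univ.biUnion P ⊆ cut g {x}ᶜ := by
    rw [cut_compl]
    exact Finset.biUnion_subset.mpr fun i _ => h.sub i
  have hcard := Finset.card_le_card hsub
  have hcc := cutDeg_compl g {x}
  have hR : Rich g D {x}ᶜ := by
    intro u hu e hT hc
    obtain ⟨e₁, e₂, e₃, t₁, t₂, t₃, h1, h2, h3, h12, h13, h23, T1, T2, T3, -⟩ := hr.cubic u e hT hc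
    have nb : ∀ {e t}, Joins g e u t → IsTerminal D t → Nbr g u t := fun hj ht =>
      ⟨fun hc => hT (hc ▸ ht), _, hj⟩
    by_cases x1 : t₁ = x
    · exact ⟨t₂, fun hc => h12 (x1.trans hc.symm), t₃, fun hc => h13 (x1.trans hc.symm), h23,
        nb h2 T2, nb h3 T3⟩
    by_cases x2 : t₂ = x
    · exact ⟨t₁, x1, t₃, fun hc => h23 (x2.trans hc.symm), h13, nb h1 T1, nb h3 T3⟩
    · exact ⟨t₁, x1, t₂, x2, h12, nb h1 T1, nb h2 T2⟩
  refine Piece.exists_isPacking ⟨hR, hsub, ?_, ?_, ?_, ?_, ?_⟩ hr h.symm h.disj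
  · rw [hcc]
    rcases h.root with h0 | ⟨-, h0, -⟩ <;> omega
  · intro W hW hy _
    exact large W (fun hc => hW hc rfl) hy
  · rintro C ⟨y, hy, hyC, hTy⟩ ⟨z, hz, hzC, hTz⟩
    have h1 := hr.sum_cutDeg_block_le hR hsub (· ∈ C) 2 (Or.inr ⟨le_rfl, by simp⟩)
    have hxb : ∀ p : Prop, x ∉ block g D {x}ᶜ (· ∈ C) p := fun p hc => hc.1 rfl
    have b1 := large _ (hxb True) ⟨y, (mem_block_of_terminal hTy).mpr ⟨hy, eq_true hyC⟩, hTy⟩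
    have b2 := large _ (hxb False) ⟨z, (mem_block_of_terminal hTz).mpr ⟨hz, eq_false hzC⟩, hTz⟩
    rw [Fintype.univ_Prop, Finset.sum_pair (by simp)] at h1
    rcases h.root with h0 | ⟨⟨w, hwx, hxw⟩, h0, h2⟩
    · unfold cutDeg at *
      omega
    · have hTw : IsTerminal D w := ⟨x, hwx.symm, h.symm _ _ hxw⟩
      have b3 := h.conn (block g D {x}ᶜ (· ∈ C) (w ∈ C)) ⟨w,
        (mem_block_of_terminal hTw).mpr ⟨hwx, rfl⟩, x, hxb _, h.symm _ _ hxw⟩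
      by_cases hwC : w ∈ C
      · rw [eq_true hwC] at b3
        omega
      · rw [eq_false hwC] at b3
        omega
  · exact fun y hy => h.conn _ (splits_singleton.mpr hy)
  · intro y _ _ _
    rcases h.root with h0 | ⟨-, -, h2⟩
    · unfold cutDeg at *
      omega
    · exact h2

end Core

section Main
variable {V E : Type} {k : ℕ} {g : E → V × V} {D : V → V → Prop} {x : V}
  {P : Fin k → Finset E}

/-- A minimal core is rich. -/
theorem Reduced.rich_of_minimal [Fintype E] (hr : Reduced g D) {X : Set V} {n : ℕ}
    (hX : Minimal (fun X => x ∉ X ∧ (∃ y ∈ X, IsTerminal D y) ∧ cutDeg g X < n) X) :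
    Rich g D X := by
  classical
  intro u hu e hT hc
  by_contra! hno
  obtain ⟨hx, ⟨y, hy, hTy⟩, hd⟩ := hX.prop
  have h1 := cutDeg_erase g hu
  have h2 : between g (X \ {u}) {u} ≤ 1 := by
    have key : ∀ e, (((g e).1 ∈ X \ {u} ∧ (g e).2 ∈ ({u} : Set V)) ∨
        ((g e).1 ∈ ({u} : Set V) ∧ (g e).2 ∈ X \ {u})) → ∃ y ∈ X, y ≠ u ∧ Joins g e u y := by
      rintro e (⟨h1, h2⟩ | ⟨h1, h2⟩)
      · exact ⟨_, h1.1, h1.2, Or.inr (Prod.ext rfl h2)⟩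
      · exact ⟨_, h2.1, h2.2, Or.inl (Prod.ext h1 rfl)⟩
    refine Finset.card_le_one.mpr fun a ha b hb => ?_
    simp only [Finset.mem_filter, Finset.mem_univ, true_and] at ha hb
    obtain ⟨y, hy, hyu, hj⟩ := key a ha
    obtain ⟨z, hz, hzu, hj'⟩ := key b hb
    have hyz : y = z := by
      by_contra hyz
      exact hno y hy z hz hyz ⟨hyu, a, hj⟩ ⟨hzu, b, hj'⟩
    subst hyz
    exact hr.edge_unique hT hyu.symm hj hj'
  have h3 : 2 ≤ cutDeg g {u} := by
    obtain ⟨e₁, e₂, -, t₁, t₂, -, j1, j2, -, h12, -, -, T1, T2, -⟩ := hr.cubic u e hT hc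
    refine Finset.one_lt_card.mpr ⟨e₁, mem_cut.mpr (j1.crosses_left fun hc => hT (hc ▸ T1)), e₂,
      mem_cut.mpr (j2.crosses_left fun hc => hT (hc ▸ T2)), ?_⟩
    rintro rfl
    exact h12 (j1.right_unique j2)
  have h4 := hX.le_of_le (y := X \ {u}) ⟨fun hc => hx hc.1,
    ⟨y, ⟨hy, fun hc => hT (Set.mem_singleton_iff.mp hc ▸ hTy)⟩, hTy⟩, by omega⟩ Set.sdiff_subset
  exact (h4 hu).2 rfl

theorem Reduced.rich_block {κ : Type} (hr : Reduced g D) {A : Set V} {f : V → κ} {c : κ} :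
    Rich g D (block g D A f c) := by
  rintro u ⟨-, hu⟩ e hT -
  obtain ⟨-, y, hy, z, hz, hyz, ny, nz, fy, fz⟩ := hu.resolve_left fun hc => hT hc.1
  exact ⟨y, (mem_block_of_terminal (hr.nbr_terminal hT ny)).mpr ⟨hy, fy⟩, z,
    (mem_block_of_terminal (hr.nbr_terminal hT nz)).mpr ⟨hz, fz⟩, hyz, ny, nz⟩

theorem Links.mono {κ : Type} {A : Set V} {B B' : Finset E} (hB : B ⊆ B') {f : V → κ} {a : V ⊕ E}
    (h : Links g D A B' f a) : Links g D A B f a := by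
  obtain ⟨hf, y, hy, z, hz, hyz⟩ := h
  have sub : ∀ y, y ∈ touched g D A B' a → y ∈ touched g D A B a := by
    intro y hy
    rcases a with u | e
    · exact hy
    · exact ⟨hy.1, hy.2.1, hy.2.2.1, fun hc => hy.2.2.2.1 (hB hc), hy.2.2.2.2⟩
  refine ⟨?_, y, sub y hy, z, sub z hz, hyz⟩
  rcases a with u | e
  · exact fun e he => hf e (hB he)
  · trivial

open Classical in
/-- An element connecting terminals of different labels either connects the two sides of `C` or is
an element of the block of `C`. -/
theorem Reduced.links_block [Fintype E] (hr : Reduced g D) {X C C' : Set V} {B : Finset E}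
    (hB : B ⊆ cut g (block g D X (· ∈ C) True)) {a : V ⊕ E}
    (ha : Links g D X (cut g X) (fun v => if v ∈ C then some (v ∈ C') else none) a) :
    Links g D X (cut g X) (· ∈ C) a ∨ Links g D (block g D X (· ∈ C) True) B (· ∈ C') a := by
  refine or_iff_not_imp_left.mpr fun hno => ?_
  obtain ⟨hf, y, hy, z, hz, hyz⟩ := ha
  have same : ∀ w, w ∈ touched g D X (cut g X) a → (y ∈ C ↔ w ∈ C) := by
    intro w hw
    by_contra hc
    exact hno ⟨hf, y, hy, w, hw, fun h => hc h.to_iff⟩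
  have hyC : y ∈ C := by
    by_contra hc
    have : z ∉ C := fun h => hc ((same z hz).mpr h)
    simp [hc, this] at hyz
  have inC : ∀ w, w ∈ touched g D X (cut g X) a → w ∈ C := fun w hw => (same w hw).mp hyC
  have inA : ∀ w, w ∈ touched g D X (cut g X) a → w ∈ block g D X (· ∈ C) True := fun w hw =>
    (mem_block_of_terminal (hr.of_touched hw).2).mpr ⟨(hr.of_touched hw).1, eq_true (inC w hw)⟩
  have hne : (y ∈ C') ≠ (z ∈ C') := by
    simpa [hyC, inC z hz] using hyz
  have hyz' : y ≠ z := fun hc => hne (hc ▸ rfl)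
  rcases a with u | e
  · obtain ⟨hyX, huX, hT, hn⟩ := id hy
    have huA : u ∈ block g D X (· ∈ C) True := ⟨huX, Or.inr ⟨hT, y, hyX, z, hz.1, hyz', hn,
      hz.2.2.2, eq_true hyC, eq_true (inC z hz)⟩⟩
    refine ⟨fun e he hc => ?_, y, ⟨inA y hy, huA, hT, hn⟩, z, ⟨inA z hz, huA, hT, hz.2.2.2⟩, hne⟩
    obtain ⟨v, hvu, hj⟩ := exists_other_end hc
    have hvX : v ∈ X := by
      by_contra hvX
      exact hf e (mem_cut.mpr ((hj.crosses X).mpr (by simp [huX, hvX]))) hc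
    exact (hj.crosses _).mp (mem_cut.mp (hB he))
      (iff_of_true huA (inA v ⟨hvX, huX, hT, hvu, e, hj⟩))
  · have heB : e ∉ B := fun hc => ((joins_of_crosses hy.2.2.1 hz.2.2.1 hyz').crosses _).mp
      (mem_cut.mp (hB hc)) (iff_of_true (inA y hy) (inA z hz))
    have hall : ∀ u ∈ block g D X (· ∈ C) True, Crosses g {u} e → IsTerminal D u := fun u hu =>
      hy.2.2.2.2 u hu.1
    exact ⟨trivial, y, ⟨inA y hy, hy.2.1, hy.2.2.1, heB, hall⟩, z,
      ⟨inA z hz, hz.2.1, hz.2.2.1, heB, hall⟩, hne⟩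

open Classical in
theorem exists_packing_of_reduced [Fintype V] [Fintype E] (h : Admissible g D x P)
    (ih : SmallerSolvable k g x) (hr : Reduced g D) : ∃ J, IsPacking g D {x}ᶜ P J := by
  by_cases large : ∀ W, x ∉ W → (∃ y ∈ W, IsTerminal D y) → 34 * k ≤ cutDeg g W
  · exact exists_packing_of_large h hr large
  push Not at large
  obtain ⟨X, hX⟩ := exists_minimal_of_wellFoundedLT
    (fun X => x ∉ X ∧ (∃ y ∈ X, IsTerminal D y) ∧ cutDeg g X < 34 * k)
    (by obtain ⟨W, h1, h2, h3⟩ := large; exact ⟨W, h1, h2, h3⟩)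
  obtain ⟨hx, hT, hd⟩ := hX.prop
  have hR := hr.rich_of_minimal hX
  have large : ∀ W ⊆ X, (∃ y ∈ W, IsTerminal D y) → (∃ z ∈ X, z ∉ W) → 34 * k ≤ cutDeg g W := by
    rintro W hW hy ⟨z, hz, hzW⟩
    by_contra! hc
    exact hzW (hX.le_of_le ⟨fun hc => hx (hW hc), hy, hc⟩ hW hz)
  by_cases links : ∀ C : Set V, (∃ y ∈ X, y ∈ C ∧ IsTerminal D y) →
      (∃ z ∈ X, z ∉ C ∧ IsTerminal D z) →
      k ≤ (Finset.univ.filter (Links g D X (cut g X) (· ∈ C))).card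
  · refine exists_packing_of_piece h ih hr hx hR (by omega) hT
      (fun W hW hy ⟨z, hz, hzW, _⟩ => large W hW hy ⟨z, hz, hzW⟩) fun B hB C hy hz => ?_
    exact (links C hy hz).trans (Finset.card_le_card
      (Finset.monotone_filter_right _ fun a _ ha => ha.mono hB))
  push Not at links
  obtain ⟨C, ⟨y, hy, hyC, hTy⟩, ⟨z, hz, hzC, hTz⟩, hlow⟩ := links
  have hsub : ∀ {κ : Type} (f : V → κ) c, block g D X f c ⊆ X := fun f c v hv => hv.1
  have hyA : y ∈ block g D X (· ∈ C) True := (mem_block_of_terminal hTy).mpr ⟨hy, eq_true hyC⟩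
  have hzA : z ∉ block g D X (· ∈ C) True := fun hc =>
    hzC (of_eq_true ((mem_block_of_terminal hTz).mp hc).2)
  have hlarge : 34 * k ≤ cutDeg g (block g D X (· ∈ C) False) :=
    large _ (hsub _ _) ⟨z, (mem_block_of_terminal hTz).mpr ⟨hz, eq_false hzC⟩, hTz⟩
      ⟨y, hy, fun hc => (of_eq_false ((mem_block_of_terminal hTy).mp hc).2) hyC⟩
  have hsum := hr.sum_cutDeg_block_le hR (Finset.Subset.refl (cut g X)) (· ∈ C) 2
    (Or.inr ⟨le_rfl, by simp⟩)
  rw [Fintype.univ_Prop, Finset.sum_pair (by simp)] at hsum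
  change _ ≤ _ + cutDeg g X at hsum
  refine exists_packing_of_piece h ih hr (fun hc => hx hc.1) hr.rich_block (by omega)
    ⟨y, hyA, hTy⟩
    (fun W hW hy _ => large W (hW.trans (hsub _ _)) hy ⟨z, hz, fun hc => hzA (hW hc)⟩) ?_
  rintro B hB C' ⟨p, hp, hpC, hTp⟩ ⟨q, hq, hqC, hTq⟩
  have hpC' : p ∈ C := of_eq_true ((mem_block_of_terminal hTp).mp hp).2
  have hqC' : q ∈ C := of_eq_true ((mem_block_of_terminal hTq).mp hq).2
  let f : V → Option Prop := fun v => if v ∈ C then some (v ∈ C') else none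
  have fp : f p = some True := by simp [f, hpC', hpC]
  have fq : f q = some False := by simp [f, hqC', hqC]
  have fz : f z = none := by simp [f, hzC]
  have label : ∀ {v c}, IsTerminal D v → f v ≠ c → v ∉ block g D X f c := fun hv hne hc =>
    hne ((mem_block_of_terminal hv).mp hc).2
  have hsum' := hr.sum_cutDeg_block_le hR (Finset.Subset.refl (cut g X)) f 3 (Or.inl le_rfl)
  rw [Fintype.sum_option, Fintype.univ_Prop, Finset.sum_pair (by simp)] at hsum'
  change _ ≤ _ + cutDeg g X at hsum'
  have b1 := large _ (hsub f none) ⟨z, (mem_block_of_terminal hTz).mpr ⟨hz, fz⟩, hTz⟩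
    ⟨p, hp.1, label hTp (by simp [fp])⟩
  have b2 := large _ (hsub f (some True)) ⟨p, (mem_block_of_terminal hTp).mpr ⟨hp.1, fp⟩, hTp⟩
    ⟨z, hz, label hTz (by simp [fz])⟩
  have b3 := large _ (hsub f (some False)) ⟨q, (mem_block_of_terminal hTq).mpr ⟨hq.1, fq⟩, hTq⟩
    ⟨z, hz, label hTz (by simp [fz])⟩
  have hcard : (Finset.univ.filter (Links g D X (cut g X) f)).card ≤
      (Finset.univ.filter (Links g D X (cut g X) (· ∈ C))).card +
        (Finset.univ.filter (Links g D (block g D X (· ∈ C) True) B (· ∈ C'))).card := by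
    refine (Finset.card_le_card fun a ha => ?_).trans (Finset.card_union_le _ _)
    rw [Finset.mem_union, Finset.mem_filter, Finset.mem_filter]
    exact (hr.links_block hB (Finset.mem_filter.mp ha).2).imp (⟨Finset.mem_univ _, ·⟩)
      (⟨Finset.mem_univ _, ·⟩)
  omega

theorem Admissible.exists_isPacking [Fintype V] [Fintype E] (hk : 0 < k)
    (h : Admissible g D x P) :
    ∃ J, IsPacking g D {x}ᶜ P J := by
  induction hn : properCount g using Nat.strong_induction_on generalizing g D P with
  | _ n ih =>
    have ih' : SmallerSolvable k g x := fun g' D' P' hlt h' => ih _ (hn ▸ hlt) h' rfl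
    exact (exists_packing_or_reduced hk h ih').elim id (exists_packing_of_reduced h ih')

end Main

section Multigraph
variable {V E : Type}

/-- A walk from `u ∈ X` to `v ∉ X` has an edge crossing `X`. -/
theorem IsWalk.exists_crossing {ends : E → Sym2 V} {X : Set V} {u v : V} {l : List E}
    (h : IsWalk ends u v l) (hu : u ∈ X) (hv : v ∉ X) :
    ∃ e ∈ l, ∃ a ∈ X, ∃ b ∉ X, ends e = s(a, b) := by
  induction h with
  | nil => exact (hv hu).elim
  | @cons u w v e l he _ ih =>
    by_cases hw : w ∈ X
    · obtain ⟨e', he', h'⟩ := ih hw hv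
      exact ⟨e', List.mem_cons_of_mem _ he', h'⟩
    · exact ⟨e, List.mem_cons_self, u, hu, w, hw, he⟩

/-- The pair of ends of an edge, in the vertex set extended by an isolated vertex `none`. -/
noncomputable def orientedEnds (ends : E → Sym2 V) (e : E) : Option V × Option V :=
  (some (ends e).out.1, some (ends e).out.2)

theorem crosses_orientedEnds_iff {ends : E → Sym2 V} {X : Set (Option V)} {e : E} :
    Crosses (orientedEnds ends) X e ↔
      ∃ a b, some a ∈ X ∧ some b ∉ X ∧ ends e = s(a, b) := by
  have hout : ends e = s((ends e).out.1, (ends e).out.2) := (Quot.out_eq (ends e)).symm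
  unfold Crosses orientedEnds
  constructor
  · intro h
    by_cases h1 : some (ends e).out.1 ∈ X
    · exact ⟨_, _, h1, fun h2 => h (iff_of_true h1 h2), hout⟩
    · refine ⟨_, _, ?_, h1, hout.trans Sym2.eq_swap⟩
      by_contra h2
      exact h (iff_of_false h1 h2)
  · rintro ⟨a, b, ha, hb, he⟩ h
    rcases Sym2.eq_iff.mp (hout.symm.trans he) with ⟨h1, h2⟩ | ⟨h1, h2⟩
    · rw [h1, h2] at h
      exact hb (h.mp ha)
    · rw [h1, h2] at h
      exact hb (h.mpr ha)

/-- The demands of a family of sets: vertices of a common set have to be connected. -/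
def familyDem {ι : Type} (S : ι → Set V) (u v : Option V) : Prop :=
  ∃ i, ∃ a ∈ S i, ∃ b ∈ S i, u = some a ∧ v = some b

theorem le_cutDeg_orientedEnds [Fintype E] {ι : Type} {ends : E → Sym2 V} {S : ι → Set V} {n : ℕ}
    (hconn : ∀ i, EdgeConnectedIn ends Set.univ (S i) n) {X : Set (Option V)}
    (hX : Splits (familyDem S) X) : n ≤ cutDeg (orientedEnds ends) X := by
  obtain ⟨_, hu, _, hv, i, a, ha, b, hb, rfl, rfl⟩ := hX
  obtain ⟨P, hP, hd⟩ := hconn i a ha b hb fun hab => hv (hab ▸ hu)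
  choose f hf c hc d hd' he using fun j =>
    (hP j).1.exists_crossing (X := {w | some w ∈ X}) hu hv
  have hinj : Function.Injective f := by
    intro j j' hjj
    by_contra hne
    exact hd j j' hne (f j) (hf j) (hjj ▸ hf j')
  simpa [cutDeg] using Finset.card_le_card_of_injOn f (s := Finset.univ)
    (t := cut (orientedEnds ends) X)
    (fun j _ => mem_cut.mpr (crosses_orientedEnds_iff.mpr ⟨c j, d j, hc j, hd' j, he j⟩))
    hinj.injOn

theorem reaches_of_cutConn {ends : E → Sym2 V} {F : Finset E} {a b : V}
    (h : CutConn (orientedEnds ends) F (some a) (some b)) : Reaches ends F a b := by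
  have hX := h {w | ∃ c, w = some c ∧ Reaches ends F a c} fun e he hc => by
    obtain ⟨c, d, ⟨c', hcc, hr⟩, hd, hcd⟩ := crosses_orientedEnds_iff.mp hc
    obtain rfl := Option.some_inj.mp hcc
    exact hd ⟨d, rfl, hr.tail ⟨e, he, hcd⟩⟩
  obtain ⟨c, hbc, hr⟩ := hX.mp ⟨a, rfl, Relation.ReflTransGen.refl⟩
  exact Option.some_inj.mp hbc ▸ hr

end Multigraph

/-- If `G` is a loopless multigraph and `S 1, …, S h` are
pairwise vertex-disjoint subsets of `V(G)`, each `36k`-edge-connected in `G`,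
then there exist `k` pairwise edge-disjoint `S`-forests in `G`, i.e. `k`
pairwise edge-disjoint subgraphs in each of which every `S i` is connected. -/
theorem steiner_forest_packing {V E : Type} [Fintype V] [Fintype E]
    (ends : E → Sym2 V) (hG : Loopless ends)
    (k h : ℕ) (hk : 0 < k) (S : Fin h → Set V)
    (hdisj : ∀ i j, i ≠ j → Disjoint (S i) (S j))
    (hconn : ∀ i, EdgeConnectedIn ends Set.univ (S i) (36 * k)) :
    ∃ H : Fin k → Set E, PairwiseEdgeDisjoint H ∧
      ∀ j : Fin k, ∀ i : Fin h, ConnectsSet ends (H j) (S i) := by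
  have hadm : Admissible (k := k) (orientedEnds ends) (familyDem S) none fun _ => ∅ :=
    { symm := fun u v ⟨i, a, ha, b, hb, hu, hv⟩ => ⟨i, b, hb, a, ha, hv, hu⟩
      conn := fun X hX => le_cutDeg_orientedEnds hconn hX
      sub := fun _ => Finset.empty_subset _
      disj := fun _ _ _ => Finset.disjoint_empty_left _
      root := Or.inl (Finset.card_eq_zero.mpr (Finset.eq_empty_of_forall_notMem fun e he => by
        obtain ⟨a, _, ha, -⟩ := crosses_orientedEnds_iff.mp (mem_cut.mp he)
        exact Option.some_ne_none a ha)) }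
  obtain ⟨J, hJ⟩ := hadm.exists_isPacking hk
  refine ⟨fun j => J j, fun i j hij => Finset.disjoint_coe.mpr (hJ.disj i j hij), ?_⟩
  intro j i a ha b hb
  exact reaches_of_cutConn (hJ.dem j _ (Option.some_ne_none a) _ (Option.some_ne_none b)
    ⟨i, a, ha, b, hb, rfl, rfl⟩)

end SteinerPacking
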